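/- Let d be a positive integer and q a prime power with q > 56 d^2. If q is prime, or if q is a perfect square coprime to d, then there exists an elliptic curve over F_q of defect d, i.e. with exactly q + 1 + floor(2 sqrt(q)) − d rational points. -/

import Mathlib

namespace St16

open Filter Topology

/-- `f` agrees near `z` (punctured) with a function analytic at `z`. -/
def RA (f : ℂ → ℂ) (z : ℂ) : Prop := ∃ g : ℂ → ℂ, AnalyticAt ℂ g z ∧ f =ᶠ[𝓝[≠] z] g

lemma RA.of_analytic {f : ℂ → ℂ} {z : ℂ} (h : AnalyticAt ℂ f z) : RA f z :=
  ⟨f, h, EventuallyEq.rfl⟩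

lemma RA.mul {f g : ℂ → ℂ} {z : ℂ} (hf : RA f z) (hg : RA g z) : RA (fun x => f x * g x) z := by
  obtain ⟨a, ha, ha'⟩ := hf
  obtain ⟨b, hb, hb'⟩ := hg
  exact ⟨fun x => a x * b x, ha.mul hb, ha'.mul hb'⟩

lemma RA.add {f g : ℂ → ℂ} {z : ℂ} (hf : RA f z) (hg : RA g z) : RA (fun x => f x + g x) z := by
  obtain ⟨a, ha, ha'⟩ := hf
  obtain ⟨b, hb, hb'⟩ := hg
  exact ⟨fun x => a x + b x, ha.add hb, ha'.add hb'⟩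

lemma RA.sub {f g : ℂ → ℂ} {z : ℂ} (hf : RA f z) (hg : RA g z) : RA (fun x => f x - g x) z := by
  obtain ⟨a, ha, ha'⟩ := hf
  obtain ⟨b, hb, hb'⟩ := hg
  exact ⟨fun x => a x - b x, ha.sub hb, ha'.sub hb'⟩

lemma RA.shift {f : ℂ → ℂ} {z c : ℂ} (hf : RA f (z + c)) : RA (fun x => f (x + c)) z := by
  obtain ⟨a, ha, ha'⟩ := hf
  refine ⟨fun x => a (x + c), ?_, ?_⟩
  · exact AnalyticAt.comp' (f := fun x => x + c) ha (by fun_prop)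
  · have : Tendsto (fun x : ℂ => x + c) (𝓝[≠] z) (𝓝[≠] (z + c)) := by
      refine tendsto_nhdsWithin_of_tendsto_nhds_of_eventually_within _ ?_ ?_
      · exact (Continuous.tendsto (by fun_prop) z).mono_left nhdsWithin_le_nhds
      · filter_upwards [self_mem_nhdsWithin] with x hx
        simpa using hx
    exact this.eventually ha'

lemma eq_of_nhdsNE {f g : ℂ → ℂ} {a : ℂ} (hf : ContinuousAt f a) (hg : ContinuousAt g a)
    (h : ∀ᶠ z in 𝓝[≠] a, f z = g z) : f a = g a :=
  tendsto_nhds_unique_of_eventuallyEq (hf.tendsto.mono_left nhdsWithin_le_nhds)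
    (hg.tendsto.mono_left nhdsWithin_le_nhds) h

/-- Liouville for periodic functions. -/
lemma liouville (L : PeriodPair) (f : ℂ → ℂ) (hper : ∀ z, ∀ l ∈ L.lattice, f (z + l) = f z)
    (hR : ∀ z, RA f z) : ∃ c, ∀ z, ContinuousAt f z → f z = c := by
  choose G hG hfG using hR
  let F : ℂ → ℂ := fun z => G z z
  have hlim : ∀ z, Tendsto f (𝓝[≠] z) (𝓝 (F z)) := fun z =>
    ((hG z).continuousAt.tendsto.mono_left nhdsWithin_le_nhds).congr' (hfG z).symm
  have hFG : ∀ z, F =ᶠ[𝓝 z] G z := by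
    intro z
    have h1 : ∀ᶠ y in 𝓝[≠] z, ∀ᶠ x in 𝓝[≠] y, f x = G z x := by
      have := (eventually_eventually_nhdsWithin (a := z) (s := {z}ᶜ)).2 (hfG z)
      filter_upwards [this, self_mem_nhdsWithin] with y hy hyz
      have hn : 𝓝[≠] y ≤ 𝓝[≠] z ⊔ 𝓝 y := le_sup_of_le_right nhdsWithin_le_nhds
      have : 𝓝[{z}ᶜ] y = 𝓝 y := (isOpen_compl_singleton.nhdsWithin_eq hyz)
      rw [this] at hy
      exact hy.filter_mono nhdsWithin_le_nhds
    have h2 : ∀ᶠ y in 𝓝 z, AnalyticAt ℂ (G z) y := (hG z).eventually_analyticAt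
    rw [eventually_nhdsWithin_iff] at h1
    filter_upwards [h1, h2] with y hy hy2
    by_cases hyz : y = z
    · subst hyz; rfl
    · have := hy hyz
      exact tendsto_nhds_unique_of_eventuallyEq (hlim y)
        (hy2.continuousAt.tendsto.mono_left nhdsWithin_le_nhds) this
  have hFd : Differentiable ℂ F := fun z =>
    ((hG z).congr (hFG z).symm).differentiableAt
  have hFper : ∀ z, ∀ l ∈ L.lattice, F (z + l) = F z := by
    intro z l hl
    have t : Tendsto (fun x : ℂ => x + l) (𝓝[≠] z) (𝓝[≠] (z + l)) := by
      refine tendsto_nhdsWithin_of_tendsto_nhds_of_eventually_within _ ?_ ?_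
      · exact (Continuous.tendsto (by fun_prop) z).mono_left nhdsWithin_le_nhds
      · filter_upwards [self_mem_nhdsWithin] with x hx
        simpa using hx
    have := (hlim (z + l)).comp t
    exact tendsto_nhds_unique_of_eventuallyEq this (hlim z)
      (Eventually.of_forall fun x => hper x l hl)
  refine ⟨F 0, fun z hz => ?_⟩
  have h1 : f z = F z := tendsto_nhds_unique (hz.tendsto.mono_left nhdsWithin_le_nhds) (hlim z)
  rw [h1]
  exact hFd.apply_eq_apply_of_bounded
    (IsZLattice.isCompact_range_of_periodic L.lattice F hFd.continuous hFper).isBounded z 0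

end St16


namespace St16

open Filter Topology

lemma double_zero {u : ℂ → ℂ} {a : ℂ} (hu : AnalyticAt ℂ u a) (h0 : u a = 0)
    (h1 : deriv u a = 0) :
    ∃ v : ℂ → ℂ, AnalyticAt ℂ v a ∧ ∀ᶠ z in 𝓝 a, u z = (z - a) ^ 2 * v z := by
  have : ((2 : ℕ) : ℕ∞) ≤ analyticOrderAt u a := by
    rw [natCast_le_analyticOrderAt_iff_iteratedDeriv_eq_zero hu]
    intro i hi
    interval_cases i
    · simpa using h0
    · simpa [iteratedDeriv_one] using h1
  rw [natCast_le_analyticOrderAt hu] at this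
  simpa using this

section
variable (L : PeriodPair)

lemma P_near_zero : ∃ E : ℂ → ℂ, AnalyticAt ℂ E 0 ∧
    ∀ z, L.weierstrassP z = 1 / z ^ 2 + E z := by
  refine ⟨L.weierstrassPExcept 0, L.analyticAt_weierstrassPExcept 0, fun z => ?_⟩
  have := L.weierstrassPExcept_add (0 : L.lattice) z
  simp at this
  rw [← this]; simp; ring

lemma P_add {l : ℂ} (hl : l ∈ L.lattice) (z : ℂ) : L.weierstrassP (z + l) = L.weierstrassP z :=
  L.weierstrassP_add_coe z ⟨l, hl⟩

lemma P'_add {l : ℂ} (hl : l ∈ L.lattice) (z : ℂ) :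
    L.derivWeierstrassP (z + l) = L.derivWeierstrassP z :=
  L.derivWeierstrassP_add_coe z ⟨l, hl⟩

lemma P_congr {a b : ℂ} (h : a - b ∈ L.lattice) : L.weierstrassP a = L.weierstrassP b := by
  rw [← P_add L h b]; congr 1; ring

lemma P_congr_neg {a b : ℂ} (h : a + b ∈ L.lattice) : L.weierstrassP a = L.weierstrassP b := by
  rw [← L.weierstrassP_neg b]; apply P_congr; simpa using h

lemma P'_congr {a b : ℂ} (h : a - b ∈ L.lattice) :
    L.derivWeierstrassP a = L.derivWeierstrassP b := by
  rw [← P'_add L h b]; congr 1; ring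

lemma P_an {z : ℂ} (hz : z ∉ L.lattice) : AnalyticAt ℂ L.weierstrassP z :=
  L.analyticOnNhd_weierstrassP z hz

lemma P_an_comp {f : ℂ → ℂ} {z : ℂ} (hf : AnalyticAt ℂ f z) (hz : f z ∉ L.lattice) :
    AnalyticAt ℂ (fun x => L.weierstrassP (f x)) z :=
  AnalyticAt.fun_comp (P_an L hz) hf

lemma RA_of_periodic {f : ℂ → ℂ} (hper : ∀ z, ∀ l ∈ L.lattice, f (z + l) = f z) {z l : ℂ}
    (hl : l ∈ L.lattice) (h : RA f (z + l)) : RA f z := by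
  have := RA.shift h
  have e : (fun x => f (x + l)) = f := funext fun x => hper x l hl
  rwa [e] at this

lemma P_ne_eventually (c : ℂ) : ∀ᶠ z in 𝓝[≠] (0 : ℂ), L.weierstrassP z ≠ c := by
  have h : meromorphicOrderAt L.weierstrassP 0 < 0 := by
    rw [L.order_weierstrassP 0 (zero_mem _)]; decide
  have := tendsto_cobounded_of_meromorphicOrderAt_neg h
  exact this.eventually (Bornology.eventually_ne_cobounded c)

/-- eventually off the lattice -/
lemma eventually_notMem (a : ℂ) : ∀ᶠ z in 𝓝[≠] a, z ∉ L.lattice := by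
  have := L.compl_lattice_sdiff_singleton_mem_nhds a
  filter_upwards [nhdsWithin_le_nhds this, self_mem_nhdsWithin] with z hz hz2 h
  exact hz ⟨h, hz2⟩

lemma eventually_nhds_notMem {a : ℂ} (ha : a ∉ L.lattice) : ∀ᶠ z in 𝓝 a, z ∉ L.lattice :=
  L.isClosed_lattice.isOpen_compl.mem_nhds ha

lemma isPreconnected_compl : IsPreconnected ((L.lattice : Set ℂ)ᶜ) := by
  have hc : (L.lattice : Set ℂ).Countable := by
    have : Countable L.lattice := L.latticeEquivProd.toEquiv.countable_iff.2 inferInstance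
    exact Set.countable_coe_iff.1 this
  exact (hc.isPathConnected_compl_of_one_lt_rank (by simp)).isConnected.isPreconnected

lemma not_eventually_const {a : ℂ} (ha : a ∉ L.lattice) (c : ℂ) :
    ¬ ∀ᶠ z in 𝓝 a, L.weierstrassP z = c := by
  intro h
  have h1 : Set.EqOn L.weierstrassP (fun _ => c) (L.lattice : Set ℂ)ᶜ :=
    L.analyticOnNhd_weierstrassP.eqOn_of_preconnected_of_eventuallyEq analyticOnNhd_const
      (isPreconnected_compl L) ha h
  have := (P_ne_eventually L c).and (eventually_notMem L 0)
  obtain ⟨z, hz, hz'⟩ := this.exists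
  exact hz (h1 hz')

/-- pole of `℘` times a double zero. -/
lemma RA_P_mul {u : ℂ → ℂ} {l : ℂ} (hl : l ∈ L.lattice) (hu : AnalyticAt ℂ u l) (h0 : u l = 0)
    (h1 : deriv u l = 0) : RA (fun z => L.weierstrassP z * u z) l := by
  obtain ⟨v, hv, huv⟩ := double_zero hu h0 h1
  obtain ⟨E, hE, hP⟩ := P_near_zero L
  refine ⟨fun z => v z + E (z - l) * u z, ?_, ?_⟩
  · refine hv.add (AnalyticAt.mul ?_ hu)
    exact AnalyticAt.fun_comp (f := fun z => z - l) (by simpa using hE) (by fun_prop)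
  · filter_upwards [nhdsWithin_le_nhds huv, self_mem_nhdsWithin] with z hz hzl
    have hzl' : z - l ≠ 0 := sub_ne_zero.2 hzl
    rw [← P_congr L (a := z - l) (b := z) (by simpa using hl), hP]
    rw [add_mul]; congr 1
    rw [hz]; field_simp

/-- even elliptic functions with at most a double pole at the lattice -/
lemma even_double (f K : ℂ → ℂ) (hper : ∀ z, ∀ l ∈ L.lattice, f (z + l) = f z)
    (heven : ∀ z, f (-z) = f z) (hR : ∀ z, z ∉ L.lattice → RA f z) (hK : AnalyticAt ℂ K 0)
    (hKf : ∀ᶠ z in 𝓝[≠] (0 : ℂ), z ^ 2 * f z = K z) :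
    ∃ β, ∀ z, z ∉ L.lattice → ContinuousAt f z → f z = K 0 * L.weierstrassP z + β := by
  obtain ⟨E, hE, hP⟩ := P_near_zero L
  have t : Tendsto (fun x : ℂ => -x) (𝓝[≠] 0) (𝓝[≠] 0) := by
    refine tendsto_nhdsWithin_of_tendsto_nhds_of_eventually_within _ ?_ ?_
    · simpa using (Continuous.tendsto (f := fun x : ℂ => -x) (by fun_prop) 0).mono_left
        nhdsWithin_le_nhds
    · filter_upwards [self_mem_nhdsWithin] with x hx
      simpa using hx
  have hKe : ∀ᶠ z in 𝓝 (0 : ℂ), K (-z) = K z := by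
    have : ∀ᶠ z in 𝓝[≠] (0 : ℂ), K (-z) = K z := by
      filter_upwards [hKf, t.eventually hKf] with z h1 h2
      rw [← h1, ← h2, heven]; ring
    rw [eventually_nhdsWithin_iff] at this
    filter_upwards [this] with z hz
    by_cases h : z = 0
    · simp [h]
    · exact hz h
  have hd : deriv K 0 = 0 := by
    have h1 : deriv (fun z => K (-z)) 0 = deriv K 0 := EventuallyEq.deriv_eq hKe
    rw [deriv_comp_neg] at h1
    simp at h1
    have : (2 : ℂ) * deriv K 0 = 0 := by linear_combination -h1
    simpa using this
  obtain ⟨M, hM, hKM⟩ := double_zero (u := fun z => K z - K 0) (a := 0)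
    (hK.sub analyticAt_const) (by simp) (by simpa using hd)
  have hp2 : ∀ z, ∀ l ∈ L.lattice, f (z + l) - K 0 * L.weierstrassP (z + l)
      = f z - K 0 * L.weierstrassP z := by
    intro z l hl; rw [hper z l hl, P_add L hl]
  obtain ⟨c, hc⟩ := liouville L (fun z => f z - K 0 * L.weierstrassP z) hp2 (by
    intro z
    by_cases hz : z ∈ L.lattice
    · refine RA_of_periodic L hp2 (l := -z) (neg_mem hz) ?_
      rw [add_neg_cancel]
      refine ⟨fun z => M z - K 0 * E z, hM.sub (analyticAt_const.mul hE), ?_⟩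
      filter_upwards [hKf, nhdsWithin_le_nhds hKM, self_mem_nhdsWithin] with z h1 h2 h3
      have h3' : z ≠ 0 := h3
      have : f z = K z / z ^ 2 := by rw [← h1]; field_simp
      rw [hP, this]
      have h4 : K z = z ^ 2 * M z + K 0 := by
        rw [sub_zero] at h2; linear_combination h2
      rw [h4]; field_simp; ring
    · exact (hR z hz).sub (RA.of_analytic (analyticAt_const.mul (P_an L hz))))
  refine ⟨c, fun z hz hcz => ?_⟩
  have := hc z (hcz.sub (continuousAt_const.mul (P_an L hz).continuousAt))
  linear_combination this

end

end St16


namespace St16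

open Filter Topology

/-- three half periods -/
structure Triple (L : PeriodPair) (a b c : ℂ) : Prop where
  ha : a ∉ L.lattice
  hb : b ∉ L.lattice
  hc : c ∉ L.lattice
  ha2 : 2 * a ∈ L.lattice
  hb2 : 2 * b ∈ L.lattice
  hc2 : 2 * c ∈ L.lattice
  hs : a + b + c ∈ L.lattice

lemma Triple.rot {L : PeriodPair} {a b c : ℂ} (h : Triple L a b c) : Triple L b c a :=
  ⟨h.hb, h.hc, h.ha, h.hb2, h.hc2, h.ha2, by have := h.hs; convert this using 1; ring⟩

lemma Triple.swap {L : PeriodPair} {a b c : ℂ} (h : Triple L a b c) : Triple L b a c :=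
  ⟨h.hb, h.ha, h.hc, h.hb2, h.ha2, h.hc2, by have := h.hs; convert this using 1; ring⟩

section
variable (L : PeriodPair)

lemma P'_half {w : ℂ} (h2 : 2 * w ∈ L.lattice) : L.derivWeierstrassP w = 0 := by
  have h1 := L.derivWeierstrassP_neg w
  have h3 := P'_congr L (a := w) (b := -w) (by convert h2 using 1; ring)
  rw [h1] at h3
  have : (2 : ℂ) * L.derivWeierstrassP w = 0 := by linear_combination h3
  simpa using this

lemma half_const {w : ℂ} (hw : w ∉ L.lattice) (h2 : 2 * w ∈ L.lattice) :
    ∃ κ : ℂ, κ ≠ 0 ∧ ∀ z, z ∉ L.lattice → z + w ∉ L.lattice →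
      (L.weierstrassP (z + w) - L.weierstrassP w) * (L.weierstrassP z - L.weierstrassP w) = κ := by
  set e := L.weierstrassP w with he
  let f : ℂ → ℂ := fun z => (L.weierstrassP (z + w) - e) * (L.weierstrassP z - e)
  have hper : ∀ z, ∀ l ∈ L.lattice, f (z + l) = f z := by
    intro z l hl
    simp only [f]
    rw [P_add L hl, show z + l + w = z + w + l by ring, P_add L hl]
  have hperw : ∀ z, f (z + w) = f z := by
    intro z
    simp only [f]
    rw [show z + w + w = z + 2 * w by ring, P_add L h2]; ring
  have h0 : ∀ z, z ∈ L.lattice → RA f z := by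
    intro z hz
    have hzw : z + w ∉ L.lattice := fun h => hw (by simpa using sub_mem h hz)
    have hu : AnalyticAt ℂ (fun z => L.weierstrassP (z + w) - e) z :=
      (P_an_comp L (f := fun z => z + w) (by fun_prop) hzw).sub analyticAt_const
    have h1 := RA_P_mul L hz hu (by
        simp only [he]
        rw [P_congr L (a := z + w) (b := w) (by simpa using hz)]; simp) (by
        rw [deriv_sub_const]
        rw [deriv_comp_add_const, L.deriv_weierstrassP, P'_congr L (a := z + w) (b := w)
          (by simpa using hz), P'_half L h2])
    have h2 := h1.sub (RA.of_analytic (hu.const_smul (c := e)))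
    convert h2 using 1
    ext x; simp [f]; ring
  have hR : ∀ z, RA f z := by
    intro z
    by_cases hz : z ∈ L.lattice
    · exact h0 z hz
    by_cases hz' : z + w ∈ L.lattice
    · have := RA.shift (h0 _ hz')
      simpa only [hperw] using this
    · refine RA.of_analytic (AnalyticAt.mul ?_ ?_)
      · exact (P_an_comp L (f := fun z => z + w) (by fun_prop) hz').sub analyticAt_const
      · exact (P_an L hz).sub analyticAt_const
  obtain ⟨κ, hκ⟩ := liouville L f hper hR
  have hκ' : ∀ z, z ∉ L.lattice → z + w ∉ L.lattice → f z = κ := by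
    intro z hz hz'
    apply hκ
    apply AnalyticAt.continuousAt (𝕜 := ℂ)
    refine AnalyticAt.mul ?_ ?_
    · exact (P_an_comp L (f := fun z => z + w) (by fun_prop) hz').sub analyticAt_const
    · exact (P_an L hz).sub analyticAt_const
  refine ⟨κ, ?_, hκ'⟩
  rintro rfl
  have t : Tendsto (fun x : ℂ => x - w) (𝓝[≠] w) (𝓝[≠] 0) := by
    refine tendsto_nhdsWithin_of_tendsto_nhds_of_eventually_within _ ?_ ?_
    · simpa using (Continuous.tendsto (f := fun x : ℂ => x - w) (by fun_prop) w).mono_left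
        nhdsWithin_le_nhds
    · filter_upwards [self_mem_nhdsWithin] with x hx
      simpa [sub_eq_zero] using hx
  have h5 : ∀ᶠ x in 𝓝[≠] w, L.weierstrassP x = e := by
    filter_upwards [t.eventually (P_ne_eventually L e), t.eventually (eventually_notMem L 0),
      nhdsWithin_le_nhds (eventually_nhds_notMem L hw)] with x h1 h2 h3
    have := hκ' (x - w) h2 (by simpa using h3)
    simp only [f, sub_add_cancel, mul_eq_zero, sub_eq_zero] at this
    tauto
  refine not_eventually_const L hw e ?_
  rw [eventually_nhdsWithin_iff] at h5
  filter_upwards [h5] with x hx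
  by_cases h : x = w
  · rw [h]
  · exact hx h

lemma half_inj {w z : ℂ} (hw : w ∉ L.lattice) (h2 : 2 * w ∈ L.lattice) (hz : z ∉ L.lattice)
    (h : L.weierstrassP z = L.weierstrassP w) : z + w ∈ L.lattice := by
  obtain ⟨κ, h0, hκ⟩ := half_const L hw h2
  by_contra hc
  have := hκ z hz hc
  rw [h] at this
  simp at this; exact h0 this.symm

variable {L}
variable {a b c : ℂ}

lemma Triple.ne (h : Triple L a b c) : L.weierstrassP a ≠ L.weierstrassP b := by
  intro hab
  have := half_inj L h.hb h.hb2 h.ha hab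
  exact h.hc (by have := sub_mem h.hs this; simpa using this)

lemma Triple.kappa (h : Triple L a b c) {z : ℂ} (hz : z ∉ L.lattice) (hza : z + a ∉ L.lattice) :
    (L.weierstrassP (z + a) - L.weierstrassP a) * (L.weierstrassP z - L.weierstrassP a) =
      (L.weierstrassP a - L.weierstrassP b) * (L.weierstrassP a - L.weierstrassP c) := by
  obtain ⟨κ, h0, hκ⟩ := half_const L h.ha h.ha2
  have hba : b + a ∉ L.lattice := fun hh => h.hc (by
    have := sub_mem h.hs hh; convert this using 1; ring)
  have h1 := hκ b h.hb hba
  rw [hκ z hz hza, ← h1, P_congr_neg L (a := b + a) (b := c) (by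
    have := h.hs; convert this using 1; ring)]
  ring

lemma Triple.ode (h : Triple L a b c) {z : ℂ} (hz : z ∉ L.lattice) :
    L.derivWeierstrassP z ^ 2 = 4 * (L.weierstrassP z - L.weierstrassP a) *
      (L.weierstrassP z - L.weierstrassP b) * (L.weierstrassP z - L.weierstrassP c) := by
  have ea := L.derivWeierstrassP_sq a h.ha
  have eb := L.derivWeierstrassP_sq b h.hb
  have ec := L.derivWeierstrassP_sq c h.hc
  have ez := L.derivWeierstrassP_sq z hz
  rw [P'_half L h.ha2] at ea
  rw [P'_half L h.hb2] at eb
  rw [P'_half L h.hc2] at ec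
  have nab := sub_ne_zero.2 h.ne
  have nbc := sub_ne_zero.2 h.rot.ne
  have nca := sub_ne_zero.2 h.rot.rot.ne
  rw [ez]
  set A := L.weierstrassP a
  set B := L.weierstrassP b
  set C := L.weierstrassP c
  set Z := L.weierstrassP z
  have h1 : 4 * (A ^ 2 + A * B + B ^ 2) = L.g₂ :=
    mul_left_cancel₀ nab (by linear_combination eb - ea)
  have h2 : 4 * (B ^ 2 + B * C + C ^ 2) = L.g₂ :=
    mul_left_cancel₀ nbc (by linear_combination ec - eb)
  have h3 : A + B + C = 0 := mul_left_cancel₀ nca (by linear_combination (h2 - h1) / 4)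
  have hC : C = - A - B := by linear_combination h3
  rw [hC, ← h1]
  have : L.g₃ = 4 * A ^ 3 - 4 * (A ^ 2 + A * B + B ^ 2) * A := by rw [h1]; linear_combination ea
  rw [this]; ring

end

end St16


namespace St16

open Filter Topology

lemma deriv_mul_sq {v s : ℂ → ℂ} {x : ℂ} (hv : DifferentiableAt ℂ v x)
    (hs : DifferentiableAt ℂ s x) (h0 : s x = 0) : deriv (fun y => v y * (s y) ^ 2) x = 0 := by
  have := hv.hasDerivAt.mul (hs.hasDerivAt.pow 2)
  have h2 := this.deriv
  simp [h0] at h2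
  exact h2

lemma add_generic {L : PeriodPair} {a b c : ℂ} (h : Triple L a b c) {w : ℂ}
    (hw4 : 4 * w ∉ L.lattice) {z : ℂ} (hz : z ∉ L.lattice) (hzw : z + w ∉ L.lattice)
    (hzw' : z - w ∉ L.lattice) :
    (L.weierstrassP (z + w) - L.weierstrassP a) * (L.weierstrassP (z - w) - L.weierstrassP a) *
      (L.weierstrassP z - L.weierstrassP w) ^ 2 =
    ((L.weierstrassP z - L.weierstrassP a) * (L.weierstrassP w - L.weierstrassP a) -
      (L.weierstrassP a - L.weierstrassP b) * (L.weierstrassP a - L.weierstrassP c)) ^ 2 := by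
  have hw2 : 2 * w ∉ L.lattice := fun hh => hw4 (by
    have := add_mem hh hh; convert this using 1; ring)
  have hw1 : w ∉ L.lattice := fun hh => hw2 (by
    have := add_mem hh hh; convert this using 1; ring)
  have haw : w + a ∉ L.lattice := fun hh => hw2 (by
    have := sub_mem (add_mem hh hh) h.ha2; convert this using 1; ring)
  have haw' : a - w ∉ L.lattice := fun hh => hw2 (by
    have := sub_mem h.ha2 (add_mem hh hh); convert this using 1; ring)
  have ha2w : a + w + w ∉ L.lattice := fun hh => hw4 (by
    have := sub_mem (add_mem hh hh) h.ha2; convert this using 1; ring)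
  have hκ := h.kappa hw1 haw
  have hcont : ∀ u v : ℂ, u - v ∈ L.lattice ∨ u + v ∈ L.lattice →
      L.weierstrassP u = L.weierstrassP v := by
    rintro u v (h | h)
    · exact P_congr L h
    · exact P_congr_neg L h
  set P := L.weierstrassP with hP
  set e := P a with he
  set κ := (e - P b) * (e - P c) with hk
  have hκ0 : κ ≠ 0 := mul_ne_zero (sub_ne_zero.2 h.ne) (sub_ne_zero.2 h.rot.rot.ne.symm)
  let G1 : ℂ → ℂ := fun z => (P (z + w) - e) * (P (z - w) - e) * (P z - P w) ^ 2
  let G : ℂ → ℂ := fun z => G1 z - ((P z - e) * (P w - e) - κ) ^ 2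
  have hPn : ∀ x, P (-x) = P x := fun x => L.weierstrassP_neg x
  have hP1 : ∀ l ∈ L.lattice, ∀ x, P (x + l) = P x := fun l hl x => P_add L hl x
  have hper1 : ∀ z, ∀ l ∈ L.lattice, G1 (z + l) = G1 z := by
    intro z l hl
    simp only [G1]
    rw [show z + l + w = z + w + l by ring, show z + l - w = z - w + l by ring, hP1 l hl,
      hP1 l hl, hP1 l hl]
  have hper : ∀ z, ∀ l ∈ L.lattice, G (z + l) = G z := by
    intro z l hl
    simp only [G]
    rw [hper1 z l hl, hP1 l hl]
  have hev1 : ∀ z, G1 (-z) = G1 z := by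
    intro z
    simp only [G1]
    rw [hPn z, show -z + w = -(z - w) by ring, show -z - w = -(z + w) by ring,
      hPn, hPn]
    ring
  have hev : ∀ z, G (-z) = G z := by
    intro z
    simp only [G]
    rw [hev1, hPn z]
  have han : ∀ z, z ∉ L.lattice → z + w ∉ L.lattice → z - w ∉ L.lattice → AnalyticAt ℂ G z := by
    intro z h1 h2 h3
    have a1 : AnalyticAt ℂ (fun z => P (z + w)) z := P_an_comp L (f := fun z => z + w) (z := z) (by fun_prop) h2
    have a2 : AnalyticAt ℂ (fun z => P (z - w)) z := P_an_comp L (f := fun z => z - w) (z := z) (by fun_prop) h3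
    have a3 : AnalyticAt ℂ P z := P_an L h1
    exact (((a1.sub analyticAt_const).mul (a2.sub analyticAt_const)).mul
      ((a3.sub analyticAt_const).pow 2)).sub
      ((((a3.sub analyticAt_const).mul analyticAt_const).sub analyticAt_const).pow 2)
  have hRw : ∀ z, z ∉ L.lattice → z + w ∈ L.lattice → RA G z := by
    intro z h1 h2
    have h3 : z - w ∉ L.lattice := fun hh => hw2 (by
      have := sub_mem h2 hh; convert this using 1; ring)
    have a2 : AnalyticAt ℂ (fun z => P (z - w)) z := P_an_comp L (f := fun z => z - w) (z := z) (by fun_prop) h3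
    have a3 : AnalyticAt ℂ P z := P_an L h1
    have b2 : AnalyticAt ℂ (fun y => P (y - w - w) - e) (z + w) :=
      (P_an_comp L (f := fun z => z - w - w) (z := z + w) (by fun_prop)
        (by simpa using h3)).sub analyticAt_const
    have b3 : AnalyticAt ℂ (fun y => P (y - w) - P w) (z + w) :=
      (P_an_comp L (f := fun z => z - w) (z := z + w) (by fun_prop)
        (by simpa using h1)).sub analyticAt_const
    have hzero : P z - P w = 0 := sub_eq_zero.2 (hcont _ _ (Or.inr h2))
    have h5 := RA_P_mul L (u := fun y => (P (y - w - w) - e) * (P (y - w) - P w) ^ 2) h2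
      (b2.mul (b3.pow 2)) (by simp [hzero])
      (deriv_mul_sq b2.differentiableAt b3.differentiableAt (by simp [hzero]))
    have h6 := RA.shift h5
    simp only [add_sub_cancel_right] at h6
    have h7 : AnalyticAt ℂ (fun z => e * ((P (z - w) - e) * (P z - P w) ^ 2) +
      ((P z - e) * (P w - e) - κ) ^ 2) z :=
      (analyticAt_const.mul ((a2.sub analyticAt_const).mul ((a3.sub analyticAt_const).pow 2))).add
      ((((a3.sub analyticAt_const).mul analyticAt_const).sub analyticAt_const).pow 2)
    convert h6.sub (RA.of_analytic h7) using 1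
    ext y; simp only [G, G1]; ring
  have hR : ∀ z, z ∉ L.lattice → RA G z := by
    intro z h1
    by_cases h2 : z + w ∈ L.lattice
    · exact hRw z h1 h2
    by_cases h3 : z - w ∈ L.lattice
    · have h4 : RA G (-z) := hRw (-z) (by simpa using h1) (by
        have := neg_mem h3; convert this using 1; ring)
      obtain ⟨g, hg, hg'⟩ := h4
      refine ⟨fun x => g (-x), AnalyticAt.fun_comp (f := fun x => -x) hg (by fun_prop), ?_⟩
      have t : Tendsto (fun x : ℂ => -x) (𝓝[≠] z) (𝓝[≠] (-z)) := by
        refine tendsto_nhdsWithin_of_tendsto_nhds_of_eventually_within _ ?_ ?_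
        · exact (Continuous.tendsto (f := fun x : ℂ => -x) (by fun_prop) z).mono_left
            nhdsWithin_le_nhds
        · filter_upwards [self_mem_nhdsWithin] with x hx
          simpa using hx
      filter_upwards [t.eventually hg'] with x hx
      rw [← hx, hev]
    · exact RA.of_analytic (han z h1 h2 h3)
  -- behaviour at zero
  obtain ⟨E, hE, hPE⟩ := P_near_zero L
  let H : ℂ → ℂ := fun z => (P (z + w) - e) * (P (z - w) - e) * (1 + z ^ 2 * (E z - P w)) ^ 2 -
    ((1 + z ^ 2 * (E z - e)) * (P w - e) - z ^ 2 * κ) ^ 2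
  have hH : AnalyticAt ℂ H 0 := by
    have a1 : AnalyticAt ℂ (fun z => P (z + w)) 0 := P_an_comp L (f := fun z => z + w) (z := 0) (by fun_prop) (by simpa using hw1)
    have a2 : AnalyticAt ℂ (fun z => P (z - w)) 0 := P_an_comp L (f := fun z => z - w) (z := 0) (by fun_prop) (by simpa using hw1)
    have a3 : AnalyticAt ℂ (fun z => (1 + z ^ 2 * (E z - P w)) ^ 2) 0 := by fun_prop
    have a4 : AnalyticAt ℂ (fun z => ((1 + z ^ 2 * (E z - e)) * (P w - e) - z ^ 2 * κ) ^ 2) 0 := by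
      fun_prop
    exact (((a1.sub analyticAt_const).mul (a2.sub analyticAt_const)).mul a3).sub a4
  have hHG : ∀ z, z ≠ 0 → z ^ 4 * G z = H z := by
    intro z hz
    have : P z * z ^ 2 = 1 + z ^ 2 * E z := by rw [hP, hPE]; field_simp
    simp only [G, G1, H]
    rw [show (1 + z ^ 2 * (E z - P w)) = P z * z ^ 2 - z ^ 2 * P w by rw [this]; ring,
      show (1 + z ^ 2 * (E z - e)) = P z * z ^ 2 - z ^ 2 * e by rw [this]; ring]
    ring
  have hH0 : H 0 = 0 := by
    simp only [H]
    rw [zero_sub, zero_add, hPn]; ring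
  have hHe : ∀ z, H (-z) = H z := by
    intro z
    by_cases hz : z = 0
    · simp [hz]
    · rw [← hHG z hz, ← hHG (-z) (by simpa using hz), hev]; ring
  have hHd : deriv H 0 = 0 := by
    have h1 : deriv (fun z => H (-z)) 0 = deriv H 0 := by simp only [hHe]
    rw [deriv_comp_neg] at h1
    simp at h1
    have : (2 : ℂ) * deriv H 0 = 0 := by linear_combination -h1
    simpa using this
  obtain ⟨K, hK, hHK⟩ := double_zero hH hH0 hHd
  obtain ⟨β, hβ⟩ := even_double L G K hper hev hR hK (by
    filter_upwards [nhdsWithin_le_nhds hHK, self_mem_nhdsWithin] with z h1 h2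
    have h2' : z ≠ 0 := h2
    rw [← hHG z h2', sub_zero] at h1
    have : z ^ 2 * (z ^ 2 * G z) = z ^ 2 * K z := by linear_combination h1
    exact mul_left_cancel₀ (pow_ne_zero 2 h2') this)
  -- evaluate at a
  have e1 := hβ a h.ha (han a h.ha (by rwa [add_comm] at haw) haw').continuousAt
  have e2 := hβ (w + a) haw (han (w + a) haw (by convert ha2w using 2; ring)
    (by simpa using h.ha)).continuousAt
  have f1 : G a = 0 := by
    simp only [G, G1]
    rw [hcont (a - w) (w + a) (Or.inr (by convert h.ha2 using 1; ring)), add_comm a w]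
    rw [← hκ, ← he]; ring
  have f2 : G (w + a) = 0 := by
    simp only [G, G1]
    rw [add_sub_cancel_left, hκ, ← he]; ring
  rw [f1] at e1
  rw [f2] at e2
  have hne : P (w + a) - e ≠ 0 := fun hh => hκ0 (by rw [← hκ, hh, zero_mul])
  have hK0 : K 0 = 0 := by
    have : K 0 * (P (w + a) - e) = 0 := by linear_combination e1 - e2
    exact (mul_eq_zero.1 this).resolve_right hne
  have hβ0 : β = 0 := by rw [hK0] at e1; linear_combination -e1
  have := hβ z hz (han z hz hzw hzw').continuousAt
  rw [hK0, hβ0] at this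
  simp only [G, G1] at this
  linear_combination this

lemma P_add_formula {L : PeriodPair} {a b c : ℂ} (h : Triple L a b c) {w z : ℂ}
    (hw : w ∉ L.lattice) (hz : z ∉ L.lattice) (hzw : z + w ∉ L.lattice)
    (hzw' : z - w ∉ L.lattice) :
    (L.weierstrassP (z + w) - L.weierstrassP a) * (L.weierstrassP (z - w) - L.weierstrassP a) *
      (L.weierstrassP z - L.weierstrassP w) ^ 2 =
    ((L.weierstrassP z - L.weierstrassP a) * (L.weierstrassP w - L.weierstrassP a) -
      (L.weierstrassP a - L.weierstrassP b) * (L.weierstrassP a - L.weierstrassP c)) ^ 2 := by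
  have a1 := (P_an_comp L (f := fun w => z + w) (z := w) (by fun_prop) hzw).continuousAt
  have a2 := (P_an_comp L (f := fun w => z - w) (z := w) (by fun_prop) hzw').continuousAt
  have a3 := (P_an L hw).continuousAt
  refine eq_of_nhdsNE (a := w) (f := fun w => (L.weierstrassP (z + w) - L.weierstrassP a) *
      (L.weierstrassP (z - w) - L.weierstrassP a) * (L.weierstrassP z - L.weierstrassP w) ^ 2)
      (g := fun w => ((L.weierstrassP z - L.weierstrassP a) *
      (L.weierstrassP w - L.weierstrassP a) -
      (L.weierstrassP a - L.weierstrassP b) * (L.weierstrassP a - L.weierstrassP c)) ^ 2)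
      (by fun_prop) (by fun_prop) ?_
  have t : Tendsto (fun x : ℂ => 4 * x) (𝓝[≠] w) (𝓝[≠] (4 * w)) := by
    refine tendsto_nhdsWithin_of_tendsto_nhds_of_eventually_within _ ?_ ?_
    · exact (Continuous.tendsto (f := fun x : ℂ => 4 * x) (by fun_prop) w).mono_left
            nhdsWithin_le_nhds
    · filter_upwards [self_mem_nhdsWithin] with x hx
      simpa using hx
  have c1 : ContinuousAt (fun w => z + w) w := by fun_prop
  have c2 : ContinuousAt (fun w => z - w) w := by fun_prop
  filter_upwards [t.eventually (eventually_notMem L _),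
    nhdsWithin_le_nhds (c1.eventually (eventually_nhds_notMem L hzw)),
    nhdsWithin_le_nhds (c2.eventually (eventually_nhds_notMem L hzw'))] with x h1 h2 h3
  exact add_generic h h1 hz h2 h3

lemma P_inj {L : PeriodPair} {a b c : ℂ} (h : Triple L a b c) {w z : ℂ}
    (hw : w ∉ L.lattice) (hz : z ∉ L.lattice) (he : L.weierstrassP z = L.weierstrassP w) :
    z + w ∈ L.lattice ∨ z - w ∈ L.lattice := by
  by_contra! hc
  have ea := P_add_formula h hw hz hc.1 hc.2
  have eb := P_add_formula h.rot hw hz hc.1 hc.2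
  have ec := P_add_formula h.rot.rot hw hz hc.1 hc.2
  have nab := sub_ne_zero.2 h.ne
  have nbc := sub_ne_zero.2 h.rot.ne
  have nca := sub_ne_zero.2 h.rot.rot.ne
  rw [he] at ea eb ec
  set A := L.weierstrassP a
  set B := L.weierstrassP b
  set C := L.weierstrassP c
  set X := L.weierstrassP w
  have ea' : (X - A) ^ 2 = (A - B) * (A - C) := by
    have : ((X - A) * (X - A) - (A - B) * (A - C)) ^ 2 = 0 := by rw [← ea]; ring
    have := pow_eq_zero_iff (two_ne_zero) |>.1 this
    linear_combination this
  have eb' : (X - B) ^ 2 = (B - C) * (B - A) := by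
    have : ((X - B) * (X - B) - (B - C) * (B - A)) ^ 2 = 0 := by rw [← eb]; ring
    have := pow_eq_zero_iff (two_ne_zero) |>.1 this
    linear_combination this
  have ec' : (X - C) ^ 2 = (C - A) * (C - B) := by
    have : ((X - C) * (X - C) - (C - A) * (C - B)) ^ 2 = 0 := by rw [← ec]; ring
    have := pow_eq_zero_iff (two_ne_zero) |>.1 this
    linear_combination this
  have h1 : 2 * X = 2 * C := mul_left_cancel₀ nab (by linear_combination eb' - ea')
  have h2 : 2 * X = 2 * A := mul_left_cancel₀ nbc (by linear_combination ec' - eb')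
  exact nca (by linear_combination (h2 - h1) / 2)

end St16


namespace St16

open Filter Topology

section scale
variable {L M : PeriodPair} {c : ℂ}

/-- multiplication by `c` as an equivalence of lattices -/
noncomputable def scaleEquiv (hc : c ≠ 0) (h : ∀ x, c * x ∈ M.lattice ↔ x ∈ L.lattice) :
    L.lattice ≃ M.lattice where
  toFun x := ⟨c * x, (h x).2 x.2⟩
  invFun y := ⟨c⁻¹ * y, (h _).1 (by rw [mul_inv_cancel_left₀ hc]; exact y.2)⟩
  left_inv x := by ext; simp [hc]
  right_inv x := by ext; simp [hc]

lemma P_scale (hc : c ≠ 0) (h : ∀ x, c * x ∈ M.lattice ↔ x ∈ L.lattice) (z : ℂ) :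
    L.weierstrassP z = c ^ 2 * M.weierstrassP (c * z) := by
  unfold PeriodPair.weierstrassP
  rw [← (scaleEquiv hc h).tsum_eq, ← tsum_mul_left]
  congr 1; ext l
  change _ = c ^ 2 * (1 / (c * z - c * l) ^ 2 - 1 / (c * l) ^ 2)
  rw [← mul_sub, mul_pow, mul_pow, mul_sub, mul_div_assoc', mul_div_assoc',
    mul_div_mul_left _ _ (pow_ne_zero 2 hc), mul_div_mul_left _ _ (pow_ne_zero 2 hc)]

lemma P'_scale (hc : c ≠ 0) (h : ∀ x, c * x ∈ M.lattice ↔ x ∈ L.lattice) (z : ℂ) :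
    L.derivWeierstrassP z = c ^ 3 * M.derivWeierstrassP (c * z) := by
  unfold PeriodPair.derivWeierstrassP
  rw [← (scaleEquiv hc h).tsum_eq, mul_neg, ← tsum_mul_left]
  congr 1; congr 1; ext l
  change _ = c ^ 3 * (2 / (c * z - c * l) ^ 3)
  rw [← mul_sub, mul_pow]
  rw [mul_div_assoc', mul_div_mul_left _ _ (pow_ne_zero 3 hc)]

end scale

/-- a system of representatives for a quotient of lattices -/
structure Cosets (L L' : PeriodPair) (S : Finset ℂ) : Prop where
  zero : (0 : ℂ) ∈ S
  le : L.lattice ≤ L'.lattice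
  mem : ∀ Q ∈ S, Q ∈ L'.lattice
  ex : ∀ x ∈ L'.lattice, ∃ Q ∈ S, x - Q ∈ L.lattice
  uniq : ∀ Q ∈ S, ∀ R ∈ S, Q - R ∈ L.lattice → Q = R

section
variable {L L' : PeriodPair} {S : Finset ℂ}

lemma Cosets.prod_shift (h : Cosets L L' S) {g : ℂ → ℂ}
    (hg : ∀ x y, x - y ∈ L.lattice → g x = g y) {l : ℂ} (hl : l ∈ L'.lattice) (w : ℂ) :
    ∏ Q ∈ S, g (w + l + Q) = ∏ Q ∈ S, g (w + Q) := by
  choose! r hr hr2 using h.ex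
  have hm : ∀ Q ∈ S, Q + l ∈ L'.lattice := fun Q hQ => add_mem (h.mem Q hQ) hl
  refine Finset.prod_bij (fun Q _ => r (Q + l)) (fun Q hQ => hr _ (hm Q hQ)) ?_ ?_ ?_
  · intro Q hQ R hR he
    have h1 := sub_mem (hr2 _ (hm Q hQ)) (hr2 _ (hm R hR))
    rw [he] at h1
    exact h.uniq Q hQ R hR (by convert h1 using 1; ring)
  · intro R hR
    have h1 : R - l ∈ L'.lattice := sub_mem (h.mem R hR) hl
    refine ⟨r (R - l), hr _ h1, ?_⟩
    refine h.uniq _ (hr _ (hm _ (hr _ h1))) _ hR ?_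
    have := add_mem (hr2 _ (hm _ (hr _ h1))) (hr2 _ h1)
    have := neg_mem this
    convert this using 1; ring
  · intro Q hQ
    apply hg
    have := hr2 _ (hm Q hQ)
    convert this using 1; ring

lemma Cosets.prod_neg (h : Cosets L L' S) {g : ℂ → ℂ}
    (hg : ∀ x y, x - y ∈ L.lattice → g x = g y) (w : ℂ) :
    ∏ Q ∈ S, g (w - Q) = ∏ Q ∈ S, g (w + Q) := by
  choose! r hr hr2 using h.ex
  have hm : ∀ Q ∈ S, - Q ∈ L'.lattice := fun Q hQ => neg_mem (h.mem Q hQ)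
  refine Finset.prod_bij (fun Q _ => r (-Q)) (fun Q hQ => hr _ (hm Q hQ)) ?_ ?_ ?_
  · intro Q hQ R hR he
    have h1 := sub_mem (hr2 _ (hm R hR)) (hr2 _ (hm Q hQ))
    rw [he] at h1
    exact h.uniq Q hQ R hR (by convert h1 using 1; ring)
  · intro R hR
    refine ⟨r (-R), hr _ (hm R hR), ?_⟩
    refine h.uniq _ (hr _ (hm _ (hr _ (hm R hR)))) _ hR ?_
    have := sub_mem (hr2 _ (hm R hR)) (hr2 _ (hm _ (hr _ (hm R hR))))
    convert this using 1; ring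
  · intro Q hQ
    apply hg
    have := hr2 _ (hm Q hQ)
    convert this using 1; ring

lemma Cosets.notMem_add (h : Cosets L L' S) {w Q : ℂ} (hw : w ∉ L'.lattice) (hQ : Q ∈ S) :
    w + Q ∉ L.lattice := fun hh => hw (by
  have := sub_mem (h.le hh) (h.mem Q hQ); simpa using this)

lemma Cosets.notMem (h : Cosets L L' S) {Q : ℂ} (hQ : Q ∈ S.erase 0) : Q ∉ L.lattice := by
  intro hh
  rw [Finset.mem_erase] at hQ
  exact hQ.1 (h.uniq Q hQ.2 0 h.zero (by simpa using hh))

lemma Cosets.prod_formula (h : Cosets L L' S) {z w : ℂ} (hz : z ∉ L'.lattice)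
    (hw : w ∉ L'.lattice) :
    ∏ Q ∈ S, (L.weierstrassP z - L.weierstrassP (w + Q)) =
      (L'.weierstrassP z - L'.weierstrassP w) *
        ∏ Q ∈ S.erase 0, (L.weierstrassP z - L.weierstrassP Q) := by
  let f : ℂ → ℂ := fun w => ∏ Q ∈ S, (L.weierstrassP z - L.weierstrassP (w + Q))
  obtain ⟨E, hE, hPE⟩ := P_near_zero L
  let K : ℂ → ℂ := fun w => (w ^ 2 * L.weierstrassP z - 1 - w ^ 2 * E w) *
    ∏ Q ∈ S.erase 0, (L.weierstrassP z - L.weierstrassP (w + Q))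
  have hg : ∀ x y, x - y ∈ L.lattice →
      L.weierstrassP z - L.weierstrassP x = L.weierstrassP z - L.weierstrassP y :=
    fun x y hxy => by rw [P_congr L hxy]
  have han : ∀ w, w ∉ L'.lattice → AnalyticAt ℂ f w := by
    intro w hw
    refine Finset.analyticAt_fun_prod _ fun Q hQ => ?_
    exact analyticAt_const.sub
      (P_an_comp L (f := fun w => w + Q) (by fun_prop) (h.notMem_add hw hQ))
  have hK : AnalyticAt ℂ K 0 := by
    refine AnalyticAt.mul (by fun_prop) ?_
    refine Finset.analyticAt_fun_prod _ fun Q hQ => ?_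
    exact analyticAt_const.sub
      (P_an_comp L (f := fun w => w + Q) (by fun_prop) (by simpa using h.notMem hQ))
  obtain ⟨β, hβ⟩ := even_double L' f K
    (fun x l hl => h.prod_shift (g := fun x => L.weierstrassP z - L.weierstrassP x) hg hl x)
    (fun x => by
      have := h.prod_neg (g := fun x => L.weierstrassP z - L.weierstrassP x) hg x
      simp only [f]
      rw [← this]
      refine Finset.prod_congr rfl fun Q _ => ?_
      rw [← L.weierstrassP_neg (x - Q)]; congr 2; ring)
    (fun x hx => RA.of_analytic (han x hx)) hK (by
      filter_upwards [self_mem_nhdsWithin] with x hx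
      have hx' : x ≠ 0 := hx
      simp only [f, K]
      rw [← Finset.mul_prod_erase S _ h.zero, ← mul_assoc]
      congr 1
      rw [add_zero, hPE x]; field_simp; ring)
  have hK0 : K 0 = - ∏ Q ∈ S.erase 0, (L.weierstrassP z - L.weierstrassP Q) := by
    simp [K]
  have h1 := hβ z hz (han z hz).continuousAt
  have h2 := hβ w hw (han w hw).continuousAt
  have h3 : f z = 0 := Finset.prod_eq_zero h.zero (by simp)
  have h4 : f w = (L'.weierstrassP z - L'.weierstrassP w) * (- K 0) := by
    rw [h3] at h1
    rw [h2]; linear_combination -h1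
  rw [hK0, neg_neg] at h4
  exact h4

lemma deriv_zero_mul {u A : ℂ → ℂ} {w : ℂ} (hu : DifferentiableAt ℂ u w)
    (hA : DifferentiableAt ℂ A w) (h0 : u w = 0) :
    deriv (fun x => u x * A x) w = deriv u w * A w := by
  have := (hu.hasDerivAt.mul hA.hasDerivAt).deriv
  simp [h0] at this
  exact this

lemma Cosets.deriv_formula (h : Cosets L L' S) {w : ℂ} (hw : w ∉ L'.lattice) :
    L.derivWeierstrassP w * ∏ Q ∈ S.erase 0, (L.weierstrassP w - L.weierstrassP (w + Q)) =
      L'.derivWeierstrassP w *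
        ∏ Q ∈ S.erase 0, (L.weierstrassP w - L.weierstrassP Q) := by
  have hwL : w ∉ L.lattice := fun hh => hw (h.le hh)
  have hP := P_an L hwL
  have hP' := P_an L' hw
  have h1 := deriv_zero_mul (u := fun z => L.weierstrassP z - L.weierstrassP w)
    (A := fun z => ∏ Q ∈ S.erase 0, (L.weierstrassP z - L.weierstrassP (w + Q))) (w := w)
    (hP.sub analyticAt_const).differentiableAt
    (AnalyticAt.differentiableAt (Finset.analyticAt_fun_prod _ fun Q hQ => hP.sub analyticAt_const))
    (by simp)
  have h2 := deriv_zero_mul (u := fun z => L'.weierstrassP z - L'.weierstrassP w)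
    (A := fun z => ∏ Q ∈ S.erase 0, (L.weierstrassP z - L.weierstrassP Q)) (w := w)
    (hP'.sub analyticAt_const).differentiableAt
    (AnalyticAt.differentiableAt (Finset.analyticAt_fun_prod _ fun Q hQ => hP.sub analyticAt_const))
    (by simp)
  rw [deriv_sub_const, L.deriv_weierstrassP] at h1
  rw [deriv_sub_const, L'.deriv_weierstrassP] at h2
  rw [← h1, ← h2]
  apply EventuallyEq.deriv_eq
  filter_upwards [eventually_nhds_notMem L' hw] with z hz
  rw [← h.prod_formula hz hw, ← Finset.mul_prod_erase S _ h.zero, add_zero]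

end

end St16


namespace St16

lemma exists_cosets (L L' : PeriodPair) (hle : L.lattice ≤ L'.lattice) (N : ℕ) (hN : 0 < N)
    (hNL : ∀ x ∈ L'.lattice, (N : ℂ) * x ∈ L.lattice) : ∃ S : Finset ℂ, Cosets L L' S := by
  classical
  let r : ℂ → ℂ := fun x => if x ∈ L.lattice then 0 else
    (Submodule.Quotient.mk (p := L.lattice) x).out
  have hr : ∀ x, x - r x ∈ L.lattice := by
    intro x
    simp only [r]
    split_ifs with h
    · simpa using h
    · rw [← Submodule.Quotient.eq]
      exact (Quotient.out_eq _).symm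
  have hr2 : ∀ x y, x - y ∈ L.lattice → r x = r y := by
    intro x y hxy
    simp only [r]
    have : x ∈ L.lattice ↔ y ∈ L.lattice :=
      ⟨fun h => by simpa using sub_mem h hxy, fun h => by simpa using add_mem hxy h⟩
    simp only [this]
    split_ifs with h
    · rfl
    · rw [(Submodule.Quotient.eq L.lattice).2 hxy]
  let T : Finset ℂ := (Finset.range N ×ˢ Finset.range N).image
    (fun m => (m.1 : ℂ) * L'.ω₁ + m.2 * L'.ω₂)
  refine ⟨T.image r, ?_, hle, ?_, ?_, ?_⟩
  · refine Finset.mem_image.2 ⟨0, Finset.mem_image.2 ⟨(0, 0), by simp [hN], by simp⟩, ?_⟩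
    simp [r]
  · intro Q hQ
    obtain ⟨x, hx, rfl⟩ := Finset.mem_image.1 hQ
    obtain ⟨m, hm, rfl⟩ := Finset.mem_image.1 hx
    have h1 := hle (hr ((m.1 : ℂ) * L'.ω₁ + m.2 * L'.ω₂))
    have h2 : (m.1 : ℂ) * L'.ω₁ + m.2 * L'.ω₂ ∈ L'.lattice :=
      PeriodPair.mem_lattice.2 ⟨m.1, m.2, by simp⟩
    simpa using sub_mem h2 h1
  · intro x hx
    obtain ⟨a, b, rfl⟩ := PeriodPair.mem_lattice.1 hx
    have hN' : (0 : ℤ) < N := by exact_mod_cast hN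
    let y : ℂ := ((a % N).toNat : ℂ) * L'.ω₁ + ((b % N).toNat : ℂ) * L'.ω₂
    have ha : (((a % N).toNat : ℕ) : ℤ) = a % N := Int.toNat_of_nonneg (Int.emod_nonneg _ hN'.ne')
    have hb : (((b % N).toNat : ℕ) : ℤ) = b % N := Int.toNat_of_nonneg (Int.emod_nonneg _ hN'.ne')
    have hy : y ∈ T := by
      refine Finset.mem_image.2 ⟨((a % N).toNat, (b % N).toNat), ?_, rfl⟩
      have := Int.emod_lt_of_pos a hN'
      have := Int.emod_lt_of_pos b hN'
      simp only [Finset.mem_product, Finset.mem_range]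
      omega
    refine ⟨r y, Finset.mem_image_of_mem _ hy, ?_⟩
    have h1 : ((a : ℂ) * L'.ω₁ + b * L'.ω₂) - y ∈ L.lattice := by
      have h2 := hNL ((a / N : ℤ) * L'.ω₁ + (b / N : ℤ) * L'.ω₂)
        (PeriodPair.mem_lattice.2 ⟨_, _, rfl⟩)
      convert h2 using 1
      have ea : (a : ℂ) = ((N * (a / N) + (a % N).toNat : ℤ) : ℂ) := by
        rw [ha, Int.mul_ediv_add_emod]
      have eb : (b : ℂ) = ((N * (b / N) + (b % N).toNat : ℤ) : ℂ) := by
        rw [hb, Int.mul_ediv_add_emod]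
      simp only [y]
      rw [ea, eb]; push_cast; ring
    have := add_mem h1 (hr y)
    convert this using 1; ring
  · intro Q hQ R hR h
    obtain ⟨x, hx, rfl⟩ := Finset.mem_image.1 hQ
    obtain ⟨y, hy, rfl⟩ := Finset.mem_image.1 hR
    apply hr2
    have := add_mem (sub_mem (hr x) (hr y)) h
    convert this using 1; ring

/-- the arithmetic data -/
structure Dat where
  p : ℕ
  n : ℕ
  s : ℕ
  hp : p.Prime
  hn : 0 < n
  hs : ¬ p ∣ s
  hs4 : s ^ 2 < 4 * p ^ n
  π : ℂ
  τ : ℂ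
  hsum : π + τ = - s
  hprod : π * τ = (p : ℂ) ^ n
  V : ValuationSubring ℂ
  hVp : V.valuation p < 1
  hVπ : V.valuation π < 1

namespace Dat
variable (D : Dat)

/-- the cardinality -/
def q : ℕ := D.p ^ D.n

lemma p_ne : (D.p : ℂ) ≠ 0 := Nat.cast_ne_zero.2 D.hp.ne_zero

lemma q_eq : (D.q : ℂ) = (D.p : ℂ) ^ D.n := by simp [q]

lemma hprod' : D.π * D.τ = D.q := by rw [D.q_eq, D.hprod]

lemma q_ne : (D.q : ℂ) ≠ 0 := by rw [q_eq]; exact pow_ne_zero _ D.p_ne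

lemma π_ne : D.π ≠ 0 := fun h => D.q_ne (by rw [← D.hprod', h, zero_mul])

lemma τ_im : D.τ.im ≠ 0 := by
  intro h
  have h1 : (D.τ - D.π) ^ 2 = ((D.s ^ 2 - 4 * D.q : ℝ) : ℂ) := by
    push_cast
    linear_combination (D.π + D.τ - D.s) * D.hsum - 4 * D.hprod'
  have h2 : D.π.im = 0 := by
    have := congrArg Complex.im D.hsum
    simpa [h] using this
  have h3 := congrArg Complex.re h1
  rw [Complex.ofReal_re, pow_two, Complex.mul_re] at h3
  simp [h, h2] at h3
  have h4 : (D.s : ℝ) ^ 2 < 4 * D.q := by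
    have := D.hs4
    rw [q]
    exact_mod_cast this
  nlinarith [mul_self_nonneg (D.τ.re - D.π.re)]

lemma indep_aux {t : ℂ} (ht : t.im ≠ 0) : LinearIndependent ℝ ![(1 : ℂ), t] := by
  rw [LinearIndependent.pair_iff]
  intro a b h
  have h1 := congrArg Complex.im h
  have h2 := congrArg Complex.re h
  simp [ht] at h1 h2
  subst h1
  simp at h2
  exact ⟨h2, rfl⟩

lemma t_im (i : ℕ) : (D.τ / (D.p : ℂ) ^ i).im ≠ 0 := by
  have : (D.p : ℂ) ^ i = ((D.p ^ i : ℝ) : ℂ) := by push_cast; rfl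
  rw [this, Complex.div_ofReal_im]
  have hp : (D.p : ℝ) ≠ 0 := Nat.cast_ne_zero.2 D.hp.ne_zero
  exact div_ne_zero D.τ_im (pow_ne_zero _ hp)

/-- the chain of lattices -/
noncomputable def L (i : ℕ) : PeriodPair where
  ω₁ := 1
  ω₂ := D.τ / (D.p : ℂ) ^ i
  indep := indep_aux (D.t_im i)

lemma mem_L {i : ℕ} {x : ℂ} : x ∈ (D.L i).lattice ↔
    ∃ a b : ℤ, x = a + b * (D.τ / (D.p : ℂ) ^ i) := by
  rw [PeriodPair.mem_lattice]
  simp only [L, mul_one]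
  constructor
  · rintro ⟨a, b, h⟩; exact ⟨a, b, h.symm⟩
  · rintro ⟨a, b, h⟩; exact ⟨a, b, h.symm⟩

lemma repr_unique {i : ℕ} {a b a' b' : ℤ}
    (h : (a : ℂ) + b * (D.τ / (D.p : ℂ) ^ i) = a' + b' * (D.τ / (D.p : ℂ) ^ i)) :
    a = a' ∧ b = b' := by
  have h1 := congrArg Complex.im h
  simp only [Complex.add_im, Complex.intCast_im, Complex.mul_im, Complex.intCast_re, zero_add,
    zero_mul, add_zero] at h1
  have hb : (b : ℝ) = b' := mul_right_cancel₀ (D.t_im i) h1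
  have hb' : b = b' := by exact_mod_cast hb
  subst hb'
  have : (a : ℂ) = a' := by linear_combination h
  exact ⟨by exact_mod_cast this, rfl⟩

lemma repr_unique0 {a b a' b' : ℤ} (h : (a : ℂ) + b * D.τ = a' + b' * D.τ) :
    a = a' ∧ b = b' := D.repr_unique (i := 0) (by simpa using h)

lemma mem_L0 {x : ℂ} : x ∈ (D.L 0).lattice ↔ ∃ a b : ℤ, x = a + b * D.τ := by
  rw [mem_L]; simp

lemma L_mono (i : ℕ) : (D.L i).lattice ≤ (D.L (i + 1)).lattice := by
  intro x hx
  obtain ⟨a, b, rfl⟩ := D.mem_L.1 hx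
  refine D.mem_L.2 ⟨a, b * D.p, ?_⟩
  have := D.p_ne
  push_cast; rw [pow_succ]; field_simp

lemma L_mono' {i j : ℕ} (h : i ≤ j) : (D.L i).lattice ≤ (D.L j).lattice :=
  monotone_nat_of_le_succ (f := fun i => (D.L i).lattice) D.L_mono h

/-- generator of the kernel of the i-th step -/
noncomputable def Q (i : ℕ) : ℂ := D.τ / (D.p : ℂ) ^ (i + 1)

/-- representatives of the i-th step -/
noncomputable def S (i : ℕ) : Finset ℂ := (Finset.range D.p).image (fun j : ℕ => (j : ℂ) * D.Q i)

lemma S_inj (i : ℕ) : Function.Injective (fun j : ℕ => (j : ℂ) * D.Q i) := by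
  intro a b h
  have := D.repr_unique (i := i + 1) (a := 0) (b := a) (a' := 0) (b' := b)
    (by simpa [Q] using h)
  exact_mod_cast this.2

lemma mul_Q_mem {i : ℕ} {j : ℤ} : (j : ℂ) * D.Q i ∈ (D.L i).lattice ↔ (D.p : ℤ) ∣ j := by
  have hp := D.p_ne
  rw [mem_L]
  constructor
  · rintro ⟨a, b, h⟩
    have h2 : (b : ℂ) * (D.τ / (D.p : ℂ) ^ i) = ((b * D.p : ℤ) : ℂ) * D.Q i := by
      push_cast; rw [Q, pow_succ]; field_simp
    rw [h2] at h
    have := D.repr_unique (i := i + 1) (a := 0) (b := j) (a' := a) (b' := b * D.p) (by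
      simpa [Q] using h)
    exact ⟨b, by rw [this.2]; ring⟩
  · rintro ⟨b, rfl⟩
    refine ⟨0, b, ?_⟩
    push_cast; rw [Q, pow_succ]; field_simp; simp

lemma cosets (i : ℕ) : Cosets (D.L i) (D.L (i + 1)) (D.S i) where
  zero := Finset.mem_image.2 ⟨0, by simp [D.hp.pos], by simp⟩
  le := D.L_mono i
  mem := by
    intro R hR
    obtain ⟨j, hj, rfl⟩ := Finset.mem_image.1 hR
    exact D.mem_L.2 ⟨0, j, by simp [Q]⟩
  ex := by
    intro x hx
    obtain ⟨a, b, rfl⟩ := D.mem_L.1 hx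
    have hp : (0 : ℤ) < D.p := by exact_mod_cast D.hp.pos
    have hb : (((b % D.p).toNat : ℕ) : ℤ) = b % D.p :=
      Int.toNat_of_nonneg (Int.emod_nonneg _ hp.ne')
    refine ⟨((b % D.p).toNat : ℂ) * D.Q i, Finset.mem_image_of_mem _ ?_, ?_⟩
    · have := Int.emod_lt_of_pos b hp
      rw [Finset.mem_range]; omega
    · have h1 : ((b - (b % D.p).toNat : ℤ) : ℂ) * D.Q i ∈ (D.L i).lattice := by
        rw [mul_Q_mem, hb]; exact Int.dvd_self_sub_emod
      have h2 : (a : ℂ) ∈ (D.L i).lattice := D.mem_L.2 ⟨a, 0, by simp⟩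
      have := add_mem h2 h1
      convert this using 1
      push_cast; rw [Q]; ring
  uniq := by
    intro R hR T hT h
    obtain ⟨j, hj, rfl⟩ := Finset.mem_image.1 hR
    obtain ⟨k, hk, rfl⟩ := Finset.mem_image.1 hT
    have : ((j - k : ℤ) : ℂ) * D.Q i ∈ (D.L i).lattice := by
      convert h using 1; push_cast; ring
    rw [mul_Q_mem] at this
    rw [Finset.mem_range] at hj hk
    have : j = k := by
      obtain ⟨c, hc⟩ := this
      have hc0 : c = 0 := by
        by_contra h0
        rcases lt_or_gt_of_ne h0 with h1 | h1
        · have : (D.p : ℤ) * c ≤ D.p * (-1) := by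
            apply mul_le_mul_of_nonneg_left <;> omega
          omega
        · have : (D.p : ℤ) * 1 ≤ D.p * c := by
            apply mul_le_mul_of_nonneg_left <;> omega
          omega
      rw [hc0] at hc; omega
    rw [this]

lemma pi_mem_L0 (x : ℂ) : D.π * x ∈ (D.L 0).lattice ↔ x ∈ (D.L D.n).lattice := by
  have hp := D.p_ne
  have hq := D.q_ne
  have hpi : D.π = - D.s - D.τ := by linear_combination D.hsum
  have h1 := D.hprod'
  have hτ2 : D.τ ^ 2 = - D.s * D.τ - D.q := by
    rw [hpi] at h1; linear_combination - h1
  rw [mem_L0, mem_L, ← D.q_eq]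
  constructor
  · rintro ⟨a, b, h⟩
    refine ⟨-b, a - b * D.s, ?_⟩
    have h2 : (D.q : ℂ) * x = (a + b * D.τ) * D.τ := by
      rw [← h, ← h1]; ring
    field_simp
    push_cast; linear_combination h2 + (b : ℂ) * hτ2
  · rintro ⟨a, b, rfl⟩
    refine ⟨-a * D.s + b, -a, ?_⟩
    have h2 : D.π * (b * (D.τ / D.q)) = b := by
      field_simp; linear_combination (b : ℂ) * h1
    rw [mul_add, h2, hpi]; push_cast; ring

lemma pi_mem_L {i : ℕ} (hi : i ≤ D.n) {x : ℂ} (hx : x ∈ (D.L i).lattice) :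
    D.π * x ∈ (D.L i).lattice := by
  obtain ⟨a, b, rfl⟩ := D.mem_L.1 hx
  have hp := D.p_ne
  have hpi : D.π = - D.s - D.τ := by linear_combination D.hsum
  refine D.mem_L.2 ⟨-a * D.s + b * D.p ^ (D.n - i), - a * D.p ^ i, ?_⟩
  have h2 : D.π * (b * (D.τ / (D.p : ℂ) ^ i)) = b * (D.p : ℂ) ^ (D.n - i) := by
    have : (D.p : ℂ) ^ D.n = (D.p : ℂ) ^ i * (D.p : ℂ) ^ (D.n - i) := by
      rw [← pow_add]; congr 1; omega
    field_simp
    linear_combination (b : ℂ) * D.hprod + (b : ℂ) * this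
  rw [mul_add, h2, hpi]; push_cast
  field_simp
  ring

/-- the lattice `π⁻¹ L i` -/
noncomputable def Lpi (i : ℕ) : PeriodPair where
  ω₁ := D.π⁻¹
  ω₂ := D.π⁻¹ * (D.τ / (D.p : ℂ) ^ i)
  indep := by
    have h1 := (D.L i).indep
    rw [LinearIndependent.pair_iff] at h1 ⊢
    intro a b h
    apply h1 a b
    have h2 := congrArg (fun x => D.π * x) h
    have hpi := D.π_ne
    simp only [Complex.real_smul, L] at h2 ⊢
    field_simp at h2 ⊢
    simpa using h2

lemma mem_Lpi {i : ℕ} (x : ℂ) : D.π * x ∈ (D.L i).lattice ↔ x ∈ (D.Lpi i).lattice := by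
  have hpi := D.π_ne
  rw [mem_L, PeriodPair.mem_lattice]
  simp only [Lpi]
  constructor
  · rintro ⟨a, b, h⟩
    refine ⟨a, b, ?_⟩
    apply mul_left_cancel₀ hpi
    rw [h]; field_simp
  · rintro ⟨a, b, h⟩
    refine ⟨a, b, ?_⟩
    rw [← h]; field_simp

/-- elements of order `p` in the kernel of `π` -/
lemma ker_order_p {i : ℕ} (hi : i < D.n) {x : ℂ} (hpx : (D.p : ℂ) * x ∈ (D.L i).lattice)
    (hπ : D.π * x ∈ (D.L i).lattice) : ∃ j : ℤ, x - j * D.Q i ∈ (D.L i).lattice := by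
  have hp := D.p_ne
  have hpi : D.π = - D.s - D.τ := by linear_combination D.hsum
  obtain ⟨a, b, h⟩ := D.mem_L.1 hpx
  obtain ⟨c, d, h'⟩ := D.mem_L.1 hπ
  have h2 : D.π * (b * (D.τ / (D.p : ℂ) ^ i)) = b * (D.p : ℂ) ^ (D.n - i) := by
    have : (D.p : ℂ) ^ D.n = (D.p : ℂ) ^ i * (D.p : ℂ) ^ (D.n - i) := by
      rw [← pow_add]; congr 1; omega
    field_simp
    linear_combination (b : ℂ) * D.hprod + (b : ℂ) * this
  have h3 : ((-a * D.s + b * D.p ^ (D.n - i) : ℤ) : ℂ) + (- a * D.p ^ i : ℤ) *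
      (D.τ / (D.p : ℂ) ^ i) = (D.p * c : ℤ) + (D.p * d : ℤ) * (D.τ / (D.p : ℂ) ^ i) := by
    have h4 : D.p * (D.π * x) = D.p * (c + d * (D.τ / (D.p : ℂ) ^ i)) := by rw [h']
    have h5 : D.p * (D.π * x) = D.π * (a + b * (D.τ / (D.p : ℂ) ^ i)) := by rw [← h]; ring
    rw [mul_add, h2, h4] at h5
    push_cast
    have h6 : ((-a : ℂ) * D.p ^ i) * (D.τ / (D.p : ℂ) ^ i) = - a * D.τ := by field_simp
    rw [h6]
    rw [hpi] at h5
    linear_combination -h5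
  have h4 := (D.repr_unique h3).1
  have h5 : (D.p : ℤ) ∣ a * D.s := by
    have : (a * D.s : ℤ) = b * D.p ^ (D.n - i) - D.p * c := by linarith
    rw [this]
    refine dvd_sub ?_ (Dvd.intro _ rfl)
    exact Dvd.dvd.mul_left (dvd_pow_self _ (by omega)) _
  have h6 : (D.p : ℤ) ∣ a := by
    rcases (Nat.prime_iff_prime_int.1 D.hp).dvd_or_dvd h5 with h | h
    · exact h
    · exact absurd (by exact_mod_cast h) D.hs
  obtain ⟨a', rfl⟩ := h6
  refine ⟨b, D.mem_L.2 ⟨a', 0, ?_⟩⟩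
  push_cast at h
  have : x = a' + b * D.Q i := by
    apply mul_left_cancel₀ hp
    rw [h, Q, pow_succ]; field_simp
  rw [this]; simp

end Dat

end St16

namespace St16
open IsLocalRing

section
variable (V : ValuationSubring ℂ)

/-- total reduction map -/
noncomputable def red (x : ℂ) : ResidueField V :=
  open Classical in if h : x ∈ V then residue V ⟨x, h⟩ else 0

variable {V}

lemma red_of_mem {x : ℂ} (h : V.valuation x ≤ 1) :
    red V x = residue V ⟨x, (V.valuation_le_one_iff x).1 h⟩ := by
  rw [red, dif_pos]

lemma red_eq_zero_iff {x : ℂ} (h : V.valuation x ≤ 1) : red V x = 0 ↔ V.valuation x < 1 := by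
  rw [red_of_mem h, residue_eq_zero_iff, V.valuation_lt_one_iff ⟨x, _⟩]

lemma red_add {x y : ℂ} (hx : V.valuation x ≤ 1) (hy : V.valuation y ≤ 1) :
    red V (x + y) = red V x + red V y := by
  rw [red_of_mem hx, red_of_mem hy, red_of_mem (V.valuation.map_add_le hx hy), ← map_add]; rfl

lemma vmul {x y : ℂ} (hx : V.valuation x ≤ 1) (hy : V.valuation y ≤ 1) :
    V.valuation (x * y) ≤ 1 := by
  rw [map_mul]; exact mul_le_one' hx hy

lemma vadd {x y : ℂ} (hx : V.valuation x ≤ 1) (hy : V.valuation y ≤ 1) :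
    V.valuation (x + y) ≤ 1 := V.valuation.map_add_le hx hy

lemma vsub {x y : ℂ} (hx : V.valuation x ≤ 1) (hy : V.valuation y ≤ 1) :
    V.valuation (x - y) ≤ 1 := (V.valuation.map_sub x y).trans (max_le hx hy)

lemma vneg {x : ℂ} (hx : V.valuation x ≤ 1) : V.valuation (-x) ≤ 1 := by
  rwa [Valuation.map_neg]

lemma vpow {x : ℂ} (hx : V.valuation x ≤ 1) (n : ℕ) : V.valuation (x ^ n) ≤ 1 := by
  rw [map_pow]; exact pow_le_one' hx n

lemma vint (n : ℤ) : V.valuation (n : ℂ) ≤ 1 := by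
  rw [V.valuation_le_one_iff]; exact intCast_mem V n

lemma vnat (n : ℕ) : V.valuation (n : ℂ) ≤ 1 := by
  rw [V.valuation_le_one_iff]; exact natCast_mem V n

lemma vofnat (n : ℕ) [n.AtLeastTwo] : V.valuation (ofNat(n) : ℂ) ≤ 1 := vnat n

lemma vone : V.valuation (1 : ℂ) ≤ 1 := by simp

lemma red_mul {x y : ℂ} (hx : V.valuation x ≤ 1) (hy : V.valuation y ≤ 1) :
    red V (x * y) = red V x * red V y := by
  rw [red_of_mem hx, red_of_mem hy, red_of_mem (vmul hx hy), ← map_mul]; rfl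

lemma red_neg {x : ℂ} (hx : V.valuation x ≤ 1) : red V (-x) = - red V x := by
  rw [red_of_mem hx, red_of_mem (vneg hx), ← map_neg]; rfl

lemma red_sub {x y : ℂ} (hx : V.valuation x ≤ 1) (hy : V.valuation y ≤ 1) :
    red V (x - y) = red V x - red V y := by
  rw [sub_eq_add_neg, red_add hx (vneg hy), red_neg hy, sub_eq_add_neg]

lemma red_pow {x : ℂ} (hx : V.valuation x ≤ 1) (n : ℕ) : red V (x ^ n) = red V x ^ n := by
  rw [red_of_mem hx, red_of_mem (vpow hx n), ← map_pow]; rfl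

lemma red_one : red V 1 = 1 := by
  rw [red_of_mem vone, ← map_one (residue V)]; rfl

lemma red_zero : red V 0 = 0 := (red_eq_zero_iff (by simp)).2 (by simp)

lemma red_nat (n : ℕ) : red V (n : ℂ) = n := by
  rw [red_of_mem (vnat n), ← map_natCast (residue V)]; rfl

lemma red_int (n : ℤ) : red V (n : ℂ) = n := by
  rw [red_of_mem (vint n), ← map_intCast (residue V)]; rfl

lemma red_ofnat (n : ℕ) [n.AtLeastTwo] : red V (ofNat(n) : ℂ) = ofNat(n) := red_nat n

lemma red_eq_iff {x y : ℂ} (hx : V.valuation x ≤ 1) (hy : V.valuation y ≤ 1) :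
    red V x = red V y ↔ V.valuation (x - y) < 1 := by
  rw [← red_eq_zero_iff (vsub hx hy), red_sub hx hy, sub_eq_zero]

lemma red_ne_zero {x : ℂ} (hx : V.valuation x = 1) : red V x ≠ 0 := by
  rw [Ne, red_eq_zero_iff hx.le, hx]; exact lt_irrefl _

lemma v_eq_one {x : ℂ} (hx : V.valuation x ≤ 1) (h : red V x ≠ 0) : V.valuation x = 1 := by
  rw [Ne, red_eq_zero_iff hx] at h
  exact le_antisymm hx (not_lt.1 h)

lemma vinv {x : ℂ} (hx : V.valuation x = 1) : V.valuation x⁻¹ = 1 := by simp [hx]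

lemma vdiv {x y : ℂ} (hx : V.valuation x ≤ 1) (hy : V.valuation y = 1) :
    V.valuation (x / y) ≤ 1 := by simpa [hy] using hx

lemma ne_zero_of_v {x : ℂ} (hx : V.valuation x = 1) : x ≠ 0 := by
  rintro rfl; simp at hx

lemma red_div {x y : ℂ} (hx : V.valuation x ≤ 1) (hy : V.valuation y = 1) :
    red V (x / y) = red V x / red V y := by
  rw [eq_div_iff (red_ne_zero hy), ← red_mul (vdiv hx hy) hy.le, div_mul_cancel₀ _ (ne_zero_of_v hy)]

lemma vprod {ι : Type*} {s : Finset ι} {f : ι → ℂ} (h : ∀ i ∈ s, V.valuation (f i) ≤ 1) :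
    V.valuation (∏ i ∈ s, f i) ≤ 1 := by
  rw [map_prod]; exact Finset.prod_le_one' h

lemma red_prod {ι : Type*} {s : Finset ι} {f : ι → ℂ} (h : ∀ i ∈ s, V.valuation (f i) ≤ 1) :
    red V (∏ i ∈ s, f i) = ∏ i ∈ s, red V (f i) := by
  classical
  induction s using Finset.induction_on with
  | empty => simp [red_one]
  | insert a s ha ih =>
    rw [Finset.prod_insert ha, Finset.prod_insert ha,
      red_mul (h _ (Finset.mem_insert_self _ _))
        (vprod fun i hi => h i (Finset.mem_insert_of_mem hi)),
      ih fun i hi => h i (Finset.mem_insert_of_mem hi)]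

/-- `1 + small` is a unit reducing to one -/
lemma v_one_add {x : ℂ} (hx : V.valuation x < 1) : V.valuation (1 + x) = 1 :=
  V.valuation.map_one_add_of_lt hx

lemma v_one_sub {x : ℂ} (hx : V.valuation x < 1) : V.valuation (1 - x) = 1 :=
  V.valuation.map_one_sub_of_lt hx

lemma charP_k {p : ℕ} (hp : p.Prime) (h : V.valuation (p : ℂ) < 1) : CharP (ResidueField V) p := by
  have : ((p : ℕ) : ResidueField V) = 0 := by
    rw [← red_nat, red_eq_zero_iff (vnat p)]; exact h
  exact (CharP.charP_iff_prime_eq_zero hp).2 this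

/-- a root of a monic quadratic with integral coefficients is integral -/
lemma v_quad {x S P : ℂ} (hS : V.valuation S ≤ 1) (hP : V.valuation P ≤ 1)
    (h : x ^ 2 = S * x - P) : V.valuation x ≤ 1 := by
  by_contra hx
  rw [not_le] at hx
  have h1 : V.valuation (S * x - P) ≤ V.valuation x := by
    refine (V.valuation.map_sub _ _).trans (max_le ?_ (hP.trans hx.le))
    rw [map_mul]; exact mul_le_of_le_one_left' hS
  rw [← h, map_pow, pow_two] at h1
  have h0 : 0 < V.valuation x := lt_trans zero_lt_one hx
  have := mul_lt_mul_of_pos_right hx h0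
  rw [one_mul] at this
  exact absurd h1 (not_le.2 this)

end
end St16

namespace St16
open IsLocalRing

/-- A labelling of the half periods adapted to the valuation -/
structure Lvl (V : ValuationSubring ℂ) (L : PeriodPair) where
  a : ℂ
  b : ℂ
  c : ℂ
  tri : Triple L a b c
  hl : V.valuation (L.weierstrassP c - L.weierstrassP a) =
    V.valuation (L.weierstrassP b - L.weierstrassP a)

namespace Lvl
variable {V : ValuationSubring ℂ} {L : PeriodPair}

lemma exists_of_triple {a b c : ℂ} (h : Triple L a b c) : Nonempty (Lvl V L) := by
  by_cases h1 : V.valuation (L.weierstrassP c - L.weierstrassP a) =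
      V.valuation (L.weierstrassP b - L.weierstrassP a)
  · exact ⟨⟨a, b, c, h, h1⟩⟩
  by_cases h2 : V.valuation (L.weierstrassP a - L.weierstrassP b) =
      V.valuation (L.weierstrassP c - L.weierstrassP b)
  · exact ⟨⟨b, c, a, h.rot, h2⟩⟩
  by_cases h3 : V.valuation (L.weierstrassP b - L.weierstrassP c) =
      V.valuation (L.weierstrassP a - L.weierstrassP c)
  · exact ⟨⟨c, a, b, h.rot.rot, h3⟩⟩
  exfalso
  rw [V.valuation.map_sub_swap (L.weierstrassP c)] at h1
  have h4 := V.valuation.map_add_of_distinct_val (Ne.symm h1)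
  rw [sub_add_sub_cancel] at h4
  rcases max_choice (V.valuation (L.weierstrassP b - L.weierstrassP a))
    (V.valuation (L.weierstrassP a - L.weierstrassP c)) with h5 | h5
  · apply h2
    rw [V.valuation.map_sub_swap, V.valuation.map_sub_swap (L.weierstrassP c), h4, h5]
  · exact h3 (h4.trans h5)

variable (l : Lvl V L)

/-- scale -/
noncomputable def u : ℂ := L.weierstrassP l.b - L.weierstrassP l.a
/-- normalised coordinate -/
noncomputable def x (z : ℂ) : ℂ := (L.weierstrassP z - L.weierstrassP l.a) / l.u
/-- third branch point -/
noncomputable def lam : ℂ := l.x l.c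

lemma u_ne : l.u ≠ 0 := sub_ne_zero.2 l.tri.ne.symm

lemma P_eq (z : ℂ) : L.weierstrassP z = L.weierstrassP l.a + l.u * l.x z := by
  have := l.u_ne
  rw [x]; field_simp; ring

lemma P_sub (z w : ℂ) : L.weierstrassP z - L.weierstrassP w = l.u * (l.x z - l.x w) := by
  rw [l.P_eq z, l.P_eq w]; ring

lemma x_a : l.x l.a = 0 := by simp [x]
lemma x_b : l.x l.b = 1 := div_self l.u_ne
lemma x_c : l.x l.c = l.lam := rfl
lemma v_lam : V.valuation l.lam = 1 := by
  rw [lam, x, map_div₀, l.hl]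
  exact div_self ((Valuation.ne_zero_iff _).2 l.u_ne)

lemma lam_ne_one : l.lam ≠ 1 := by
  intro h
  have := l.P_sub l.c l.b
  rw [x_b, x_c, h, sub_self, mul_zero, sub_eq_zero] at this
  exact l.tri.rot.ne this.symm

lemma lam_ne_zero : l.lam ≠ 0 := ne_zero_of_v l.v_lam

lemma x_congr {z w : ℂ} (h : z - w ∈ L.lattice) : l.x z = l.x w := by rw [x, x, P_congr L h]
lemma x_congr_neg {z w : ℂ} (h : z + w ∈ L.lattice) : l.x z = l.x w := by
  rw [x, x, P_congr_neg L h]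
lemma x_neg (z : ℂ) : l.x (-z) = l.x z := by rw [x, x, L.weierstrassP_neg]

lemma x_inj {z w : ℂ} (hz : z ∉ L.lattice) (hw : w ∉ L.lattice) (h : l.x z = l.x w) :
    z + w ∈ L.lattice ∨ z - w ∈ L.lattice := by
  refine P_inj l.tri hw hz ?_
  rw [l.P_eq z, l.P_eq w, h]

/-- the cubic -/
noncomputable def cub (X : ℂ) : ℂ := X * (X - 1) * (X - l.lam)

lemma ode {z : ℂ} (hz : z ∉ L.lattice) :
    L.derivWeierstrassP z ^ 2 = 4 * l.u ^ 3 * l.cub (l.x z) := by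
  rw [l.tri.ode hz, l.P_sub z, l.P_sub z, l.P_sub z, x_a, x_b, x_c, cub]; ring

lemma half {w : ℂ} (hw : w ∉ L.lattice) (h2 : 2 * w ∈ L.lattice) :
    l.x w = 0 ∨ l.x w = 1 ∨ l.x w = l.lam := by
  have h := l.ode hw
  rw [P'_half L h2] at h
  have h3 : l.cub (l.x w) = 0 := by
    have := l.u_ne
    by_contra h0
    have : 4 * l.u ^ 3 * l.cub (l.x w) ≠ 0 :=
      mul_ne_zero (mul_ne_zero (by norm_num) (pow_ne_zero _ this)) h0
    exact this (by rw [← h]; ring)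
  rw [cub, mul_eq_zero, mul_eq_zero] at h3
  rcases h3 with (h3 | h3) | h3
  · exact Or.inl h3
  · exact Or.inr (Or.inl (by linear_combination h3))
  · exact Or.inr (Or.inr (by linear_combination h3))

lemma half_int {w : ℂ} (hw : w ∉ L.lattice) (h2 : 2 * w ∈ L.lattice) :
    V.valuation (l.x w) ≤ 1 := by
  rcases l.half hw h2 with h | h | h <;> rw [h]
  · simp
  · simp
  · exact l.v_lam.le

lemma kappa {z : ℂ} (hz : z ∉ L.lattice) (hza : z + l.a ∉ L.lattice) :
    l.x (z + l.a) * l.x z = l.lam := by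
  have h := l.tri.kappa hz hza
  rw [l.P_sub, l.P_sub, l.P_sub, l.P_sub, x_a, x_b, x_c] at h
  have := l.u_ne
  have h2 : l.u ^ 2 * (l.x (z + l.a) * l.x z) = l.u ^ 2 * l.lam := by linear_combination h
  exact mul_left_cancel₀ (pow_ne_zero 2 this) h2

lemma add0 {w z : ℂ} (hw : w ∉ L.lattice) (hz : z ∉ L.lattice) (hzw : z + w ∉ L.lattice)
    (hzw' : z - w ∉ L.lattice) :
    l.x (z + w) * l.x (z - w) * (l.x z - l.x w) ^ 2 = (l.x z * l.x w - l.lam) ^ 2 := by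
  have h := P_add_formula l.tri hw hz hzw hzw'
  simp only [l.P_sub, x_a, x_b, x_c] at h
  have := l.u_ne
  apply mul_left_cancel₀ (pow_ne_zero 4 this)
  linear_combination h

lemma add1 {w z : ℂ} (hw : w ∉ L.lattice) (hz : z ∉ L.lattice) (hzw : z + w ∉ L.lattice)
    (hzw' : z - w ∉ L.lattice) :
    (l.x (z + w) - 1) * (l.x (z - w) - 1) * (l.x z - l.x w) ^ 2 =
      (l.x z * l.x w - l.x z - l.x w + l.lam) ^ 2 := by
  have h := P_add_formula l.tri.rot hw hz hzw hzw'
  simp only [l.P_sub, x_a, x_b, x_c] at h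
  have := l.u_ne
  apply mul_left_cancel₀ (pow_ne_zero 4 this)
  linear_combination h

/-- the pairing formula -/
lemma pair {w z : ℂ} (hw : w ∉ L.lattice) (hz : z ∉ L.lattice) (hzw : z + w ∉ L.lattice)
    (hzw' : z - w ∉ L.lattice) :
    (l.x z - l.x (z + w)) * (l.x z - l.x (z - w)) * (l.x z - l.x w) ^ 2 =
      (l.x z ^ 2 - l.lam) ^ 2 - 4 * l.cub (l.x z) * l.x w := by
  have h0 := l.add0 hw hz hzw hzw'
  have h1 := l.add1 hw hz hzw hzw'
  rw [cub]
  linear_combination (1 - l.x z) * h0 + l.x z * h1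

/-- translation by a big point does not change the reduction -/
lemma trans_big {R Q : ℂ} (hR : R ∉ L.lattice) (hQ : Q ∉ L.lattice)
    (hxR : V.valuation (l.x R) ≤ 1) (hxQ : 1 < V.valuation (l.x Q)) :
    R + Q ∉ L.lattice ∧ V.valuation (l.x (R + Q)) ≤ 1 ∧
      V.valuation (l.x (R + Q) - l.x R) < 1 := by
  have hne : l.x R ≠ l.x Q := by
    intro h; rw [h] at hxR; exact absurd hxR (not_le.2 hxQ)
  have hp : R + Q ∉ L.lattice := fun h => hne (l.x_congr_neg h)
  have hm : R - Q ∉ L.lattice := fun h => hne (l.x_congr h)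
  have h0 := l.add0 hQ hR hp hm
  have h1 := l.add1 hQ hR hp hm
  set X := l.x R
  set Y := l.x Q
  set A := l.x (R + Q)
  set B := l.x (R - Q)
  have hY0 : Y ≠ 0 := by rintro h; rw [h, map_zero] at hxQ; exact not_lt_zero hxQ
  set y := Y⁻¹ with hy
  have hvy : V.valuation y < 1 := by
    rw [hy, map_inv₀]; exact inv_lt_one_of_one_lt₀ hxQ
  have hYy : Y * y = 1 := mul_inv_cancel₀ hY0
  have hlam := l.v_lam.le
  set m := l.lam
  have hXy : V.valuation (X * y) < 1 := by
    rw [map_mul]; exact (mul_le_of_le_one_left' hxR).trans_lt hvy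
  have hw := v_one_sub hXy
  set w := 1 - X * y with hwd
  have e0 : A * B * w ^ 2 = (X - m * y) ^ 2 := by
    have : (A * B * (X - Y) ^ 2) * y ^ 2 = (X * Y - m) ^ 2 * y ^ 2 := by rw [h0]
    rw [hwd]
    linear_combination this + (2 * A * B * X * y - A * B * (Y * y + 1) + X ^ 2 * (Y * y + 1) - 2 * X * m * y) * hYy
  have e1 : (A - 1) * (B - 1) * w ^ 2 = (X - 1 - X * y + m * y) ^ 2 := by
    have : ((A - 1) * (B - 1) * (X - Y) ^ 2) * y ^ 2 = (X * Y - X - Y + m) ^ 2 * y ^ 2 := by rw [h1]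
    rw [hwd]
    linear_combination this + (2 * (A - 1) * (B - 1) * X * y - (A - 1) * (B - 1) * (Y * y + 1)
      + (X - 1) ^ 2 * (Y * y + 1) - 2 * (X - 1) * (X * y - m * y)) * hYy
  have hw0 : w ≠ 0 := ne_zero_of_v hw
  have hy1 := hvy.le
  have hw2 : V.valuation (w ^ 2) = 1 := by rw [map_pow, hw, one_pow]
  have hrw : red V w = 1 := by
    rw [hwd, red_sub vone hXy.le, red_one, (red_eq_zero_iff hXy.le).2 hXy, sub_zero]
  have hry : red V y = 0 := (red_eq_zero_iff hy1).2 hvy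
  have hmy := vmul hlam hy1
  have f0 : A * B = (X - m * y) ^ 2 / w ^ 2 := by field_simp; linear_combination e0
  have f1 : (A - 1) * (B - 1) = (X - 1 - X * y + m * y) ^ 2 / w ^ 2 := by
    field_simp; linear_combination e1
  have i0 : V.valuation (X - m * y) ≤ 1 := vsub hxR hmy
  have i2 : V.valuation (X - 1 - X * y) ≤ 1 := vsub (vsub hxR vone) hXy.le
  have i1 : V.valuation (X - 1 - X * y + m * y) ≤ 1 := vadd i2 hmy
  have hP : V.valuation (A * B) ≤ 1 := by rw [f0]; exact vdiv (vpow i0 2) hw2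
  have hP1 : V.valuation ((A - 1) * (B - 1)) ≤ 1 := by rw [f1]; exact vdiv (vpow i1 2) hw2
  have r0 : red V (A * B) = red V X ^ 2 := by
    rw [f0, red_div (vpow i0 2) hw2, red_pow i0, red_pow hw.le, red_sub hxR hmy, red_mul hlam hy1,
      hry, hrw]; simp
  have r1 : red V ((A - 1) * (B - 1)) = (red V X - 1) ^ 2 := by
    rw [f1, red_div (vpow i1 2) hw2, red_pow i1, red_pow hw.le, red_add i2 hmy,
      red_sub (vsub hxR vone) hXy.le, red_sub hxR vone,
      red_mul hlam hy1, red_mul hxR hy1, hry, hrw, red_one]; simp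
  have hSe : A + B = A * B - (A - 1) * (B - 1) + 1 := by ring
  have hS : V.valuation (A + B) ≤ 1 := by rw [hSe]; exact vadd (vsub hP hP1) vone
  have rS : red V (A + B) = 2 * red V X := by
    rw [hSe, red_add (vsub hP hP1) vone, red_sub hP hP1, r0, r1, red_one]; ring
  have hA : V.valuation A ≤ 1 := v_quad hS hP (by ring)
  have hB : V.valuation B ≤ 1 := v_quad (x := B) hS hP (by ring)
  refine ⟨hp, hA, ?_⟩
  rw [← red_eq_iff hA hxR]
  rw [red_mul hA hB] at r0
  rw [red_add hA hB] at rS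
  have : (red V A - red V X) ^ 2 = 0 := by
    linear_combination red V A * rS - r0
  exact sub_eq_zero.1 (pow_eq_zero_iff (two_ne_zero)|>.1 this)

/-- zero or big -/
def Big (z : ℂ) : Prop := z ∈ L.lattice ∨ 1 < V.valuation (l.x z)

lemma Big.add {z w : ℂ} (hz : l.Big z) (hw : l.Big w) : l.Big (z + w) := by
  rcases hz with hz | hz
  · rcases hw with hw | hw
    · exact Or.inl (add_mem hz hw)
    · right; rwa [l.x_congr (z := z + w) (w := w) (by simpa using hz)]
  rcases hw with hw | hw
  · right; rwa [l.x_congr (z := z + w) (w := z) (by simpa using hw)]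
  by_contra hc
  simp only [Big, not_or, not_lt] at hc
  by_cases hwL : w ∈ L.lattice
  · rw [l.x_congr (z := z + w) (w := z) (by simpa using hwL)] at hc
    exact absurd hc.2 (not_le.2 hz)
  have := (l.trans_big hc.1 (Q := - w) (by simpa using hwL) hc.2 (by rwa [x_neg])).2.1
  rw [add_neg_cancel_right] at this
  exact absurd this (not_le.2 hz)

lemma Big.neg {z : ℂ} (hz : l.Big z) : l.Big (-z) := by
  rcases hz with hz | hz
  · exact Or.inl (neg_mem hz)
  · right; rwa [x_neg]

lemma Big.nsmul {z : ℂ} (hz : l.Big z) (n : ℕ) : l.Big ((n : ℂ) * z) := by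
  induction n with
  | zero => left; simp
  | succ n ih =>
    have := Big.add l ih hz
    convert this using 1; push_cast; ring

lemma Big.zsmul {z : ℂ} (hz : l.Big z) (n : ℤ) : l.Big ((n : ℂ) * z) := by
  rcases Int.eq_nat_or_neg n with ⟨m, rfl | rfl⟩
  · exact_mod_cast Big.nsmul l hz m
  · have := Big.neg l (Big.nsmul l hz m)
    convert this using 1; push_cast; ring

lemma Big.congr {z w : ℂ} (hz : l.Big z) (h : z - w ∈ L.lattice) : l.Big w := by
  rcases hz with hz | hz
  · left; have := sub_mem hz h; simpa using this
  · right; rwa [← l.x_congr h]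

end Lvl
end St16

namespace St16
open IsLocalRing

namespace Lvl
variable {V : ValuationSubring ℂ} {L : PeriodPair} (l : Lvl V L)

/-- reduced cubic -/
noncomputable def hk (X : ResidueField V) : ResidueField V := X * (X - 1) * (X - red V l.lam)

lemma red_cub {X : ℂ} (hX : V.valuation X ≤ 1) : red V (l.cub X) = l.hk (red V X) := by
  have h1 := vsub hX vone
  have h2 := vsub hX l.v_lam.le
  rw [cub, hk, red_mul (vmul hX h1) h2, red_mul hX h1, red_sub hX vone, red_sub hX l.v_lam.le,
    red_one]

lemma v_cub {X : ℂ} (hX : V.valuation X ≤ 1) : V.valuation (l.cub X) ≤ 1 :=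
  vmul (vmul hX (vsub hX vone)) (vsub hX l.v_lam.le)

lemma x_ne {a b c : ℂ} (h : Triple L a b c) : l.x a ≠ l.x b := by
  intro h2
  apply h.ne
  rw [l.P_eq a, l.P_eq b, h2]

lemma sym {a b c : ℂ} (h : Triple L a b c) :
    l.x a + l.x b + l.x c = 1 + l.lam ∧
    l.x a * l.x b + l.x b * l.x c + l.x c * l.x a = l.lam ∧ l.x a * l.x b * l.x c = 0 := by
  have h1 := l.x_ne h
  have h2 := l.x_ne h.rot
  have h3 := l.x_ne h.rot.rot
  rcases l.half h.ha h.ha2 with e | e | e <;> rcases l.half h.hb h.hb2 with e' | e' | e' <;>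
  rcases l.half h.hc h.hc2 with e'' | e'' | e'' <;> rw [e, e'] at h1 <;> rw [e', e''] at h2 <;>
  rw [e'', e] at h3 <;> first | exact absurd rfl h1 | exact absurd rfl h2 | exact absurd rfl h3 |
    (rw [e, e', e'']; refine ⟨by ring, by ring, by ring⟩)

lemma hk_sym {a b c : ℂ} (h : Triple L a b c) (Y : ResidueField V) :
    l.hk Y = (Y - red V (l.x a)) * (Y - red V (l.x b)) * (Y - red V (l.x c)) := by
  have ha := l.half_int h.ha h.ha2
  have hb := l.half_int h.hb h.hb2
  have hc := l.half_int h.hc h.hc2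
  obtain ⟨h1, h2, h3⟩ := l.sym h
  have h1 := congrArg (red V) h1
  have h2 := congrArg (red V) h2
  have h3 := congrArg (red V) h3
  rw [red_add (vadd ha hb) hc, red_add ha hb, red_add vone l.v_lam.le, red_one] at h1
  rw [red_add (vadd (vmul ha hb) (vmul hb hc)) (vmul hc ha), red_add (vmul ha hb) (vmul hb hc),
    red_mul ha hb, red_mul hb hc, red_mul hc ha] at h2
  rw [red_mul (vmul ha hb) hc, red_mul ha hb, red_zero] at h3
  rw [hk]
  linear_combination Y ^ 2 * h1 - Y * h2 + h3

end Lvl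

/-- the relation between two levels -/
structure Rel {V : ValuationSubring ℂ} {L L' : PeriodPair} (l : Lvl V L) (l' : Lvl V L')
    (N : ℕ) : Prop where
  odd : Odd N
  le : L.lattice ≤ L'.lattice
  addp : ∀ a b : ResidueField V, (a + b) ^ N = a ^ N + b ^ N
  expand : ∀ z, z ∉ L'.lattice → 1 < V.valuation (l.x z) → V.valuation (l.x z) < V.valuation (l'.x z)
  integ : ∀ z, z ∉ L'.lattice → V.valuation (l.x z) ≤ 1 → V.valuation (l'.x z) ≤ 1
  contr : ∀ z w, z ∉ L'.lattice → w ∉ L'.lattice → V.valuation (l.x z) ≤ 1 →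
    V.valuation (l.x w) ≤ 1 → V.valuation (l.x z - l.x w) < 1 → l.x z ≠ l.x w →
    V.valuation (l'.x z - l'.x w) < V.valuation (l.x z - l.x w)
  frob : ∃ C D : ResidueField V, C ≠ 0 ∧ ∀ z, z ∉ L'.lattice → V.valuation (l.x z) ≤ 1 →
    red V (l'.x z) = C * red V (l.x z) ^ N + D
  hh : ∃ c : ResidueField V, c ≠ 0 ∧ ∀ z, z ∉ L'.lattice → V.valuation (l.x z) ≤ 1 →
    l'.hk (red V (l'.x z)) = c * l.hk (red V (l.x z)) ^ N
  sign : ∃ (K : ℂ) (c : ResidueField V), K ≠ 0 ∧ c ≠ 0 ∧ ∀ z, z ∉ L'.lattice →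
    V.valuation (l.x z) ≤ 1 → ∃ g : ℂ, V.valuation g ≤ 1 ∧
      L'.derivWeierstrassP z = K * L.derivWeierstrassP z * g ∧
      red V g = c * l.hk (red V (l.x z)) ^ ((N - 1) / 2)

lemma Rel.trans {V : ValuationSubring ℂ} {L L' L'' : PeriodPair} {l : Lvl V L} {l' : Lvl V L'}
    {l'' : Lvl V L''} {N N' : ℕ} (h : Rel l l' N) (h' : Rel l' l'' N') : Rel l l'' (N * N') where
  odd := h.odd.mul h'.odd
  le := h.le.trans h'.le
  addp := fun a b => by rw [pow_mul, h.addp, h'.addp, ← pow_mul, ← pow_mul]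
  expand := fun z hz h1 => by
    have h2 := h.expand z (fun hh => hz (h'.le hh)) h1
    exact h2.trans (h'.expand z hz (h1.trans h2))
  integ := fun z hz h1 => h'.integ z hz (h.integ z (fun hh => hz (h'.le hh)) h1)
  contr := fun z w hz hw iz iw h1 hne => by
    have hz' : z ∉ L'.lattice := fun hh => hz (h'.le hh)
    have hw' : w ∉ L'.lattice := fun hh => hw (h'.le hh)
    have h2 := h.contr z w hz' hw' iz iw h1 hne
    by_cases h3 : l'.x z = l'.x w
    · have h4 : l''.x z = l''.x w := by
        rcases l'.x_inj hz' hw' h3 with h5 | h5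
        · exact l''.x_congr_neg (h'.le h5)
        · exact l''.x_congr (h'.le h5)
      rw [h3, sub_self] at h2
      rwa [h4, sub_self]
    · exact (h'.contr z w hz hw (h.integ z hz' iz) (h.integ w hw' iw) (h2.trans h1) h3).trans h2
  frob := by
    obtain ⟨C, D, hC, hf⟩ := h.frob
    obtain ⟨C', D', hC', hf'⟩ := h'.frob
    refine ⟨C' * C ^ N', C' * D ^ N' + D', mul_ne_zero hC' (pow_ne_zero _ hC), fun z hz iz => ?_⟩
    have hz' : z ∉ L'.lattice := fun hh => hz (h'.le hh)
    rw [hf' z hz (h.integ z hz' iz), hf z hz' iz, h'.addp, mul_pow, ← pow_mul]; ring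
  hh := by
    obtain ⟨c, hc, hf⟩ := h.hh
    obtain ⟨c', hc', hf'⟩ := h'.hh
    refine ⟨c' * c ^ N', mul_ne_zero hc' (pow_ne_zero _ hc), fun z hz iz => ?_⟩
    have hz' : z ∉ L'.lattice := fun hh => hz (h'.le hh)
    rw [hf' z hz (h.integ z hz' iz), hf z hz' iz, mul_pow, ← pow_mul]; ring
  sign := by
    obtain ⟨c1, hc1, hf⟩ := h.hh
    obtain ⟨K, c, hK, hc, hs⟩ := h.sign
    obtain ⟨K', c', hK', hc', hs'⟩ := h'.sign
    refine ⟨K' * K, c' * c1 ^ ((N' - 1) / 2) * c, mul_ne_zero hK' hK,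
      mul_ne_zero (mul_ne_zero hc' (pow_ne_zero _ hc1)) hc, fun z hz iz => ?_⟩
    have hz' : z ∉ L'.lattice := fun hh => hz (h'.le hh)
    obtain ⟨g, hg, e, r⟩ := hs z hz' iz
    obtain ⟨g', hg', e', r'⟩ := hs' z hz (h.integ z hz' iz)
    refine ⟨g' * g, vmul hg' hg, by rw [e', e]; ring, ?_⟩
    have hexp : (N * N' - 1) / 2 = N * ((N' - 1) / 2) + (N - 1) / 2 := by
      obtain ⟨a, rfl⟩ := h.odd
      obtain ⟨b, rfl⟩ := h'.odd
      have : (2 * a + 1) * (2 * b + 1) - 1 = 2 * ((2 * a + 1) * b + a) := by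
        have : (2 * a + 1) * (2 * b + 1) = 2 * ((2 * a + 1) * b + a) + 1 := by ring
        omega
      rw [this]; simp
    rw [red_mul hg' hg, r', r, hf z hz' iz, hexp, mul_pow, pow_add, pow_mul]; ring

section step
variable {V : ValuationSubring ℂ} {L L' : PeriodPair} {S : Finset ℂ}

/-- the denominators -/
noncomputable def FF (l : Lvl V L) (S : Finset ℂ) (z : ℂ) : ℂ :=
  ∏ Q ∈ S.erase 0, (1 - l.x z / l.x Q)

variable (l : Lvl V L) (l' : Lvl V L') (hc : Cosets L L' S)
  (hbig : ∀ Q ∈ S.erase 0, 1 < V.valuation (l.x Q))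

include hbig in
lemma xQ_ne {Q : ℂ} (hQ : Q ∈ S.erase 0) : l.x Q ≠ 0 := by
  intro h
  have := hbig Q hQ
  rw [h, map_zero] at this
  exact not_lt_zero this

include hbig in
lemma v_div {z Q : ℂ} (hQ : Q ∈ S.erase 0) (hz : V.valuation z ≤ 1) :
    V.valuation (z / l.x Q) < 1 := by
  rw [map_div₀, div_eq_mul_inv]
  exact (mul_le_of_le_one_left' hz).trans_lt (inv_lt_one_of_one_lt₀ (hbig Q hQ))

include hbig in
lemma v_FF {z : ℂ} (hz : V.valuation (l.x z) ≤ 1) : V.valuation (FF l S z) = 1 := by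
  rw [FF, map_prod]
  exact Finset.prod_eq_one fun Q hQ => v_one_sub (v_div l hbig hQ hz)

include hbig in
lemma red_FF {z : ℂ} (hz : V.valuation (l.x z) ≤ 1) : red V (FF l S z) = 1 := by
  have h : ∀ Q ∈ S.erase 0, V.valuation (1 - l.x z / l.x Q) ≤ 1 := fun Q hQ =>
    (v_one_sub (v_div l hbig hQ hz)).le
  rw [FF, red_prod h]
  refine Finset.prod_eq_one fun Q hQ => ?_
  have := v_div l hbig hQ hz
  rw [red_sub vone this.le, red_one, (red_eq_zero_iff this.le).2 this, sub_zero]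

include hbig in
lemma prod_sub_Q (z : ℂ) : ∏ Q ∈ S.erase 0, (l.x z - l.x Q) =
    (∏ Q ∈ S.erase 0, (- l.x Q)) * FF l S z := by
  rw [FF, ← Finset.prod_mul_distrib]
  refine Finset.prod_congr rfl fun Q hQ => ?_
  have := xQ_ne l hbig hQ
  field_simp; ring

include hbig in
lemma prodQ_ne : (∏ Q ∈ S.erase 0, (- l.x Q)) ≠ 0 :=
  Finset.prod_ne_zero_iff.2 fun _ hQ => neg_ne_zero.2 (xQ_ne l hbig hQ)

/-- leading constant of the step -/
noncomputable def CC (l : Lvl V L) (l' : Lvl V L') (S : Finset ℂ) : ℂ :=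
  l.u / (l'.u * ∏ Q ∈ S.erase 0, (- l.x Q))

include hc hbig in
lemma step_main {z w : ℂ} (hz : z ∉ L'.lattice) (hw : w ∉ L'.lattice) :
    (l'.x z - l'.x w) * FF l S z = CC l l' S * ∏ Q ∈ S, (l.x z - l.x (w + Q)) := by
  have h := hc.prod_formula hz hw
  simp only [l.P_sub, l'.P_sub, Finset.prod_mul_distrib, Finset.prod_const] at h
  rw [prod_sub_Q l hbig, Finset.card_erase_of_mem hc.zero] at h
  have h0 := Finset.card_pos.2 ⟨0, hc.zero⟩
  have hu := l.u_ne
  have hu' := l'.u_ne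
  have hP := prodQ_ne l hbig
  obtain ⟨m, hm⟩ : ∃ m, S.card = m + 1 := ⟨S.card - 1, by omega⟩
  rw [hm, Nat.add_sub_cancel, pow_succ] at h
  rw [CC]
  field_simp
  apply mul_left_cancel₀ (pow_ne_zero m hu)
  linear_combination -h

include hc hbig in
lemma shift_int {w Q : ℂ} (hw : w ∉ L'.lattice) (iw : V.valuation (l.x w) ≤ 1) (hQ : Q ∈ S) :
    V.valuation (l.x (w + Q)) ≤ 1 ∧ red V (l.x (w + Q)) = red V (l.x w) := by
  by_cases h0 : Q = 0
  · rw [h0, add_zero]; exact ⟨iw, rfl⟩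
  · have hQ' := Finset.mem_erase.2 ⟨h0, hQ⟩
    obtain ⟨-, h1, h2⟩ := l.trans_big (fun hh => hw (hc.le hh)) (hc.notMem hQ') iw (hbig Q hQ')
    exact ⟨h1, (red_eq_iff h1 iw).2 h2⟩

include hc hbig in
lemma step_prod {z w : ℂ} (hw : w ∉ L'.lattice)
    (iz : V.valuation (l.x z) ≤ 1) (iw : V.valuation (l.x w) ≤ 1) :
    V.valuation (∏ Q ∈ S, (l.x z - l.x (w + Q))) ≤ 1 ∧
    red V (∏ Q ∈ S, (l.x z - l.x (w + Q))) = (red V (l.x z) - red V (l.x w)) ^ S.card := by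
  have h : ∀ Q ∈ S, V.valuation (l.x z - l.x (w + Q)) ≤ 1 := fun Q hQ =>
    vsub iz (shift_int l hc hbig hw iw hQ).1
  refine ⟨vprod h, ?_⟩
  rw [red_prod h, Finset.prod_congr rfl, Finset.prod_const]
  intro Q hQ
  have := shift_int l hc hbig hw iw hQ
  rw [red_sub iz this.1, this.2]

variable (ht : Triple L' l.a l.b l.c)

include hc hbig ht in
lemma v_CC : V.valuation (CC l l' S) = 1 := by
  have ia : V.valuation (l.x l.a) ≤ 1 := by rw [l.x_a]; simp
  have ib : V.valuation (l.x l.b) ≤ 1 := by rw [l.x_b]; simp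
  have ic : V.valuation (l.x l.c) ≤ 1 := l.v_lam.le
  have ja := l'.half_int ht.ha ht.ha2
  have jb := l'.half_int ht.hb ht.hb2
  have jc := l'.half_int ht.hc ht.hc2
  have key : ∀ z w, z ∉ L'.lattice → w ∉ L'.lattice → V.valuation (l.x z) ≤ 1 →
      V.valuation (l.x w) ≤ 1 → V.valuation (l'.x z - l'.x w) ≤ V.valuation (CC l l' S) := by
    intro z w hz hw iz iw
    have h := congrArg V.valuation (step_main l l' hc hbig hz hw)
    rw [map_mul, map_mul, v_FF l hbig iz, mul_one] at h
    rw [h]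
    exact mul_le_of_le_one_right' (step_prod l hc hbig hw iz iw).1
  apply le_antisymm
  · have h := congrArg V.valuation (step_main l l' hc hbig ht.ha ht.hb)
    have h2 := step_prod l hc hbig ht.hb ia ib
    have h3 : V.valuation (∏ Q ∈ S, (l.x l.a - l.x (l.b + Q))) = 1 := by
      apply v_eq_one h2.1
      rw [h2.2, l.x_a, l.x_b, red_zero, red_one]
      exact pow_ne_zero _ (by simp)
    rw [map_mul, map_mul, v_FF l hbig ia, h3, mul_one, mul_one] at h
    rw [← h]
    exact vsub ja jb
  · have k1 := key _ _ ht.ha ht.hb ia ib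
    have k2 := key _ _ ht.hb ht.hc ib ic
    have k3 := key _ _ ht.hc ht.ha ic ia
    have n1 := l'.x_ne ht
    have n2 := l'.x_ne ht.rot
    have n3 := l'.x_ne ht.rot.rot
    rcases l'.half ht.ha ht.ha2 with e | e | e <;> rcases l'.half ht.hb ht.hb2 with e' | e' | e' <;>
    rcases l'.half ht.hc ht.hc2 with e'' | e'' | e'' <;> rw [e, e'] at k1 n1 <;>
    rw [e', e''] at k2 n2 <;>
    rw [e'', e] at k3 n3 <;>
    first
    | exact absurd rfl n1
    | exact absurd rfl n2
    | exact absurd rfl n3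
    | simpa using k1
    | simpa using k2
    | simpa using k3

end step
end St16

namespace St16
open IsLocalRing

section
variable {V : ValuationSubring ℂ} {L L' : PeriodPair} {S : Finset ℂ}
  (l : Lvl V L) (l' : Lvl V L') (hc : Cosets L L' S)
  (hbig : ∀ Q ∈ S.erase 0, 1 < V.valuation (l.x Q)) (ht : Triple L' l.a l.b l.c)

include hc hbig ht in
lemma step_eq {z w : ℂ} (hz : z ∉ L'.lattice) (hw : w ∉ L'.lattice)
    (iz : V.valuation (l.x z) ≤ 1) (iw : V.valuation (l.x w) ≤ 1) :
    V.valuation (l'.x z - l'.x w) ≤ 1 ∧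
    red V (l'.x z - l'.x w) = red V (CC l l' S) * (red V (l.x z) - red V (l.x w)) ^ S.card := by
  have h := step_main l l' hc hbig hz hw
  have hF := v_FF l hbig iz
  have hC := (v_CC l l' hc hbig ht).le
  have hF0 := ne_zero_of_v hF
  have h2 := step_prod l hc hbig hw iz iw
  rw [← eq_div_iff hF0] at h
  rw [h]
  refine ⟨vdiv (vmul hC h2.1) hF, ?_⟩
  rw [red_div (vmul hC h2.1) hF, red_mul hC h2.1, red_FF l hbig iz, h2.2, div_one]

lemma v_a : V.valuation (l.x l.a) ≤ 1 := by rw [l.x_a]; simp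
lemma v_b : V.valuation (l.x l.b) ≤ 1 := by rw [l.x_b]; simp
lemma v_c : V.valuation (l.x l.c) ≤ 1 := l.v_lam.le

include hc hbig ht in
lemma step_integ {z : ℂ} (hz : z ∉ L'.lattice) (iz : V.valuation (l.x z) ≤ 1) :
    V.valuation (l'.x z) ≤ 1 := by
  have h := (step_eq l l' hc hbig ht hz ht.ha iz (v_a l)).1
  have := vadd h (l'.half_int ht.ha ht.ha2)
  simpa using this

include hc hbig ht in
lemma step_contr (hS : 2 ≤ S.card) {z w : ℂ} (hz : z ∉ L'.lattice) (hw : w ∉ L'.lattice)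
    (iz : V.valuation (l.x z) ≤ 1) (iw : V.valuation (l.x w) ≤ 1)
    (h1 : V.valuation (l.x z - l.x w) < 1) (hne : l.x z ≠ l.x w) :
    V.valuation (l'.x z - l'.x w) < V.valuation (l.x z - l.x w) := by
  have h := congrArg V.valuation (step_main l l' hc hbig hz hw)
  rw [map_mul, map_mul, v_FF l hbig iz, v_CC l l' hc hbig ht, mul_one, one_mul,
    ← Finset.mul_prod_erase S _ hc.zero, map_mul, add_zero] at h
  rw [h]
  have h0 : 0 < V.valuation (l.x z - l.x w) :=
    zero_lt_iff.2 ((Valuation.ne_zero_iff _).2 (sub_ne_zero.2 hne))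
  refine mul_lt_of_lt_one_right h0 ?_
  obtain ⟨Q, hQ⟩ : (S.erase 0).Nonempty := by
    rw [← Finset.card_pos, Finset.card_erase_of_mem hc.zero]; omega
  have key : ∀ Q ∈ S, V.valuation (l.x z - l.x (w + Q)) < 1 := by
    intro Q hQ
    have h3 := shift_int l hc hbig hw iw hQ
    rw [← red_eq_iff iz h3.1, h3.2, red_eq_iff iz iw]; exact h1
  rw [← Finset.mul_prod_erase _ _ hQ, map_mul]
  refine (mul_le_of_le_one_right' (vprod fun R hR => ?_)).trans_lt
    (key Q (Finset.mem_of_mem_erase hQ))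
  exact (key R (Finset.mem_of_mem_erase (Finset.mem_of_mem_erase hR))).le

include hc in
lemma FF_ne {z : ℂ} (hz : z ∉ L'.lattice) {Q : ℂ} (hQ : Q ∈ S.erase 0) : l.x z ≠ l.x Q := by
  intro h
  have hm := hc.mem Q (Finset.mem_of_mem_erase hQ)
  rcases l.x_inj (fun hh => hz (hc.le hh)) (hc.notMem hQ) h with h5 | h5
  · exact hz (by have := sub_mem (hc.le h5) hm; simpa using this)
  · exact hz (by have := add_mem (hc.le h5) hm; simpa using this)

include hc hbig ht in
lemma step_expand (hS : 2 ≤ S.card) {z : ℂ} (hz : z ∉ L'.lattice)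
    (h1 : 1 < V.valuation (l.x z)) : V.valuation (l.x z) < V.valuation (l'.x z) := by
  have hx0 : l.x z ≠ 0 := by rintro h; rw [h, map_zero] at h1; exact not_lt_zero h1
  have h := step_main l l' hc hbig hz ht.ha
  rw [← Finset.mul_prod_erase S _ hc.zero, add_zero, l.x_a, sub_zero] at h
  have hzL : z ∉ L.lattice := fun hh => hz (hc.le hh)
  have key : ∀ Q ∈ S.erase 0, V.valuation (1 - l.x z / l.x Q) <
      V.valuation (l.x z - l.x (l.a + Q)) := by
    intro Q hQ
    have h2 := l.kappa (hc.notMem hQ) (by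
      rw [add_comm]; exact hc.notMem_add ht.ha (Finset.mem_of_mem_erase hQ))
    have hQ0 := xQ_ne l hbig hQ
    have h3 : l.x (l.a + Q) = l.lam / l.x Q := by
      rw [add_comm, eq_div_iff hQ0, h2]
    have h4 := v_div l hbig hQ l.v_lam.le
    rw [h3, V.valuation.map_sub_eq_of_lt_left (h4.trans h1)]
    refine V.valuation.map_sub_lt (by simpa using h1) ?_
    rw [map_div₀, div_eq_mul_inv]
    exact mul_lt_of_lt_one_right (zero_lt_one.trans h1) (inv_lt_one_of_one_lt₀ (hbig Q hQ))
  have hF : FF l S z ≠ 0 := by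
    rw [FF, Finset.prod_ne_zero_iff]
    intro Q hQ h0
    have hQ0 := xQ_ne l hbig hQ
    field_simp at h0
    exact FF_ne l hc hz hQ (by linear_combination -h0)
  have hFv : 0 < V.valuation (FF l S z) := zero_lt_iff.2 ((Valuation.ne_zero_iff _).2 hF)
  have hlt : V.valuation (FF l S z) < V.valuation (∏ Q ∈ S.erase 0, (l.x z - l.x (l.a + Q))) := by
    rw [FF, map_prod, map_prod]
    refine Finset.prod_lt_prod_of_nonempty (fun Q hQ => ?_) key ?_
    · rw [zero_lt_iff, Valuation.ne_zero_iff]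
      rw [FF, Finset.prod_ne_zero_iff] at hF
      exact hF Q hQ
    · rw [← Finset.card_pos, Finset.card_erase_of_mem hc.zero]; omega
  have h' := congrArg V.valuation h
  rw [map_mul, map_mul, map_mul, v_CC l l' hc hbig ht, one_mul] at h'
  have h5 : V.valuation (l.x z) < V.valuation (l'.x z - l'.x l.a) := by
    have : V.valuation (l.x z) * V.valuation (FF l S z) <
        V.valuation (l'.x z - l'.x l.a) * V.valuation (FF l S z) := by
      rw [h']
      exact mul_lt_mul_of_pos_left hlt (zero_lt_one.trans h1)
    exact lt_of_mul_lt_mul_right this hFv.le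
  have h6 := l'.half_int ht.ha ht.ha2
  by_contra hcon
  rw [not_lt] at hcon
  have := (V.valuation.map_sub (l'.x z) (l'.x l.a)).trans (max_le hcon (h6.trans h1.le))
  exact absurd h5 (not_lt.2 this)

include hc hbig ht in
lemma step_rel {m : ℕ} (hm : 1 ≤ m) (hcard : S.card = 2 * m + 1)
    (haddp : ∀ a b : ResidueField V, (a + b) ^ S.card = a ^ S.card + b ^ S.card)
    (h2 : V.valuation (2 : ℂ) = 1) (g : ℕ → ℂ) (hg : ∀ j < m, g j ∉ L.lattice)
    (hgv : ∀ j < m, 1 < V.valuation (l.x (g j)))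
    (hpair : ∀ f : ℂ → ℂ, (∀ x y, x - y ∈ L.lattice → f x = f y) →
      ∏ Q ∈ S.erase 0, f Q = ∏ j ∈ Finset.range m, (f (g j) * f (- g j))) :
    Rel l l' S.card where
  odd := ⟨m, hcard⟩
  le := hc.le
  addp := haddp
  expand := fun z hz h1 => step_expand l l' hc hbig ht (by omega) hz h1
  integ := fun z hz iz => step_integ l l' hc hbig ht hz iz
  contr := fun z w hz hw iz iw h1 hne => step_contr l l' hc hbig ht (by omega) hz hw iz iw h1 hne
  frob := by
    refine ⟨red V (CC l l' S), red V (l'.x l.a), red_ne_zero (v_CC l l' hc hbig ht),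
      fun z hz iz => ?_⟩
    have h := (step_eq l l' hc hbig ht hz ht.ha iz (v_a l)).2
    rw [red_sub (step_integ l l' hc hbig ht hz iz) (l'.half_int ht.ha ht.ha2), l.x_a, red_zero,
      sub_zero] at h
    linear_combination h
  hh := by
    refine ⟨red V (CC l l' S) ^ 3, pow_ne_zero _ (red_ne_zero (v_CC l l' hc hbig ht)),
      fun z hz iz => ?_⟩
    have iz' := step_integ l l' hc hbig ht hz iz
    have h := (step_eq l l' hc hbig ht hz ht.ha iz (v_a l)).2
    have h' := (step_eq l l' hc hbig ht hz ht.hb iz (v_b l)).2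
    have h'' := (step_eq l l' hc hbig ht hz ht.hc iz (v_c l)).2
    rw [red_sub iz' (l'.half_int ht.ha ht.ha2), l.x_a, red_zero, sub_zero] at h
    rw [red_sub iz' (l'.half_int ht.hb ht.hb2), l.x_b, red_one] at h'
    rw [red_sub iz' (l'.half_int ht.hc ht.hc2), l.x_c] at h''
    rw [l'.hk_sym ht, h, h', h'', Lvl.hk, mul_pow, mul_pow]; ring
  sign := by
    have hxg : ∀ j < m, l.x (g j) ≠ 0 := fun j hj h0 => by
      have := hgv j hj
      rw [h0, map_zero] at this
      exact not_lt_zero this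
    have hP := prodQ_ne l hbig
    have hG : ∏ j ∈ Finset.range m, l.x (g j) ≠ 0 := Finset.prod_ne_zero_iff.2 fun j hj =>
      hxg j (Finset.mem_range.1 hj)
    refine ⟨1 / ((∏ Q ∈ S.erase 0, (- l.x Q)) * ∏ j ∈ Finset.range m, l.x (g j)), (-4) ^ m,
      one_div_ne_zero (mul_ne_zero hP hG), pow_ne_zero _ ?_, fun z hz iz => ?_⟩
    · have h3 := red_ne_zero h2
      rw [red_ofnat] at h3
      have : (-4 : ResidueField V) = - (2 * 2) := by ring
      rw [this]; exact neg_ne_zero.2 (mul_ne_zero h3 h3)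
    have hzL : z ∉ L.lattice := fun hh => hz (hc.le hh)
    have hd := hc.deriv_formula hz
    simp only [l.P_sub, Finset.prod_mul_distrib, Finset.prod_const] at hd
    rw [prod_sub_Q l hbig] at hd
    have hu := pow_ne_zero (S.erase 0).card l.u_ne
    have hd2 : L.derivWeierstrassP z * ∏ Q ∈ S.erase 0, (l.x z - l.x (z + Q)) =
        L'.derivWeierstrassP z * ((∏ Q ∈ S.erase 0, (- l.x Q)) * FF l S z) := by
      apply mul_left_cancel₀ hu
      linear_combination hd
    rw [hpair (fun Q => l.x z - l.x (z + Q)) (fun x y hxy => by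
      rw [l.x_congr (z := z + x) (w := z + y) (by simpa using hxy)])] at hd2
    let G : ℕ → ℂ := fun j => ((l.x z ^ 2 - l.lam) ^ 2 / l.x (g j) - 4 * l.cub (l.x z)) /
      (1 - l.x z / l.x (g j)) ^ 2
    have hinv : ∀ j < m, ∀ y, V.valuation y ≤ 1 → V.valuation (y / l.x (g j)) < 1 := by
      intro j hj y hy
      rw [map_div₀, div_eq_mul_inv]
      exact (mul_le_of_le_one_left' hy).trans_lt (inv_lt_one_of_one_lt₀ (hgv j hj))
    have hGe : ∀ j ∈ Finset.range m, (l.x z - l.x (z + g j)) * (l.x z - l.x (z + - g j)) =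
        G j / l.x (g j) := by
      intro j hj
      rw [Finset.mem_range] at hj
      have hx := hxg j hj
      have hne : l.x z - l.x (g j) ≠ 0 := by
        rw [sub_ne_zero]; intro h0
        have := hgv j hj
        rw [← h0] at this; exact absurd iz (not_le.2 this)
      have hp := l.pair (hg j hj) hzL
        (fun hh => hne (sub_eq_zero.2 (l.x_congr_neg hh)))
        (fun hh => hne (sub_eq_zero.2 (l.x_congr hh)))
      rw [← sub_eq_add_neg]
      have hne2 : l.x (g j) - l.x z ≠ 0 := by rw [← neg_sub]; exact neg_ne_zero.2 hne
      have e : (l.x z - l.x (z + g j)) * (l.x z - l.x (z - g j)) =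
        ((l.x z ^ 2 - l.lam) ^ 2 - 4 * l.cub (l.x z) * l.x (g j)) / (l.x z - l.x (g j)) ^ 2 := by
        rw [eq_div_iff (pow_ne_zero 2 hne), hp]
      rw [e]
      simp only [G]
      have e2 : 1 - l.x z / l.x (g j) = (l.x (g j) - l.x z) / l.x (g j) := by field_simp
      have e3 : (l.x z - l.x (g j)) ^ 2 = (l.x (g j) - l.x z) ^ 2 := by ring
      rw [e2, e3]
      field_simp
    have c1 : V.valuation ((l.x z ^ 2 - l.lam) ^ 2) ≤ 1 := vpow (vsub (vpow iz 2) l.v_lam.le) 2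
    have c2 : V.valuation (4 * l.cub (l.x z)) ≤ 1 := vmul (vofnat 4) (l.v_cub iz)
    have hGi : ∀ j ∈ Finset.range m, V.valuation (G j) ≤ 1 ∧
        red V (G j) = -4 * l.hk (red V (l.x z)) := by
      intro j hj
      rw [Finset.mem_range] at hj
      have a1 := hinv j hj _ c1
      have a2 := hinv j hj _ iz
      have a3 := v_one_sub a2
      have a4 : V.valuation ((1 - l.x z / l.x (g j)) ^ 2) = 1 := by rw [map_pow, a3, one_pow]
      have a5 := vsub a1.le c2
      refine ⟨vdiv a5 a4, ?_⟩
      rw [red_div a5 a4, red_sub a1.le c2, red_pow a3.le, red_sub vone a2.le,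
        (red_eq_zero_iff a1.le).2 a1, (red_eq_zero_iff a2.le).2 a2, red_mul (vofnat 4) (l.v_cub iz),
        l.red_cub iz, red_ofnat, red_one]
      simp
    rw [Finset.prod_congr rfl hGe, Finset.prod_div_distrib] at hd2
    have hF := v_FF l hbig iz
    have hF0 := ne_zero_of_v hF
    have hGp : V.valuation (∏ j ∈ Finset.range m, G j) ≤ 1 := vprod fun j hj => (hGi j hj).1
    refine ⟨(∏ j ∈ Finset.range m, G j) / FF l S z, vdiv hGp hF, ?_, ?_⟩
    · generalize (∏ Q ∈ S.erase 0, (- l.x Q)) = A at *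
      generalize (∏ j ∈ Finset.range m, l.x (g j)) = B at *
      field_simp
      field_simp at hd2
      linear_combination -hd2
    · rw [red_div hGp hF, red_FF l hbig iz, div_one, red_prod fun j hj => (hGi j hj).1,
        Finset.prod_congr rfl fun j hj => (hGi j hj).2, Finset.prod_const, Finset.card_range,
        mul_pow, hcard]
      congr 2; omega
end
end St16

namespace St16
open IsLocalRing

lemma odd_half {L : PeriodPair} {N : ℕ} (hN : Odd N) {a : ℂ} (h1 : (N : ℂ) * a ∈ L.lattice)
    (h2 : 2 * a ∈ L.lattice) : a ∈ L.lattice := by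
  obtain ⟨m, rfl⟩ := hN
  have h3 : (m : ℂ) * (2 * a) ∈ L.lattice := by
    have := L.lattice.smul_mem (m : ℤ) h2
    rw [zsmul_eq_mul] at this
    exact_mod_cast this
  have := sub_mem h1 h3
  convert this using 1; push_cast; ring

lemma Triple.up {L L' : PeriodPair} {a b c : ℂ} (h : Triple L a b c)
    (hle : L.lattice ≤ L'.lattice) {N : ℕ} (hN : Odd N)
    (hNL : ∀ x ∈ L'.lattice, (N : ℂ) * x ∈ L.lattice) : Triple L' a b c :=
  ⟨fun hh => h.ha (odd_half hN (hNL _ hh) h.ha2), fun hh => h.hb (odd_half hN (hNL _ hh) h.hb2),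
    fun hh => h.hc (odd_half hN (hNL _ hh) h.hc2), hle h.ha2, hle h.hb2, hle h.hc2, hle h.hs⟩

namespace Dat
variable (D : Dat)

lemma triple (i : ℕ) : Triple (D.L i) (1 / 2) (D.τ / (D.p : ℂ) ^ i / 2)
    (-((1 + D.τ / (D.p : ℂ) ^ i) / 2)) where
  ha := by
    intro h
    obtain ⟨a, b, h⟩ := D.mem_L.1 h
    have := D.repr_unique (i := i) (a := 1) (b := 0) (a' := 2 * a) (b' := 2 * b) (by
      push_cast; linear_combination 2 * h)
    omega
  hb := by
    intro h
    obtain ⟨a, b, h⟩ := D.mem_L.1 h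
    have := D.repr_unique (i := i) (a := 0) (b := 1) (a' := 2 * a) (b' := 2 * b) (by
      push_cast; linear_combination 2 * h)
    omega
  hc := by
    intro h
    obtain ⟨a, b, h⟩ := D.mem_L.1 h
    have := D.repr_unique (i := i) (a := -1) (b := -1) (a' := 2 * a) (b' := 2 * b) (by
      push_cast; linear_combination 2 * h)
    omega
  ha2 := D.mem_L.2 ⟨1, 0, by push_cast; ring⟩
  hb2 := D.mem_L.2 ⟨0, 1, by push_cast; ring⟩
  hc2 := D.mem_L.2 ⟨-1, -1, by push_cast; ring⟩
  hs := D.mem_L.2 ⟨0, 0, by push_cast; ring⟩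

lemma p_mul_L {i : ℕ} {x : ℂ} (hx : x ∈ (D.L (i + 1)).lattice) :
    (D.p : ℂ) * x ∈ (D.L i).lattice := by
  obtain ⟨a, b, rfl⟩ := D.mem_L.1 hx
  have hp := D.p_ne
  refine D.mem_L.2 ⟨D.p * a, b, ?_⟩
  push_cast; rw [pow_succ]; field_simp

lemma int_mul {L : PeriodPair} (j : ℤ) {x : ℂ} (hx : x ∈ L.lattice) : (j : ℂ) * x ∈ L.lattice := by
  have := L.lattice.smul_mem j hx
  rwa [zsmul_eq_mul] at this

lemma tau_mem {i : ℕ} (hi : i ≤ D.n) {x : ℂ} (hx : x ∈ (D.L i).lattice) :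
    D.τ * x ∈ (D.L i).lattice := by
  have h1 := D.pi_mem_L hi hx
  have h2 := int_mul (L := D.L i) (-D.s) hx
  have := sub_mem h2 h1
  convert this using 1
  push_cast; linear_combination x * D.hsum

lemma q_mul {i : ℕ} (hi : i ≤ D.n) {x : ℂ} (hx : D.π * x ∈ (D.L i).lattice) :
    (D.q : ℂ) * x ∈ (D.L i).lattice := by
  have := D.tau_mem hi hx
  convert this using 1
  rw [← D.hprod']; ring

variable {D}

lemma q_odd (hodd : Odd D.p) : Odd D.q := hodd.pow

lemma exists_big (hodd : Odd D.p) {i : ℕ} (hi : i < D.n) (l : Lvl D.V (D.L i)) :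
    ∃ Q, Q ∉ (D.L i).lattice ∧ D.π * Q ∈ (D.L i).lattice ∧ 1 < D.V.valuation (l.x Q) := by
  have hle : (D.L i).lattice ≤ (D.Lpi i).lattice := fun x hx =>
    (D.mem_Lpi x).1 (D.pi_mem_L hi.le hx)
  have hNL : ∀ x ∈ (D.Lpi i).lattice, (D.q : ℂ) * x ∈ (D.L i).lattice := fun x hx =>
    D.q_mul hi.le ((D.mem_Lpi x).2 hx)
  obtain ⟨S, hc⟩ := exists_cosets (D.L i) (D.Lpi i) hle D.q (q_odd hodd).pos hNL
  have ht := l.tri.up hle (q_odd hodd) hNL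
  by_contra! hcon
  have hv : ∀ Q ∈ S.erase 0, D.V.valuation (l.x Q) ≤ 1 := fun Q hQ =>
    hcon Q (hc.notMem hQ) ((D.mem_Lpi Q).2 (hc.mem Q (Finset.mem_of_mem_erase hQ)))
  have hu := l.u_ne
  have main : ∀ z, z ∉ (D.Lpi i).lattice → ∏ Q ∈ S, (l.x z - l.x (l.a + Q)) =
      D.π ^ 2 * (l.x (D.π * z) - l.x (D.π * l.a)) * ∏ Q ∈ S.erase 0, (l.x z - l.x Q) := by
    intro z hz
    have h := hc.prod_formula hz ht.ha
    rw [P_scale D.π_ne (D.mem_Lpi (i := i)), P_scale D.π_ne (D.mem_Lpi (i := i)), ← mul_sub] at h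
    simp only [l.P_sub, Finset.prod_mul_distrib, Finset.prod_const] at h
    rw [Finset.card_erase_of_mem hc.zero] at h
    have h0 := Finset.card_pos.2 ⟨0, hc.zero⟩
    obtain ⟨m, hm⟩ : ∃ m, S.card = m + 1 := ⟨S.card - 1, by omega⟩
    rw [hm, Nat.add_sub_cancel, pow_succ] at h
    apply mul_left_cancel₀ (mul_ne_zero (pow_ne_zero m hu) hu)
    linear_combination h
  have hk : ∀ Q ∈ S.erase 0, l.x Q ≠ 0 ∧ l.x (l.a + Q) = l.lam / l.x Q := by
    intro Q hQ
    have h2 := l.kappa (hc.notMem hQ) (by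
      rw [add_comm]; exact hc.notMem_add ht.ha (Finset.mem_of_mem_erase hQ))
    have h0 : l.x Q ≠ 0 := by
      intro h0; rw [h0, mul_zero] at h2; exact l.lam_ne_zero h2.symm
    exact ⟨h0, by rw [add_comm, eq_div_iff h0, h2]⟩
  have mb := main l.b ht.hb
  have mc := main l.c ht.hc
  rw [← Finset.mul_prod_erase S _ hc.zero, add_zero, l.x_a, sub_zero,
    Finset.prod_congr rfl fun Q hQ => by rw [(hk Q hQ).2]] at mb mc
  rw [l.x_b] at mb
  rw [l.x_c] at mc
  have hprod : (∏ Q ∈ S.erase 0, (1 - l.lam / l.x Q)) * ∏ Q ∈ S.erase 0, (l.lam - l.lam / l.x Q) =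
      (∏ Q ∈ S.erase 0, (l.lam / l.x Q ^ 2)) * ((∏ Q ∈ S.erase 0, (1 - l.x Q)) *
        ∏ Q ∈ S.erase 0, (l.lam - l.x Q)) := by
    rw [← Finset.prod_mul_distrib, ← Finset.prod_mul_distrib, ← Finset.prod_mul_distrib]
    refine Finset.prod_congr rfl fun Q hQ => ?_
    have := (hk Q hQ).1
    field_simp; ring
  have n1 : ∏ Q ∈ S.erase 0, (1 - l.x Q) ≠ 0 := Finset.prod_ne_zero_iff.2 fun Q hQ => by
    have := FF_ne l hc ht.hb hQ
    rw [l.x_b] at this; exact sub_ne_zero.2 this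
  have n2 : ∏ Q ∈ S.erase 0, (l.lam - l.x Q) ≠ 0 := Finset.prod_ne_zero_iff.2 fun Q hQ => by
    have := FF_ne l hc ht.hc hQ
    rw [l.x_c] at this; exact sub_ne_zero.2 this
  have key : l.lam * ∏ Q ∈ S.erase 0, (l.lam / l.x Q ^ 2) =
      D.π ^ 4 * ((l.x (D.π * l.b) - l.x (D.π * l.a)) * (l.x (D.π * l.c) - l.x (D.π * l.a))) := by
    apply mul_right_cancel₀ (mul_ne_zero n1 n2)
    rw [mul_assoc, ← hprod]
    linear_combination (l.lam * ∏ Q ∈ S.erase 0, (l.lam - l.lam / l.x Q)) * mb +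
      (D.π ^ 2 * (l.x (D.π * l.b) - l.x (D.π * l.a)) * ∏ Q ∈ S.erase 0, (1 - l.x Q)) * mc
  have hIntg : ∀ w, w ∉ (D.Lpi i).lattice → 2 * w ∈ (D.L i).lattice →
      D.V.valuation (l.x (D.π * w)) ≤ 1 := by
    intro w hw hw2
    refine l.half_int (fun hh => hw ((D.mem_Lpi w).1 hh)) ?_
    have := D.pi_mem_L hi.le hw2
    convert this using 1; ring
  have ia := hIntg _ ht.ha l.tri.ha2
  have ib := hIntg _ ht.hb l.tri.hb2
  have ic := hIntg _ ht.hc l.tri.hc2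
  have e := congrArg D.V.valuation key
  rw [map_mul, map_mul, l.v_lam, one_mul, map_prod, map_pow] at e
  have h1 : D.V.valuation D.π ^ 4 * D.V.valuation ((l.x (D.π * l.b) - l.x (D.π * l.a)) *
      (l.x (D.π * l.c) - l.x (D.π * l.a))) < 1 :=
    (mul_le_of_le_one_right' (vmul (vsub ib ia) (vsub ic ia))).trans_lt
      (pow_lt_one₀ zero_le D.hVπ (by norm_num))
  rw [← e] at h1
  refine absurd h1 (not_lt.2 (Finset.one_le_prod' fun Q hQ => ?_))
  rw [map_div₀, l.v_lam, one_div, map_pow]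
  refine (one_le_inv₀ ?_).2 (pow_le_one' (hv Q hQ) 2)
  exact pow_pos (zero_lt_iff.2 ((Valuation.ne_zero_iff _).2 (hk Q hQ).1)) 2

lemma all_big (hodd : Odd D.p) {i : ℕ} (hi : i < D.n) (l : Lvl D.V (D.L i)) (j : ℤ) :
    l.Big (j * D.Q i) := by
  obtain ⟨Q, hQ, hπ, hv⟩ := exists_big hodd hi l
  have hb : l.Big Q := Or.inr hv
  have hex : ∃ m : ℕ, (D.p : ℂ) ^ m * Q ∈ (D.L i).lattice :=
    ⟨D.n, by rw [← D.q_eq]; exact D.q_mul hi.le hπ⟩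
  classical
  have hm := Nat.find_spec hex
  have hmin := fun k hk => Nat.find_min hex (m := k) hk
  set m := Nat.find hex
  have hm0 : m ≠ 0 := by
    intro h0; rw [h0] at hm; simp at hm; exact hQ hm
  obtain ⟨k, hk⟩ := Nat.exists_eq_succ_of_ne_zero hm0
  have hx := hmin k (by omega)
  set x := (D.p : ℂ) ^ k * Q with hxd
  have hbx : l.Big x := by
    have := Lvl.Big.nsmul l hb (D.p ^ k)
    rwa [Nat.cast_pow] at this
  obtain ⟨t, ht⟩ := D.ker_order_p hi (x := x) (by
      rw [hk, pow_succ] at hm; convert hm using 1; rw [hxd]; ring) (by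
      have := int_mul (L := D.L i) (D.p ^ k : ℤ) hπ
      convert this using 1; rw [hxd]; push_cast; ring)
  have hpt : ¬ (D.p : ℤ) ∣ t := by
    intro h
    have := add_mem ht (D.mul_Q_mem.2 h)
    simp at this; exact hx this
  have hcop : IsCoprime (D.p : ℤ) t := (Nat.prime_iff_prime_int.1 D.hp).coprime_iff_not_dvd.2 hpt
  obtain ⟨a, b, hab⟩ := hcop
  have h2 := Lvl.Big.zsmul l hbx (j * b)
  refine Lvl.Big.congr l h2 ?_
  have h3 := int_mul (L := D.L i) (j * b) ht
  have h4 : ((j * (a * D.p) : ℤ) : ℂ) * D.Q i ∈ (D.L i).lattice :=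
    D.mul_Q_mem.2 ⟨j * a, by ring⟩
  have h5 := sub_mem h3 h4
  convert h5 using 1
  have : ((a * D.p + b * t : ℤ) : ℂ) = 1 := by rw [hab]; simp
  push_cast at this ⊢
  linear_combination (j * D.Q i) * this

end Dat
end St16

namespace St16
open IsLocalRing
namespace Dat
variable {D : Dat}

lemma S_card (i : ℕ) : (D.S i).card = D.p := by
  rw [S, Finset.card_image_of_injective _ (D.S_inj i), Finset.card_range]

lemma S_erase {m : ℕ} (hm : D.p = 2 * m + 1) (i : ℕ) : (D.S i).erase 0 =
    (Finset.range (m + m)).image (fun j : ℕ => ((j + 1 : ℕ) : ℂ) * D.Q i) := by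
  ext x
  simp only [S, Finset.mem_erase, Finset.mem_image, Finset.mem_range, hm]
  constructor
  · rintro ⟨h0, j, hj, rfl⟩
    have : j ≠ 0 := by rintro rfl; simp at h0
    exact ⟨j - 1, by omega, by congr 2; omega⟩
  · rintro ⟨j, hj, rfl⟩
    refine ⟨?_, j + 1, by omega, rfl⟩
    intro h
    have := D.S_inj i (a₁ := j + 1) (a₂ := 0) (by simpa using h)
    omega

lemma pairing {m : ℕ} (hm : D.p = 2 * m + 1) (i : ℕ) (f : ℂ → ℂ)
    (hf : ∀ x y, x - y ∈ (D.L i).lattice → f x = f y) :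
    ∏ Q ∈ (D.S i).erase 0, f Q =
      ∏ j ∈ Finset.range m, (f (((j + 1 : ℕ) : ℂ) * D.Q i) * f (-(((j + 1 : ℕ) : ℂ) * D.Q i))) := by
  rw [S_erase hm, Finset.prod_image (fun a _ b _ h => by
    have := D.S_inj i h; omega), Finset.prod_range_add, Finset.prod_mul_distrib]
  congr 1
  rw [← Finset.prod_range_reflect]
  refine Finset.prod_congr rfl fun j hj => hf _ _ ?_
  rw [Finset.mem_range] at hj
  have h := (D.mul_Q_mem (i := i) (j := D.p)).2 (dvd_refl _)
  convert h using 1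
  have e : m + (m - 1 - j) + 1 + (j + 1) = D.p := by omega
  have e' : ((m + (m - 1 - j) + 1 + (j + 1) : ℕ) : ℂ) = ((D.p : ℕ) : ℂ) := by rw [e]
  rw [sub_neg_eq_add, ← add_mul, ← Nat.cast_add, e]
  simp

lemma v_two (hodd : Odd D.p) : D.V.valuation (2 : ℂ) = 1 := by
  obtain ⟨m, hm⟩ := hodd
  by_contra h
  have h2 : D.V.valuation (2 : ℂ) < 1 := lt_of_le_of_ne (vofnat 2) h
  have h3 : (1 : ℂ) = D.p - m * 2 := by rw [hm]; push_cast; ring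
  have h4 : D.V.valuation (1 : ℂ) < 1 := by
    rw [h3]
    refine D.V.valuation.map_sub_lt D.hVp ?_
    rw [map_mul]
    exact (mul_le_of_le_one_left' (vnat m)).trans_lt h2
  simp at h4

lemma addp_k (D : Dat) (a b : ResidueField D.V) : (a + b) ^ D.p = a ^ D.p + b ^ D.p := by
  have := charP_k D.hp D.hVp
  have : Fact D.p.Prime := ⟨D.hp⟩
  exact add_pow_char a b D.p

lemma step (hodd : Odd D.p) {i : ℕ} (hi : i < D.n) (l : Lvl D.V (D.L i))
    (l' : Lvl D.V (D.L (i + 1))) : Rel l l' D.p := by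
  obtain ⟨m, hm⟩ := id hodd
  have hm1 : 1 ≤ m := by
    have := D.hp.two_le; omega
  have hb := fun j : ℤ => all_big hodd hi l j
  have hg : ∀ j < m, (((j + 1 : ℕ) : ℂ) * D.Q i) ∉ (D.L i).lattice := by
    intro j hj h
    have h' := (D.mul_Q_mem (i := i) (j := ((j + 1 : ℕ) : ℤ))).1 (by exact_mod_cast h)
    have := Nat.le_of_dvd (by omega) (Int.natCast_dvd_natCast.1 h')
    omega
  rw [← S_card i]
  refine step_rel l l' (D.cosets i) ?_ (l.tri.up (D.L_mono i) hodd fun x hx => D.p_mul_L hx) hm1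
    (by rw [S_card, hm]) (by rw [S_card]; exact D.addp_k) (v_two hodd)
    (fun j => ((j + 1 : ℕ) : ℂ) * D.Q i) hg ?_ (pairing hm i)
  · intro Q hQ
    obtain ⟨j, hj, rfl⟩ := Finset.mem_image.1 (Finset.mem_of_mem_erase hQ)
    have := hb j
    rcases this with h | h
    · exact absurd (by exact_mod_cast h) ((D.cosets i).notMem hQ)
    · exact_mod_cast h
  · intro j hj
    rcases hb ((j + 1 : ℕ) : ℤ) with h | h
    · exact absurd (by exact_mod_cast h) (hg j hj)
    · exact_mod_cast h

lemma rel (hodd : Odd D.p) (l0 : Lvl D.V (D.L 0)) : ∀ i, i < D.n →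
    ∀ l : Lvl D.V (D.L (i + 1)), Rel l0 l (D.p ^ (i + 1)) := by
  intro i
  induction i with
  | zero => intro hi l; simpa using step hodd hi l0 l
  | succ i ih =>
    intro hi l
    obtain ⟨l'⟩ := Lvl.exists_of_triple (V := D.V) (D.triple (i + 1))
    have h1 := ih (by omega) l'
    exact h1.trans (step hodd hi l' l)

/-- the transported labelling at the top -/
noncomputable def top (l : Lvl D.V (D.L 0)) : Lvl D.V (D.L D.n) where
  a := l.a / D.π
  b := l.b / D.π
  c := l.c / D.π
  tri := by
    have hπ := D.π_ne
    have h : ∀ x, x / D.π ∈ (D.L D.n).lattice ↔ x ∈ (D.L 0).lattice := fun x => by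
      rw [← D.pi_mem_L0, mul_div_cancel₀ _ hπ]
    have ht := l.tri
    refine ⟨by rw [h]; exact ht.ha, by rw [h]; exact ht.hb, by rw [h]; exact ht.hc, ?_, ?_, ?_, ?_⟩
    · rw [← mul_div_assoc, h]; exact ht.ha2
    · rw [← mul_div_assoc, h]; exact ht.hb2
    · rw [← mul_div_assoc, h]; exact ht.hc2
    · rw [← add_div, ← add_div, h]; exact ht.hs
  hl := by
    have hπ := D.π_ne
    simp only [P_scale hπ D.pi_mem_L0, mul_div_cancel₀ _ hπ, ← mul_sub, map_mul, l.hl]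

lemma top_x (l : Lvl D.V (D.L 0)) (z : ℂ) : (top l).x z = l.x (D.π * z) := by
  have hπ := D.π_ne
  have hu := l.u_ne
  rw [Lvl.u] at hu
  simp only [Lvl.x, top, Lvl.u, P_scale hπ D.pi_mem_L0, mul_div_cancel₀ _ hπ, ← mul_sub]
  field_simp

lemma top_lam (l : Lvl D.V (D.L 0)) : (top l).lam = l.lam := by
  rw [Lvl.lam, top_x]; simp only [top, mul_div_cancel₀ _ D.π_ne]; rfl

lemma rel_top (hodd : Odd D.p) (l : Lvl D.V (D.L 0)) : Rel l (top l) D.q := by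
  obtain ⟨m, hm⟩ : ∃ m, D.n = m + 1 := ⟨D.n - 1, by have := D.hn; omega⟩
  have h := rel hodd l m (by omega)
  rw [← hm] at h
  exact h (top l)

end Dat
end St16

namespace St16
open IsLocalRing

lemma comb {ι k : Type*} [Fintype ι] [DecidableEq ι] [DecidableEq k] (M : AddSubgroup ℂ) (π : ℂ)
    (hπ : ∀ x ∈ M, π * x ∈ M) (z : ι → ℂ) (eps : ι → ℤ) (heps : ∀ i, eps i = 1 ∨ eps i = -1)
    (hpi : ∀ i, π * z i - eps i * z i ∈ M) (hinj : ∀ i j, eps i = eps j → z i - z j ∈ M → i = j)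
    (t : ι → k) (ht : ∀ i j, t i = t j → z i + z j ∈ M ∨ z i - z j ∈ M)
    (Fix : Finset k) (hFix : ∀ i, t i ∈ Fix) (q : ℕ) (hq : Fix.card ≤ q)
    (hcard : Fintype.card ι = 2 * q) (s : ℤ) (hs : ∑ i, eps i = 2 * s) :
    Fix.card = q ∧ (∀ y ∈ Fix, ∃ i, t i = y) ∧
    ∃ sg : k → ℤ, (∀ i, 2 * z i ∈ M → sg (t i) = 0) ∧ (∀ i, 2 * z i ∉ M → sg (t i) = eps i) ∧
      ∑ y ∈ Fix, sg y = s := by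
  have hdiff : ∀ i j, t i = t j → eps i ≠ eps j → 2 * z i ∈ M := by
    intro i j hij hne
    have hej : (eps j : ℂ) = - eps i := by
      rcases heps i with h | h <;> rcases heps j with h' | h' <;> rw [h, h'] at hne ⊢ <;> simp at hne ⊢
    have hi := hpi i
    have hj := hpi j
    rw [hej] at hj
    have key : 2 * (eps i * z i) ∈ M := by
      rcases ht i j hij with h | h
      · have h1 := hπ _ h
        have h2 : (eps i : ℂ) * (z i + z j) ∈ M := by
          have := M.zsmul_mem h (eps i); rwa [zsmul_eq_mul] at this
        have := add_mem (sub_mem (sub_mem h1 hi) hj) h2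
        convert this using 1; ring
      · have h1 := hπ _ h
        have h2 : (eps i : ℂ) * (z i - z j) ∈ M := by
          have := M.zsmul_mem h (eps i); rwa [zsmul_eq_mul] at this
        have := add_mem (add_mem (sub_mem h1 hi) hj) h2
        convert this using 1; ring
    rcases heps i with h | h <;> rw [h] at key
    · simpa using key
    · have := neg_mem key; simpa using this
  have hsame : ∀ i j, t i = t j → eps i = eps j → i ≠ j → z i + z j ∈ M ∧ 2 * z i ∉ M := by
    intro i j hij he hne
    have h1 : z i + z j ∈ M := (ht i j hij).resolve_right fun h => hne (hinj i j he h)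
    refine ⟨h1, fun h2 => hne (hinj i j he ?_)⟩
    have := sub_mem h2 h1
    convert this using 1; ring
  have hfib : ∀ y, (Finset.univ.filter fun i => t i = y).card ≤ 2 := by
    intro y
    by_contra hcon
    rw [not_le, Finset.two_lt_card] at hcon
    obtain ⟨a, ha, b, hb, c, hc, hab, hac, hbc⟩ := hcon
    simp only [Finset.mem_filter, Finset.mem_univ, true_and] at ha hb hc
    have aux : ∀ a b c, t a = y → t b = y → t c = y → a ≠ b → a ≠ c → b ≠ c → eps a = eps b →
        False := by
      intro a b c ha hb hc hab hac hbc he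
      have h1 := hsame a b (ha.trans hb.symm) he hab
      by_cases h2 : eps a = eps c
      · have h3 := hsame a c (ha.trans hc.symm) h2 hac
        refine hbc (hinj b c (he.symm.trans h2) ?_)
        have := sub_mem h1.1 h3.1
        convert this using 1; ring
      · exact h1.2 (hdiff a c (ha.trans hc.symm) h2)
    by_cases h1 : eps a = eps b
    · exact aux a b c ha hb hc hab hac hbc h1
    by_cases h2 : eps a = eps c
    · exact aux a c b ha hc hb hac hab hbc.symm h2
    · refine aux b c a hb hc ha hbc hab.symm hac.symm ?_
      rcases heps a with h | h <;> rcases heps b with h' | h' <;> rcases heps c with h'' | h'' <;>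
        rw [h, h'] at h1 <;> rw [h, h''] at h2 <;> simp_all
  have htot : 2 * q = ∑ y ∈ Fix, (Finset.univ.filter fun i => t i = y).card := by
    rw [← hcard, ← Finset.card_univ]
    exact Finset.card_eq_sum_card_fiberwise fun i _ => hFix i
  have hle : ∑ y ∈ Fix, (Finset.univ.filter fun i => t i = y).card ≤ Fix.card * 2 := by
    exact Finset.sum_le_card_nsmul _ _ _ fun y _ => hfib y
  have hcq : Fix.card = q := by omega
  have htwo : ∀ y ∈ Fix, (Finset.univ.filter fun i => t i = y).card = 2 := by
    have h1 : ∑ y ∈ Fix, (Finset.univ.filter fun i => t i = y).card = ∑ y ∈ Fix, 2 := by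
      rw [← htot, Finset.sum_const, smul_eq_mul, hcq]; ring
    exact (Finset.sum_eq_sum_iff_of_le fun y _ => hfib y).1 h1
  have hval : ∀ i, ∑ j ∈ Finset.univ.filter (fun j => t j = t i), eps j =
      2 * (open Classical in if 2 * z i ∈ M then 0 else eps i) := by
    intro i
    obtain ⟨a, b, hab, hS⟩ := Finset.card_eq_two.1 (htwo (t i) (hFix i))
    rw [hS, Finset.sum_pair hab]
    have hi : i ∈ ({a, b} : Finset ι) := by rw [← hS]; simp
    have ha : t a = t i := by
      have : a ∈ Finset.univ.filter (fun j => t j = t i) := by rw [hS]; simp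
      simpa using this
    have hb : t b = t i := by
      have : b ∈ Finset.univ.filter (fun j => t j = t i) := by rw [hS]; simp
      simpa using this
    rw [Finset.mem_insert, Finset.mem_singleton] at hi
    rcases hi with rfl | rfl
    · by_cases he : eps i = eps b
      · rw [if_neg (hsame i b hb.symm he hab).2, ← he]; ring
      · rw [if_pos (hdiff i b hb.symm he)]
        rcases heps i with h | h <;> rcases heps b with h' | h' <;> rw [h, h'] at he ⊢ <;> simp at he ⊢
    · by_cases he : eps i = eps a
      · rw [if_neg (hsame i a ha.symm he hab.symm).2, ← he]; ring
      · rw [if_pos (hdiff i a ha.symm he)]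
        rcases heps i with h | h <;> rcases heps a with h' | h' <;> rw [h, h'] at he ⊢ <;> simp at he ⊢
  have hsurj : ∀ y ∈ Fix, ∃ i, t i = y := by
    intro y hy
    have := htwo y hy
    obtain ⟨i, hi⟩ := Finset.card_pos.1 (by rw [this]; norm_num)
    exact ⟨i, by simpa using hi⟩
  refine ⟨hcq, hsurj, fun y => (∑ j ∈ Finset.univ.filter (fun j => t j = y), eps j) / 2, ?_, ?_, ?_⟩
  · intro i hi
    simp only [hval i, if_pos hi]; rfl
  · intro i hi
    simp only [hval i, if_neg hi]; simp
  · have h1 : ∑ y ∈ Fix, ∑ j ∈ Finset.univ.filter (fun j => t j = y), eps j = 2 * s := by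
      rw [← hs]
      exact Finset.sum_fiberwise_of_maps_to (fun i _ => hFix i) _
    have h2 : ∑ y ∈ Fix, ∑ j ∈ Finset.univ.filter (fun j => t j = y), eps j =
        2 * ∑ y ∈ Fix, (∑ j ∈ Finset.univ.filter (fun j => t j = y), eps j) / 2 := by
      rw [Finset.mul_sum]
      refine Finset.sum_congr rfl fun y hy => ?_
      obtain ⟨i, rfl⟩ := hsurj y hy
      rw [hval i, Int.mul_ediv_cancel_left _ two_ne_zero]
    show ∑ y ∈ Fix, (∑ j ∈ Finset.univ.filter (fun j => t j = y), eps j) / 2 = s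
    omega

namespace Dat
variable (D : Dat)

/-- index type for the fixed points -/
abbrev ι : Type := Fin (D.q + D.s) ⊕ Fin (D.q - D.s)

/-- the fixed points -/
noncomputable def zz : D.ι → ℂ
  | Sum.inl k => ((k : ℕ) + 1 : ℂ) / (D.π - 1)
  | Sum.inr k => ((k : ℕ) + 1 : ℂ) / (D.π + 1)

/-- the signs -/
def eps : D.ι → ℤ
  | Sum.inl _ => 1
  | Sum.inr _ => -1

lemma eps_pm (i : D.ι) : D.eps i = 1 ∨ D.eps i = -1 := by
  rcases i with i | i <;> simp [eps]

lemma π_im : D.π.im ≠ 0 := by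
  have := congrArg Complex.im D.hsum
  simp at this
  intro h; rw [h, zero_add] at this; exact D.τ_im this

lemma pm_ne : D.π - 1 ≠ 0 ∧ D.π + 1 ≠ 0 := by
  constructor <;> intro h <;> have := congrArg Complex.im h <;> simp at this <;> exact D.π_im this

lemma div1 {m : ℤ} (h : (m : ℂ) / (D.π - 1) ∈ (D.L 0).lattice) : ((D.q + 1 + D.s : ℕ) : ℤ) ∣ m := by
  obtain ⟨a, b, h⟩ := D.mem_L0.1 h
  rw [div_eq_iff D.pm_ne.1] at h
  have := D.repr_unique0 (a := -m) (b := m) (a' := (D.q + 1 + D.s : ℕ) * a)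
    (b' := (D.q + 1 + D.s : ℕ) * b) (by
      push_cast
      linear_combination (D.τ - 1) * h + (a + b * D.τ) * (D.hprod' - D.hsum))
  exact ⟨b, this.2⟩

lemma div2 (hs : D.s ≤ D.q) {m : ℤ} (h : (m : ℂ) / (D.π + 1) ∈ (D.L 0).lattice) :
    ((D.q - D.s + 1 : ℕ) : ℤ) ∣ m := by
  obtain ⟨a, b, h⟩ := D.mem_L0.1 h
  rw [div_eq_iff D.pm_ne.2] at h
  have := D.repr_unique0 (a := m) (b := m) (a' := (D.q - D.s + 1 : ℕ) * a)
    (b' := (D.q - D.s + 1 : ℕ) * b) (by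
      push_cast [Nat.cast_sub hs]
      linear_combination (D.τ + 1) * h + (a + b * D.τ) * (D.hprod' + D.hsum))
  exact ⟨b, this.2⟩

lemma zz_pi (i : D.ι) : D.π * D.zz i - D.eps i * D.zz i ∈ (D.L 0).lattice := by
  have h1 := D.pm_ne.1
  have h2 := D.pm_ne.2
  rcases i with k | k
  · refine D.mem_L0.2 ⟨k + 1, 0, ?_⟩
    simp only [zz, eps]; push_cast; field_simp; ring
  · refine D.mem_L0.2 ⟨k + 1, 0, ?_⟩
    simp only [zz, eps]; push_cast; field_simp; ring

lemma zz_notMem (hs : D.s ≤ D.q) (i : D.ι) : D.zz i ∉ (D.L 0).lattice := by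
  intro h
  rcases i with k | k
  · have := D.div1 (m := (k + 1 : ℕ)) (by simpa [zz] using h)
    have := Nat.le_of_dvd (by omega) (Int.natCast_dvd_natCast.1 this)
    omega
  · have := D.div2 hs (m := (k + 1 : ℕ)) (by simpa [zz] using h)
    have := Nat.le_of_dvd (by omega) (Int.natCast_dvd_natCast.1 this)
    omega

lemma small_dvd {a b N : ℕ} (ha : a < N) (hb : b < N) (h : (N : ℤ) ∣ (a : ℤ) - b) : a = b := by
  have := Int.eq_zero_of_abs_lt_dvd h (by rw [abs_lt]; constructor <;> omega)
  omega

lemma zz_inj (hs : D.s ≤ D.q) (i j : D.ι) (he : D.eps i = D.eps j)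
    (h : D.zz i - D.zz j ∈ (D.L 0).lattice) : i = j := by
  rcases i with k | k <;> rcases j with m | m
  · have := D.div1 (m := (k : ℕ) - (m : ℕ)) (by
      convert h using 1
      simp only [zz]; push_cast; ring)
    have := small_dvd (by omega) (by omega) this
    rw [Fin.ext this]
  · simp [eps] at he
  · simp [eps] at he
  · have := D.div2 hs (m := (k : ℕ) - (m : ℕ)) (by
      convert h using 1
      simp only [zz]; push_cast; ring)
    have := small_dvd (by omega) (by omega) this
    rw [Fin.ext this]

lemma count (hs : D.s ≤ D.q) {k : Type*} [DecidableEq k] (t : D.ι → k)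
    (ht : ∀ i j, t i = t j → D.zz i + D.zz j ∈ (D.L 0).lattice ∨ D.zz i - D.zz j ∈ (D.L 0).lattice)
    (Fix : Finset k) (hFix : ∀ i, t i ∈ Fix) (hq : Fix.card ≤ D.q) :
    Fix.card = D.q ∧ (∀ y ∈ Fix, ∃ i, t i = y) ∧
    ∃ sg : k → ℤ, (∀ i, 2 * D.zz i ∈ (D.L 0).lattice → sg (t i) = 0) ∧
      (∀ i, 2 * D.zz i ∉ (D.L 0).lattice → sg (t i) = D.eps i) ∧ ∑ y ∈ Fix, sg y = D.s := by
  refine comb (D.L 0).lattice.toAddSubgroup D.π (fun x hx => D.pi_mem_L (Nat.zero_le _) hx) D.zz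
    D.eps D.eps_pm D.zz_pi (D.zz_inj hs) t ht Fix hFix D.q hq ?_ D.s ?_
  · simp [ι]; omega
  · simp only [ι, Fintype.sum_sum_type, eps]
    simp [Nat.cast_sub hs]; ring

/-- elements fixed by the q-power map -/
noncomputable def Fix : Finset (ResidueField D.V) :=
  open Classical in ((Polynomial.X ^ D.q - Polynomial.X : Polynomial (ResidueField D.V)).roots).toFinset

lemma q_gt : 1 < D.q := one_lt_pow₀ D.hp.one_lt D.hn.ne'

lemma mem_Fix {y : ResidueField D.V} : y ∈ D.Fix ↔ y ^ D.q = y := by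
  classical
  rw [Fix, Multiset.mem_toFinset, Polynomial.mem_roots (FiniteField.X_pow_card_sub_X_ne_zero _ D.q_gt),
    Polynomial.IsRoot.def]
  simp [sub_eq_zero]

lemma Fix_card : D.Fix.card ≤ D.q := by
  classical
  rw [Fix]
  refine (Multiset.toFinset_card_le _).trans ((Polynomial.card_roots' _).trans ?_)
  rw [FiniteField.X_pow_card_sub_X_natDegree_eq _ D.q_gt]

end Dat
end St16

namespace St16
open IsLocalRing

namespace Dat
variable (D : Dat)

lemma zz_pi_cases (i : D.ι) : (D.eps i = 1 ∧ D.π * D.zz i - D.zz i ∈ (D.L 0).lattice) ∨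
    (D.eps i = -1 ∧ D.π * D.zz i + D.zz i ∈ (D.L 0).lattice) := by
  have h := D.zz_pi i
  rcases D.eps_pm i with e | e <;> rw [e] at h
  · left; exact ⟨e, by simpa using h⟩
  · right; exact ⟨e, by simpa using h⟩

lemma zz_P (i : D.ι) : (D.L 0).weierstrassP (D.π * D.zz i) = (D.L 0).weierstrassP (D.zz i) := by
  rcases D.zz_pi_cases i with ⟨-, h⟩ | ⟨-, h⟩
  · exact P_congr _ h
  · exact P_congr_neg _ h

lemma zz_P' (i : D.ι) : (D.L 0).derivWeierstrassP (D.π * D.zz i) =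
    D.eps i * (D.L 0).derivWeierstrassP (D.zz i) := by
  rcases D.zz_pi_cases i with ⟨e, h⟩ | ⟨e, h⟩
  · rw [P'_congr _ h, e]; simp
  · rw [e, P'_congr (b := - D.zz i) _ (by simpa using h), (D.L 0).derivWeierstrassP_neg]; simp

lemma zz_notMem_n (hs : D.s ≤ D.q) (i : D.ι) : D.zz i ∉ (D.L D.n).lattice := by
  intro h
  rw [← D.pi_mem_L0] at h
  apply D.zz_notMem hs i
  rcases D.zz_pi_cases i with ⟨-, h'⟩ | ⟨-, h'⟩
  · have := sub_mem h h'; simpa using this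
  · have := sub_mem h' h; simpa using this

lemma zz_three (hs : D.s ≤ D.q) (hq3 : 2 < D.q) : ∃ i j : D.ι, ¬ (D.zz i + D.zz j ∈ (D.L 0).lattice ∨
    D.zz i - D.zz j ∈ (D.L 0).lattice) := by
  by_contra hcon
  push Not at hcon
  have h1 := hcon (Sum.inl ⟨0, by omega⟩) (Sum.inl ⟨1, by omega⟩)
  have h2 := hcon (Sum.inl ⟨0, by omega⟩) (Sum.inl ⟨2, by omega⟩)
  have h1 := h1.resolve_right fun h => by
    have := D.zz_inj hs (Sum.inl ⟨0, by omega⟩) (Sum.inl ⟨1, by omega⟩) rfl h; simp at this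
  have h2 := h2.resolve_right fun h => by
    have := D.zz_inj hs (Sum.inl ⟨0, by omega⟩) (Sum.inl ⟨2, by omega⟩) rfl h; simp at this
  have h3 := sub_mem h1 h2
  rw [add_sub_add_left_eq_sub] at h3
  have := D.zz_inj hs (Sum.inl ⟨1, by omega⟩) (Sum.inl ⟨2, by omega⟩) rfl h3
  simp at this

theorem odd_final (hodd : Odd D.p) (hs : D.s ≤ D.q) :
    ∃ (e1 e2 e3 : ResidueField D.V) (c : ℤ) (sg : ResidueField D.V → ℤ),
      D.Fix.card = D.q ∧ e1 ≠ e2 ∧ e1 ≠ e3 ∧ e2 ≠ e3 ∧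
      (e1 + e2 + e3) ^ D.q = e1 + e2 + e3 ∧
      (e1 * e2 + e2 * e3 + e3 * e1) ^ D.q = e1 * e2 + e2 * e3 + e3 * e1 ∧
      (e1 * e2 * e3) ^ D.q = e1 * e2 * e3 ∧ (c = 1 ∨ c = -1) ∧
      (∀ t ∈ D.Fix, (t - e1) * (t - e2) * (t - e3) = 0 → sg t = 0) ∧
      (∀ t ∈ D.Fix, (t - e1) * (t - e2) * (t - e3) ≠ 0 → (sg t = 1 ∨ sg t = -1) ∧
        (sg t : ResidueField D.V) = c * ((t - e1) * (t - e2) * (t - e3)) ^ ((D.q - 1) / 2)) ∧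
      ∑ t ∈ D.Fix, sg t = D.s := by
  classical
  obtain ⟨l⟩ := Lvl.exists_of_triple (V := D.V) (D.triple 0)
  have R := rel_top hodd l
  have tn : Triple (D.L D.n) l.a l.b l.c := l.tri.up R.le (D.q_odd hodd) (fun x hx => by
    rw [← D.pi_mem_L0] at hx
    exact D.q_mul (Nat.zero_le _) hx)
  have hia := l.half_int l.tri.ha l.tri.ha2
  have hib := l.half_int l.tri.hb l.tri.hb2
  have hic := l.half_int l.tri.hc l.tri.hc2
  have hl1 : D.V.valuation (l.lam - 1) = 1 := by
    by_contra hne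
    have hlt : D.V.valuation (l.lam - 1) < 1 := lt_of_le_of_ne (vsub l.v_lam.le vone) hne
    have h1 := R.contr l.c l.b tn.hc tn.hb hic hib (by rwa [l.x_b, l.x_c])
      (by rw [l.x_b, l.x_c]; exact l.lam_ne_one)
    rw [l.x_b, l.x_c] at h1
    have h2 := (top l).x_ne tn.rot
    have hs1 : D.V.valuation (1 - l.lam) = D.V.valuation (l.lam - 1) := Valuation.map_sub_swap _ _ _
    have hv := l.v_lam
    rcases (top l).half tn.hb tn.hb2 with e | e | e <;>
    rcases (top l).half tn.hc tn.hc2 with e' | e' | e' <;> rw [e, e'] at h1 h2 <;>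
    (try rw [top_lam] at h1) <;>
    first
      | exact absurd rfl h2
      | (try simp only [sub_zero, zero_sub, Valuation.map_neg, map_one, hv, hs1] at h1
         first
          | exact absurd h1 (lt_irrefl _)
          | exact absurd (h1.trans hlt) (lt_irrefl _))
  have hl1' : red D.V l.lam ≠ 1 := by
    have := red_ne_zero hl1
    rwa [red_sub l.v_lam.le vone, red_one, sub_ne_zero] at this
  have hl0' : red D.V l.lam ≠ 0 := red_ne_zero l.v_lam
  -- the points
  have hzn := D.zz_notMem_n hs
  have hz0 := D.zz_notMem hs
  have hxz : ∀ i, (top l).x (D.zz i) = l.x (D.zz i) := fun i => by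
    rw [top_x, Lvl.x, Lvl.x, zz_P]
  have hiz : ∀ i, D.V.valuation (l.x (D.zz i)) ≤ 1 := fun i => by
    by_contra h
    have := R.expand _ (hzn i) (not_le.1 h)
    rw [hxz] at this
    exact lt_irrefl _ this
  have hXinj : ∀ i j, red D.V (l.x (D.zz i)) = red D.V (l.x (D.zz j)) →
      D.zz i + D.zz j ∈ (D.L 0).lattice ∨ D.zz i - D.zz j ∈ (D.L 0).lattice := by
    intro i j h
    rw [red_eq_iff (hiz i) (hiz j)] at h
    refine l.x_inj (hz0 i) (hz0 j) ?_
    by_contra hne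
    have := R.contr _ _ (hzn i) (hzn j) (hiz i) (hiz j) h hne
    rw [hxz, hxz] at this
    exact lt_irrefl _ this
  obtain ⟨C, E, hC, hf⟩ := R.frob
  have hXf : ∀ i, red D.V (l.x (D.zz i)) = C * red D.V (l.x (D.zz i)) ^ D.q + E := fun i => by
    have := hf _ (hzn i) (hiz i)
    rwa [hxz] at this
  have hq3 : 2 < D.q := by
    have h1 := D.q_gt
    obtain ⟨m, hm⟩ := D.q_odd hodd
    omega
  obtain ⟨i0, i1, hi01⟩ := D.zz_three hs hq3
  have hi01 : red D.V (l.x (D.zz i0)) ≠ red D.V (l.x (D.zz i1)) := fun h => hi01 (hXinj _ _ h)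
  set X : D.ι → ResidueField D.V := fun i => red D.V (l.x (D.zz i)) with hX
  set X0 := X i0 with hX0
  set ρ := X i1 - X0 with hρ
  have hρ0 : ρ ≠ 0 := sub_ne_zero.2 (Ne.symm hi01)
  have hsubq : ∀ a b : ResidueField D.V, (a - b) ^ D.q = a ^ D.q - b ^ D.q := by
    intro a b
    have := R.addp (a - b) b
    rw [sub_add_cancel] at this
    rw [this]; ring
  have hCρ : C * ρ ^ D.q = ρ := by
    rw [hρ, hsubq]
    linear_combination hXf i0 - hXf i1
  have hρq : ρ ^ D.q ≠ 0 := pow_ne_zero _ hρ0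
  have hpow : ∀ Y Y' : ResidueField D.V, Y' = C * Y ^ D.q + E →
      ((Y - X0) / ρ) ^ D.q = (Y' - X0) / ρ := by
    intro Y Y' h
    have h0 := hXf i0
    rw [div_pow, hsubq, div_eq_div_iff hρq hρ0, h]
    have : X0 = C * X0 ^ D.q + E := hXf i0
    linear_combination (X0 ^ D.q - Y ^ D.q) * hCρ + ρ ^ D.q * this
  set t : D.ι → ResidueField D.V := fun i => (X i - X0) / ρ with ht
  have htF : ∀ i, t i ∈ D.Fix := fun i => by
    rw [mem_Fix]; exact hpow _ _ (hXf i)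
  have htX : ∀ i, X i = X0 + ρ * t i := fun i => by
    simp only [ht]; field_simp; ring
  have htinj : ∀ i j, t i = t j → D.zz i + D.zz j ∈ (D.L 0).lattice ∨
      D.zz i - D.zz j ∈ (D.L 0).lattice := by
    intro i j h
    refine hXinj i j ?_
    have := htX i
    rw [h, ← htX j] at this
    exact this
  obtain ⟨hcard, hsurj, sg, hsg0, hsg1, hsum⟩ := D.count hs t htinj D.Fix htF D.Fix_card
  -- roots
  have hroot : ∀ i, l.hk (X i) = 0 → 2 * D.zz i ∈ (D.L 0).lattice := by
    intro i hi
    have key : ∀ w, w ∉ (D.L 0).lattice → 2 * w ∈ (D.L 0).lattice → w ∉ (D.L D.n).lattice →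
        X i = red D.V (l.x w) → 2 * D.zz i ∈ (D.L 0).lattice := by
      intro w hw0 hw2 hwn hXw
      have hiw := l.half_int hw0 hw2
      have h1 : red D.V ((top l).x w) = red D.V (l.x w) := by
        rw [hf w hwn hiw, ← hXw]; exact (hXf i).symm
      have h2 : (top l).x w = l.x w := by
        have hw2n := R.le hw2
        rcases (top l).half hwn hw2n with e | e | e <;> rcases l.half hw0 hw2 with e' | e' | e' <;>
        rw [e, e'] at h1 ⊢ <;> (try rw [top_lam] at h1 ⊢) <;>
        (try simp only [red_zero, red_one] at h1) <;>
        first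
          | done
          | exact absurd h1 hl1'
          | exact absurd h1.symm hl1'
          | exact absurd h1 hl0'
          | exact absurd h1.symm hl0'
          | simp at h1
      have h3 : l.x (D.zz i) = l.x w := by
        by_contra hne
        have := R.contr _ _ (hzn i) hwn (hiz i) hiw ((red_eq_iff (hiz i) hiw).1 hXw) hne
        rw [hxz, h2] at this
        exact lt_irrefl _ this
      rcases l.x_inj (hz0 i) hw0 h3 with h | h
      · have := sub_mem (add_mem h h) hw2; convert this using 1; ring
      · have := add_mem (add_mem h h) hw2; convert this using 1; ring
    rw [l.hk_sym l.tri, mul_eq_zero, mul_eq_zero] at hi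
    rcases hi with (h | h) | h
    · exact key l.a l.tri.ha l.tri.ha2 tn.ha (sub_eq_zero.1 h)
    · exact key l.b l.tri.hb l.tri.hb2 tn.hb (sub_eq_zero.1 h)
    · exact key l.c l.tri.hc l.tri.hc2 tn.hc (sub_eq_zero.1 h)
  have hroot' : ∀ i, 2 * D.zz i ∈ (D.L 0).lattice → l.hk (X i) = 0 := by
    intro i hi
    simp only [hX, Lvl.hk]
    rcases l.half (hz0 i) hi with h | h | h <;> rw [h] <;> simp [red_zero, red_one]
  set ea := (red D.V (l.x l.a) - X0) / ρ with hea
  set eb := (red D.V (l.x l.b) - X0) / ρ with heb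
  set ec := (red D.V (l.x l.c) - X0) / ρ with hec
  have hft : ∀ i, l.hk (X i) = ρ ^ 3 * ((t i - ea) * (t i - eb) * (t i - ec)) := by
    intro i
    rw [l.hk_sym l.tri, htX, hea, heb, hec]
    field_simp
    ring
  have hρ3 : ρ ^ 3 ≠ 0 := pow_ne_zero _ hρ0
  have hneq : ∀ a b : ResidueField D.V, a ≠ b → (a - X0) / ρ ≠ (b - X0) / ρ := by
    intro a b h h'
    rw [div_left_inj' hρ0, sub_left_inj] at h'
    exact h h'
  -- sign
  obtain ⟨K, c, hK, hc, hsign⟩ := R.sign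
  have hsg : ∀ i, 2 * D.zz i ∉ (D.L 0).lattice → (D.eps i : ResidueField D.V) *
      ((t i - ea) * (t i - eb) * (t i - ec)) ^ ((D.q - 1) / 2) =
      red D.V (D.π ^ 3 / K) / c / (ρ ^ 3) ^ ((D.q - 1) / 2) := by
    intro i hi
    obtain ⟨g, hg, e1, e2⟩ := hsign _ (hzn i) (hiz i)
    have hP0 : (D.L 0).derivWeierstrassP (D.zz i) ≠ 0 := by
      intro h0
      apply hi
      apply hroot
      have := l.ode (hz0 i)
      rw [h0] at this
      have h1 : l.cub (l.x (D.zz i)) = 0 := by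
        have hu := l.u_ne
        by_contra hne
        have h4 : 4 * l.u ^ 3 * l.cub (l.x (D.zz i)) ≠ 0 :=
          mul_ne_zero (mul_ne_zero (by norm_num) (pow_ne_zero _ hu)) hne
        exact h4 (by rw [← this]; ring)
      rw [hX]
      simp only
      rw [← l.red_cub (hiz i), h1, red_zero]
    rw [P'_scale D.π_ne D.pi_mem_L0, zz_P'] at e1
    have hee : (D.eps i : ℂ) * D.eps i = 1 := by
      rcases D.eps_pm i with h | h <;> rw [h] <;> norm_num
    have hee' : (D.eps i : ResidueField D.V) * D.eps i = 1 := by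
      rcases D.eps_pm i with h | h <;> rw [h] <;> norm_num
    have e3 : D.π ^ 3 / K = D.eps i * g := by
      rw [div_eq_iff hK]
      apply mul_right_cancel₀ hP0
      linear_combination D.eps i * e1 - D.π ^ 3 * (D.L 0).derivWeierstrassP (D.zz i) * hee
    rw [e3, red_mul (vint _) hg, red_int, e2]
    have := hft i
    simp only [hX] at this
    rw [this, mul_pow (ρ ^ 3)]
    have h5 : (ρ ^ 3) ^ ((D.q - 1) / 2) ≠ 0 := pow_ne_zero _ hρ3
    generalize (ρ ^ 3) ^ ((D.q - 1) / 2) = y1 at h5 ⊢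
    generalize ((t i - ea) * (t i - eb) * (t i - ec)) ^ ((D.q - 1) / 2) = y2
    field_simp
  have hfq : ∀ a, C * red D.V (l.x a) ^ D.q + E = C * red D.V (l.x a) ^ D.q + E := fun _ => rfl
  have pa := hpow _ _ (hf l.a tn.ha hia)
  have pb := hpow _ _ (hf l.b tn.hb hib)
  have pc := hpow _ _ (hf l.c tn.hc hic)
  have hja := R.integ _ tn.ha hia
  have hjb := R.integ _ tn.hb hib
  have hjc := R.integ _ tn.hc hic
  have hid : ∀ Y, (Y - red D.V ((top l).x l.a)) * (Y - red D.V ((top l).x l.b)) *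
      (Y - red D.V ((top l).x l.c)) = (Y - red D.V (l.x l.a)) * (Y - red D.V (l.x l.b)) *
      (Y - red D.V (l.x l.c)) := by
    intro Y
    rw [← (top l).hk_sym tn, ← l.hk_sym l.tri, Lvl.hk, Lvl.hk, top_lam]
  have sy1 : red D.V ((top l).x l.a) + red D.V ((top l).x l.b) + red D.V ((top l).x l.c) =
      red D.V (l.x l.a) + red D.V (l.x l.b) + red D.V (l.x l.c) := by
    rw [← red_add hja hjb, ← red_add (vadd hja hjb) hjc, ← red_add hia hib,
      ← red_add (vadd hia hib) hic, ((top l).sym tn).1, (l.sym l.tri).1, top_lam]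
  have sy2 : red D.V ((top l).x l.a) * red D.V ((top l).x l.b) + red D.V ((top l).x l.b) *
      red D.V ((top l).x l.c) + red D.V ((top l).x l.c) * red D.V ((top l).x l.a) =
      red D.V (l.x l.a) * red D.V (l.x l.b) + red D.V (l.x l.b) * red D.V (l.x l.c) +
      red D.V (l.x l.c) * red D.V (l.x l.a) := by
    rw [← red_mul hja hjb, ← red_mul hjb hjc, ← red_mul hjc hja,
      ← red_add (vmul hja hjb) (vmul hjb hjc),
      ← red_add (vadd (vmul hja hjb) (vmul hjb hjc)) (vmul hjc hja),
      ← red_mul hia hib, ← red_mul hib hic, ← red_mul hic hia,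
      ← red_add (vmul hia hib) (vmul hib hic),
      ← red_add (vadd (vmul hia hib) (vmul hib hic)) (vmul hic hia),
      ((top l).sym tn).2.1, (l.sym l.tri).2.1, top_lam]
  have sy3 := hid 0
  set A := red D.V (l.x l.a) with hA
  set B := red D.V (l.x l.b) with hB
  set G := red D.V (l.x l.c) with hG
  have hA0 : A = 0 := by rw [hA, l.x_a, red_zero]
  have hB1 : B = 1 := by rw [hB, l.x_b, red_one]
  have hGl : G = red D.V l.lam := by rw [hG, l.x_c]
  have habne : ea ≠ eb := hneq A B (by rw [hA0, hB1]; exact zero_ne_one)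
  have hacne : ea ≠ ec := hneq A G (by rw [hA0, hGl]; exact hl0'.symm)
  have hbcne : eb ≠ ec := hneq B G (by rw [hB1, hGl]; exact hl1'.symm)
  have s1 : (ea + eb + ec) ^ D.q = ea + eb + ec := by
    rw [R.addp, R.addp, pa, pb, pc, hea, heb, hec]
    field_simp
    linear_combination sy1
  have s2 : (ea * eb + eb * ec + ec * ea) ^ D.q = ea * eb + eb * ec + ec * ea := by
    rw [R.addp, R.addp, mul_pow, mul_pow, mul_pow, pa, pb, pc, hea, heb, hec]
    field_simp
    linear_combination sy2 - 2 * X0 * sy1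
  have s3 : (ea * eb * ec) ^ D.q = ea * eb * ec := by
    rw [mul_pow, mul_pow, pa, pb, pc, hea, heb, hec]
    field_simp
    linear_combination - sy3 - X0 * sy2 + X0 ^ 2 * sy1
  have hffix : ∀ y ∈ D.Fix, ((y - ea) * (y - eb) * (y - ec)) ^ D.q =
      (y - ea) * (y - eb) * (y - ec) := by
    intro y hy
    rw [mem_Fix] at hy
    rw [mul_pow, mul_pow, hsubq, hsubq, hsubq, hy]
    rw [R.addp, R.addp] at s1 s2
    rw [mul_pow, mul_pow, mul_pow] at s2
    rw [mul_pow, mul_pow] at s3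
    linear_combination - y ^ 2 * s1 + y * s2 - s3
  have hoddq := D.q_odd hodd
  have hsq : ∀ y ∈ D.Fix, (y - ea) * (y - eb) * (y - ec) ≠ 0 →
      ((y - ea) * (y - eb) * (y - ec)) ^ ((D.q - 1) / 2) = 1 ∨
      ((y - ea) * (y - eb) * (y - ec)) ^ ((D.q - 1) / 2) = -1 := by
    intro y hy h0
    rw [← sq_eq_one_iff]
    have h1 := hffix y hy
    have h2 : D.q = (D.q - 1) / 2 * 2 + 1 := by
      obtain ⟨m, hm⟩ := hoddq
      omega
    rw [← pow_mul]
    apply mul_right_cancel₀ h0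
    rw [← pow_succ, ← h2, h1, one_mul]
  have h0iff : ∀ i, (t i - ea) * (t i - eb) * (t i - ec) = 0 ↔ 2 * D.zz i ∈ (D.L 0).lattice := by
    intro i
    constructor
    · intro h; apply hroot; rw [hft, h, mul_zero]
    · intro h
      have := hroot' i h
      rw [hft] at this
      exact (mul_eq_zero.1 this).resolve_left hρ3
  set κ := red D.V (D.π ^ 3 / K) / c / (ρ ^ 3) ^ ((D.q - 1) / 2) with hκ
  have hcc : ∃ cc : ℤ, (cc = 1 ∨ cc = -1) ∧ ∀ i, 2 * D.zz i ∉ (D.L 0).lattice → κ = cc := by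
    by_cases hex : ∃ i, 2 * D.zz i ∉ (D.L 0).lattice
    · obtain ⟨i, hi⟩ := hex
      have h1 := hsg i hi
      rcases hsq (t i) (htF i) (fun h => hi ((h0iff i).1 h)) with h2 | h2 <;> rw [h2] at h1
      · exact ⟨D.eps i, D.eps_pm i, fun _ _ => by rw [← h1]; simp⟩
      · refine ⟨- D.eps i, ?_, fun _ _ => by rw [← h1]; simp⟩
        rcases D.eps_pm i with h | h <;> rw [h] <;> simp
    · push Not at hex
      exact ⟨1, Or.inl rfl, fun i hi => absurd (hex i) hi⟩
  obtain ⟨cc, hcc1, hcc⟩ := hcc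
  refine ⟨ea, eb, ec, cc, sg, hcard, habne, hacne, hbcne, s1, s2, s3, hcc1, ?_, ?_, hsum⟩
  · intro y hy h
    obtain ⟨i, rfl⟩ := hsurj y hy
    exact hsg0 i ((h0iff i).1 h)
  · intro y hy h
    obtain ⟨i, rfl⟩ := hsurj y hy
    have hi : 2 * D.zz i ∉ (D.L 0).lattice := fun h' => h ((h0iff i).2 h')
    rw [hsg1 i hi]
    refine ⟨D.eps_pm i, ?_⟩
    have h1 := hsg i hi
    rw [hcc i hi] at h1
    rw [← h1, mul_assoc, ← sq]
    rcases hsq (t i) (htF i) h with h2 | h2 <;> rw [h2] <;> simp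

end Dat
end St16

namespace St16
open IsLocalRing

open Classical in
lemma card_points {F : Type*} [Field F] [Fintype F] (E : WeierstrassCurve F)
    (hE : E.Δ ≠ 0) (f : F → ℕ)
    (hf : ∀ x, (Finset.univ.filter fun y => E.toAffine.Equation x y).card = f x) :
    Nat.card E.toAffine.Point = 1 + ∑ x, f x := by
  classical
  let e : E.toAffine.Point ≃ Option {xy : F × F // E.toAffine.Equation xy.1 xy.2} :=
    { toFun := fun P => match P with
        | .zero => none
        | .some x y h => some ⟨(x, y), h.1⟩
      invFun := fun o => match o with
        | none => .zero
        | some xy => .some xy.1.1 xy.1.2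
            ((E.toAffine.equation_iff_nonsingular_of_Δ_ne_zero hE).1 xy.2)
      left_inv := fun P => by cases P <;> rfl
      right_inv := fun o => by cases o <;> rfl }
  rw [Nat.card_congr e, Nat.card_eq_fintype_card, Fintype.card_option, add_comm,
    Fintype.card_subtype]
  congr 1
  rw [← Finset.univ_product_univ, Finset.card_filter, Finset.sum_product]
  refine Finset.sum_congr rfl fun x _ => ?_
  rw [← hf, Finset.card_filter]

namespace Dat
variable (D : Dat)

lemma addq (a b : ResidueField D.V) : (a + b) ^ D.q = a ^ D.q + b ^ D.q := by
  have := charP_k D.hp D.hVp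
  have : Fact D.p.Prime := ⟨D.hp⟩
  exact add_pow_char_pow a b ..

lemma negq (a : ResidueField D.V) : (-a) ^ D.q = - a ^ D.q := by
  have := D.addq (-a) a
  rw [neg_add_cancel, zero_pow (by have := D.q_gt; omega)] at this
  linear_combination - this

/-- the fixed field -/
def FixF : Subfield (ResidueField D.V) where
  carrier := {y | y ^ D.q = y}
  mul_mem' := fun {a b} ha hb => by
    simp only [Set.mem_ofPred_eq] at *; rw [mul_pow, ha, hb]
  one_mem' := one_pow _
  add_mem' := fun {a b} ha hb => by
    simp only [Set.mem_ofPred_eq] at *; rw [addq, ha, hb]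
  zero_mem' := zero_pow (by have := D.q_gt; omega)
  neg_mem' := fun {a} ha => by
    simp only [Set.mem_ofPred_eq] at *; rw [negq, ha]
  inv_mem' := fun a ha => by
    simp only [Set.mem_ofPred_eq] at *; rw [inv_pow, ha]

lemma exists_emb (hc : D.Fix.card = D.q) (F : Type*) [Field F] [Fintype F]
    (hF : Fintype.card F = D.q) : ∃ φ : F →+* ResidueField D.V,
      ∀ y, y ∈ D.Fix ↔ ∃ x, φ x = y := by
  classical
  have hm : ∀ y, y ∈ D.Fix ↔ y ∈ D.FixF := fun y => by rw [mem_Fix]; rfl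
  let _ : Fintype D.FixF := Fintype.subtype D.Fix hm
  have hcard : Fintype.card F = Fintype.card D.FixF := by
    rw [hF, Fintype.card_of_subtype D.Fix hm, hc]
  let e := FiniteField.ringEquivOfCardEq hcard
  refine ⟨D.FixF.subtype.comp e.toRingHom, fun y => ?_⟩
  rw [hm]
  constructor
  · intro h
    exact ⟨e.symm ⟨y, h⟩, by simp⟩
  · rintro ⟨x, rfl⟩
    exact (e x).2

lemma sum_emb {F : Type*} [Field F] [Fintype F] (φ : F →+* ResidueField D.V)
    (hφ : ∀ y, y ∈ D.Fix ↔ ∃ x, φ x = y) (f : ResidueField D.V → ℤ) :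
    ∑ y ∈ D.Fix, f y = ∑ x, f (φ x) := by
  classical
  have : D.Fix = Finset.univ.image φ := by
    ext y; rw [hφ]; simp
  rw [this, Finset.sum_image (fun _ _ _ _ h => φ.injective h)]

theorem odd_curve (hodd : Odd D.p) (hs : D.s ≤ D.q) (F : Type*) [Field F] [Fintype F]
    (hF : Fintype.card F = D.q) : ∃ E : WeierstrassCurve F, E.IsElliptic ∧
      Nat.card E.toAffine.Point = D.q + 1 + D.s := by
  classical
  obtain ⟨e1, e2, e3, c, sg, hcard, h12, h13, h23, s1, s2, s3, hc, hz, hnz, hsum⟩ :=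
    D.odd_final hodd hs
  obtain ⟨φ, hφ⟩ := D.exists_emb hcard F hF
  obtain ⟨A, hA⟩ := (hφ _).1 (D.mem_Fix.2 s1)
  obtain ⟨B, hB⟩ := (hφ _).1 (D.mem_Fix.2 s2)
  obtain ⟨C, hC⟩ := (hφ _).1 (D.mem_Fix.2 s3)
  have hqo := D.q_odd hodd
  have hchar : ringChar F ≠ 2 := by
    intro h
    have := FiniteField.even_card_of_char_two h
    rw [hF] at this
    rw [Nat.odd_iff] at hqo
    omega
  have h2 : (2 : F) ≠ 0 := Ring.two_ne_zero hchar
  have hexp : (D.q - 1) / 2 = D.q / 2 := by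
    obtain ⟨m, hm⟩ := hqo
    omega
  set f : F → F := fun t => t ^ 3 - A * t ^ 2 + B * t - C with hf
  have hfφ : ∀ t, φ (f t) = (φ t - e1) * (φ t - e2) * (φ t - e3) := by
    intro t
    simp only [hf, map_sub, map_add, map_mul, map_pow, hA, hB, hC]
    ring
  have hone : (1 : ResidueField D.V) ≠ -1 := by
    intro h
    apply h2
    apply φ.injective
    rw [map_ofNat, map_zero]
    linear_combination h
  have hsgχ : ∀ t, sg (φ t) = c * quadraticChar F (f t) := by
    intro t
    have ht : φ t ∈ D.Fix := (hφ _).2 ⟨t, rfl⟩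
    by_cases h0 : f t = 0
    · rw [h0, quadraticChar_zero, mul_zero]
      exact hz _ ht (by rw [← hfφ, h0, map_zero])
    · have h1 : (φ t - e1) * (φ t - e2) * (φ t - e3) ≠ 0 := by
        rw [← hfφ]; exact (map_ne_zero φ).2 h0
      obtain ⟨hpm, heq⟩ := hnz _ ht h1
      rw [← hfφ, hexp, ← map_pow, ← hF, ← quadraticChar_eq_pow_of_char_ne_two' hchar] at heq
      rcases hpm with h | h <;> rcases hc with h' | h' <;>
      rcases quadraticChar_dichotomy h0 with h'' | h'' <;> rw [h, h', h''] at heq ⊢ <;>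
      simp at heq ⊢ <;> first | exact hone heq | exact hone heq.symm
  obtain ⟨δ, hδ⟩ : ∃ δ : F, quadraticChar F δ = c := by
    rcases hc with h | h
    · exact ⟨1, by rw [h]; simp⟩
    · rw [h]; exact quadraticChar_exists_neg_one hchar
  have hδ0 : δ ≠ 0 := by
    rintro rfl
    rw [quadraticChar_zero] at hδ
    rcases hc with h | h <;> rw [h] at hδ <;> simp at hδ
  let E : WeierstrassCurve F := ⟨0, - δ * A, 0, δ ^ 2 * B, - δ ^ 3 * C⟩
  have hΔ : E.Δ ≠ 0 := by
    have h16 : φ E.Δ = 2 ^ 4 * (φ δ ^ 3 * (e1 - e2) * (e1 - e3) * (e2 - e3)) ^ 2 := by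
      simp only [WeierstrassCurve.Δ, WeierstrassCurve.b₂, WeierstrassCurve.b₄, WeierstrassCurve.b₆,
        WeierstrassCurve.b₈, E, map_sub, map_add, map_mul, map_pow, map_neg, map_ofNat, map_zero,
        hA, hB, hC]
      ring
    intro h
    rw [h, map_zero] at h16
    have h2' : (2 : ResidueField D.V) ≠ 0 := by
      rw [← map_ofNat φ]; exact (map_ne_zero φ).2 h2
    have hδ' := (map_ne_zero φ).2 hδ0
    have := sub_ne_zero.2 h12
    have := sub_ne_zero.2 h13
    have := sub_ne_zero.2 h23
    have : 2 ^ 4 * (φ δ ^ 3 * (e1 - e2) * (e1 - e3) * (e2 - e3)) ^ 2 ≠ 0 := by positivity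
    exact this h16.symm
  refine ⟨E, ⟨isUnit_iff_ne_zero.2 hΔ⟩, ?_⟩
  rw [card_points E hΔ _ (fun _ => rfl)]
  have hsq : ∀ t, ((Finset.univ.filter fun y => E.toAffine.Equation (δ * t) y).card : ℤ) =
      sg (φ t) + 1 := by
    intro t
    rw [hsgχ, ← hδ, ← map_mul]
    have h3 : quadraticChar F (δ * f t) = quadraticChar F (δ ^ 3 * f t) := by
      rw [show δ ^ 3 * f t = δ ^ 2 * (δ * f t) by ring, map_mul _ (δ ^ 2),
        quadraticChar_sq_one' hδ0, one_mul]
    rw [h3, ← quadraticChar_card_sqrts hchar]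
    congr 2
    ext y
    simp only [Finset.mem_filter, Finset.mem_univ, true_and, Set.mem_toFinset, Set.mem_ofPred_eq,
      WeierstrassCurve.Affine.equation_iff, E, hf]
    constructor <;> intro h <;> linear_combination h
  have hre : ∑ x, (Finset.univ.filter fun y => E.toAffine.Equation x y).card =
      ∑ t, (Finset.univ.filter fun y => E.toAffine.Equation (δ * t) y).card :=
    (Equiv.sum_comp (Equiv.mulLeft₀ δ hδ0)
      (fun x => (Finset.univ.filter fun y => E.toAffine.Equation x y).card)).symm
  have htot : ((∑ x, (Finset.univ.filter fun y => E.toAffine.Equation x y).card : ℕ) : ℤ) =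
      D.s + D.q := by
    rw [hre]
    push_cast
    rw [Finset.sum_congr rfl fun t _ => hsq t, Finset.sum_add_distrib, ← D.sum_emb φ hφ, hsum]
    simp [hF]
  omega

end Dat
end St16

namespace St16
open IsLocalRing

/-- shifted `℘`-function, and its values at the two other half periods -/
noncomputable def XX (L : PeriodPair) (T z : ℂ) : ℂ := L.weierstrassP z - L.weierstrassP T

section
variable {L L' : PeriodPair} {T Q Q1 : ℂ} (h : Triple L T Q (T + Q)) (h' : Triple L' T Q1 (T + Q1))
  (hc : Cosets L L' {0, Q}) (h2 : 2 * Q1 = Q)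

include h in
lemma aa_ne : XX L T Q ≠ 0 := sub_ne_zero.2 h.ne.symm
include h in
lemma bb_ne : XX L T (T + Q) ≠ 0 := sub_ne_zero.2 h.rot.rot.ne
include h in
lemma aabb_ne : XX L T Q ≠ XX L T (T + Q) := fun hh => h.rot.ne (by
  simpa [XX] using hh)

include h in
lemma Q_ne : Q ≠ 0 := fun h0 => h.hb (by rw [h0]; exact zero_mem _)

include h in
lemma er_S : ({0, Q} : Finset ℂ).erase 0 = {Q} := by
  have := Q_ne h
  rw [Finset.erase_insert]; simpa using this.symm

include h h' hc in
lemma step2_X {z : ℂ} (hz : z ∉ L'.lattice) :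
    XX L' T z * (XX L T z - XX L T Q) = XX L T z * (XX L T z - XX L T (T + Q)) := by
  have e := hc.prod_formula hz h'.ha
  rw [er_S h, Finset.prod_insert (by simpa using (Q_ne h).symm), Finset.prod_singleton,
    Finset.prod_singleton, add_zero] at e
  simp only [XX]
  linear_combination -e

include h hc in
lemma kap2 {z : ℂ} (hz : z ∉ L'.lattice) :
    (XX L T (z + Q) - XX L T Q) * (XX L T z - XX L T Q) =
      XX L T Q * (XX L T Q - XX L T (T + Q)) := by
  have hQ : Q ∈ L'.lattice := hc.mem Q (by simp)
  have e := h.rot.kappa (z := z) (fun hh => hz (hc.le hh)) (fun hh => hz (by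
    have := sub_mem (hc.le hh) hQ; simpa using this))
  simp only [XX]
  linear_combination e

include h hc in
lemma XQ_ne {z : ℂ} (hz : z ∉ L'.lattice) : XX L T z - XX L T Q ≠ 0 := by
  intro h0
  have := kap2 h hc hz
  rw [h0, mul_zero] at this
  exact mul_ne_zero (aa_ne h) (sub_ne_zero.2 (aabb_ne h)) this.symm

include h h' hc h2 in
lemma step2_ab : XX L' T Q1 + XX L' T (T + Q1) = 2 * (2 * XX L T Q - XX L T (T + Q)) ∧
    XX L' T Q1 * XX L' T (T + Q1) = XX L T (T + Q) ^ 2 := by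
  have hQ : Q ∈ L'.lattice := hc.mem Q (by simp)
  have k1 := kap2 h hc h'.hb
  have k2 := kap2 h hc h'.hc
  have e1 : XX L T (Q1 + Q) = XX L T Q1 := by
    simp only [XX]; congr 1
    refine P_congr_neg L ?_
    have := h.hb2
    convert this using 1; linear_combination h2
  have e2 : XX L T (T + Q1 + Q) = XX L T (T + Q1) := by
    simp only [XX]; congr 1
    refine P_congr_neg L ?_
    have := h.hc2
    convert this using 1; linear_combination h2
  rw [e1] at k1
  rw [e2] at k2
  have hne : XX L T Q1 ≠ XX L T (T + Q1) := by
    intro hh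
    have hh : L.weierstrassP Q1 = L.weierstrassP (T + Q1) := by simpa [XX] using hh
    rcases P_inj h (fun hh => h'.hc (hc.le hh)) (fun hh => h'.hb (hc.le hh)) hh with e | e
    · apply h.hc
      convert e using 1; linear_combination -h2
    · apply h.ha
      have := neg_mem e
      convert this using 1; ring
  have x1 := step2_X h h' hc h'.hb
  have x2 := step2_X h h' hc h'.hc
  have n1 := XQ_ne h hc h'.hb
  generalize XX L T Q1 = u at *
  generalize XX L T (T + Q1) = w at *
  generalize XX L T Q = a at *
  generalize XX L T (T + Q) = b at *
  have hw : w - a = -(u - a) := by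
    have : (u - w) * (u + w - 2 * a) = 0 := by linear_combination k1 - k2
    have := (mul_eq_zero.1 this).resolve_left (sub_ne_zero.2 hne)
    linear_combination this
  obtain ⟨e, rfl⟩ : ∃ e, u = a + e := ⟨u - a, by ring⟩
  have hw' : w = a - e := by linear_combination hw
  subst hw'
  simp only [add_sub_cancel_left] at n1 x1 x2 k1
  have r1 : XX L' T Q1 = 2 * e + 2 * a - b := by
    apply mul_right_cancel₀ n1
    rw [x1]; linear_combination -k1
  have r2 : XX L' T (T + Q1) = -2 * e + 2 * a - b := by
    apply mul_right_cancel₀ n1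
    linear_combination -x2 + k1
  rw [r1, r2]
  constructor
  · ring
  · linear_combination -4 * k1

include h hc in
lemma step2_d {z : ℂ} (hz : z ∉ L'.lattice) :
    L'.derivWeierstrassP z * (XX L T z - XX L T Q) ^ 2 =
      L.derivWeierstrassP z * (XX L T z ^ 2 - 2 * XX L T Q * XX L T z +
        XX L T Q * XX L T (T + Q)) := by
  have e := hc.deriv_formula hz
  rw [er_S h, Finset.prod_singleton, Finset.prod_singleton] at e
  have k := kap2 h hc hz
  have f1 : L.weierstrassP z - L.weierstrassP (z + Q) = XX L T z - XX L T (z + Q) := by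
    simp [XX]
  have f2 : L.weierstrassP z - L.weierstrassP Q = XX L T z - XX L T Q := by
    simp [XX]
  rw [f1, f2] at e
  linear_combination (-(XX L T z - XX L T Q)) * e - L.derivWeierstrassP z * k
end

end St16

namespace St16
open IsLocalRing

section
variable {V : ValuationSubring ℂ}

lemma v2mul (h2 : V.valuation (2 : ℂ) < 1) {y : ℂ} (hy : V.valuation y ≤ 1) :
    V.valuation (2 * y) < 1 := by
  rw [map_mul]; exact (mul_le_of_le_one_right' hy).trans_lt h2

lemma red_two (h2 : V.valuation (2 : ℂ) < 1) : (2 : ResidueField V) = 0 := by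
  rw [← red_ofnat, red_eq_zero_iff (vofnat 2)]; exact h2

lemma red_cong2 (h2 : V.valuation (2 : ℂ) < 1) {x y : ℂ} (hx : V.valuation x ≤ 1)
    (hy : V.valuation y ≤ 1) : red V (x + 2 * y) = red V x := by
  rw [red_add hx (v2mul h2 hy).le, (red_eq_zero_iff (v2mul h2 hy).le).2 (v2mul h2 hy), add_zero]

/-- the scalar data of a 2-isogeny step -/
structure Sc (V : ValuationSubring ℂ) (ν W G : ℂ) : Prop where
  h2 : V.valuation (2 : ℂ) < 1
  hν : V.valuation ν = 1
  hW : W = 1 + 16 * ν * W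
  hG : G = 1 - 8 * ν * W

namespace Sc
variable {ν W G : ℂ} (S : Sc V ν W G)
include S

lemma vW : V.valuation W = 1 := by
  have h1 : V.valuation (1 - 16 * ν) = 1 := by
    refine v_one_sub ?_
    have := v2mul S.h2 (y := 8 * ν) (vmul (vofnat 8) S.hν.le)
    convert this using 2; ring
  have h2 : W * (1 - 16 * ν) = 1 := by linear_combination S.hW
  have h3 := congrArg V.valuation h2
  rwa [map_mul, h1, mul_one, map_one] at h3

lemma vG : V.valuation G = 1 := by
  rw [S.hG]
  refine v_one_sub ?_
  have := v2mul S.h2 (y := 4 * ν * W) (vmul (vmul (vofnat 4) S.hν.le) S.vW.le)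
  convert this using 2; ring

lemma rW : red V W = 1 := by
  have := red_cong2 S.h2 (x := 1) (y := 8 * ν * W) vone (vmul (vmul (vofnat 8) S.hν.le) S.vW.le)
  rw [red_one] at this
  rw [← this]; congr 1; linear_combination S.hW

lemma rG : red V G = 1 := by
  have := red_cong2 S.h2 (x := 1) (y := -(4 * ν * W)) vone
    (vneg (vmul (vmul (vofnat 4) S.hν.le) S.vW.le))
  rw [red_one] at this
  rw [← this]; congr 1; linear_combination S.hG

lemma exists_u : ∃ u, V.valuation u ≤ 1 ∧ (1 + 4 * u) ^ 2 * G = W := by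
  have hG0 := ne_zero_of_v S.vG
  obtain ⟨κ, hκ⟩ := IsAlgClosed.exists_pow_nat_eq (W / G) (n := 2) (by norm_num)
  rw [eq_div_iff hG0] at hκ
  obtain ⟨y, rfl⟩ : ∃ y, κ = 1 + 2 * y := ⟨(κ - 1) / 2, by ring⟩
  have hy : y ^ 2 = (-1) * y - (- (6 * ν * W / G)) := by
    field_simp
    have h1 := S.hW
    have h2 := S.hG
    linear_combination (1/4 : ℂ) * hκ + (1/4 : ℂ) * h1 - (1/4 : ℂ) * h2
  have hP : V.valuation (- (6 * ν * W / G)) ≤ 1 :=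
    vneg (vdiv (vmul (vmul (vofnat 6) S.hν.le) S.vW.le) S.vG)
  have vy := v_quad (vneg vone) hP hy
  have hprod : V.valuation (y * (y + 1)) ≤ V.valuation 2 := by
    have e : y * (y + 1) = 2 * (3 * ν * W / G) := by linear_combination hy
    rw [e, map_mul]
    exact mul_le_of_le_one_right' (vdiv (vmul (vmul (vofnat 3) S.hν.le) S.vW.le) S.vG)
  have h20 : V.valuation (2 : ℂ) ≠ 0 := (Valuation.ne_zero_iff _).2 two_ne_zero
  have key : ∀ w : ℂ, V.valuation w ≤ V.valuation 2 → V.valuation (w / 2) ≤ 1 := by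
    intro w hw
    rw [map_div₀]
    exact div_le_one_of_le₀ hw zero_le
  by_cases hlt : V.valuation y < 1
  · have h1 : V.valuation (y + 1) = 1 := by rw [add_comm]; exact v_one_add hlt
    rw [map_mul, h1, mul_one] at hprod
    exact ⟨y / 2, key _ hprod, by rw [← hκ]; ring⟩
  · have h1 : V.valuation y = 1 := le_antisymm vy (not_lt.1 hlt)
    rw [map_mul, h1, one_mul] at hprod
    refine ⟨-((y + 1) / 2), vneg (key _ hprod), by rw [← hκ]; ring⟩

lemma v14 {x : ℂ} (hx : V.valuation x ≤ 1) : V.valuation (1 + 4 * W * x) = 1 := by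
  refine v_one_add ?_
  have := v2mul S.h2 (y := 2 * W * x) (vmul (vmul (vofnat 2) S.vW.le) hx)
  convert this using 2; ring

lemma r14 {x : ℂ} (hx : V.valuation x ≤ 1) : red V (1 + 4 * W * x) = 1 := by
  have := red_cong2 S.h2 (x := 1) (y := 2 * W * x) vone (vmul (vmul (vofnat 2) S.vW.le) hx)
  rw [red_one] at this
  rw [← this]; congr 1; ring

lemma rx4 {x : ℂ} (hx : V.valuation x ≤ 1) : red V (x + 4 * ν) = red V x := by
  have := red_cong2 S.h2 (x := x) (y := 2 * ν) hx (vmul (vofnat 2) S.hν.le)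
  rw [← this]; congr 1; ring

lemma vx4 {x : ℂ} (hx : V.valuation x ≤ 1) : V.valuation (x + 4 * ν) ≤ 1 :=
  vadd hx (vmul (vofnat 4) S.hν.le)

variable {x x' w w' : ℂ}

lemma integ (hx' : x' * (G * (1 + 4 * W * x)) = W ^ 2 * (x * (x + 4 * ν)))
    (hx : V.valuation x ≤ 1) : V.valuation x' ≤ 1 ∧ red V x' = red V x ^ 2 := by
  have hd : V.valuation (G * (1 + 4 * W * x)) = 1 := by rw [map_mul, S.vG, S.v14 hx, one_mul]
  rw [← eq_div_iff (ne_zero_of_v hd)] at hx'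
  have h1 := S.vx4 hx
  have h3 := vpow S.vW.le 2
  have h2 := vmul h3 (vmul hx h1)
  rw [hx']
  refine ⟨vdiv h2 hd, ?_⟩
  rw [red_div h2 hd, red_mul S.vG.le (S.v14 hx).le, S.rG, S.r14 hx, red_mul h3 (vmul hx h1),
    red_pow S.vW.le, S.rW, red_mul hx h1, S.rx4 hx]
  ring

lemma contr (hx' : x' * (G * (1 + 4 * W * x)) = W ^ 2 * (x * (x + 4 * ν)))
    (hw' : w' * (G * (1 + 4 * W * w)) = W ^ 2 * (w * (w + 4 * ν)))
    (hx : V.valuation x ≤ 1) (hw : V.valuation w ≤ 1) (h1 : V.valuation (x - w) < 1)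
    (hne : x ≠ w) : V.valuation (x' - w') < V.valuation (x - w) := by
  have e : (x' - w') * (G * (1 + 4 * W * x) * (1 + 4 * W * w)) =
      (x - w) * (W ^ 2 * ((x - w) + 2 * (w + 2 * ν + 2 * W * x * w))) := by
    linear_combination (1 + 4 * W * w) * hx' - (1 + 4 * W * x) * hw'
  have e2 := congrArg V.valuation e
  rw [map_mul, map_mul, map_mul, S.vG, S.v14 hx, S.v14 hw, one_mul, mul_one, mul_one, map_mul,
    map_mul (V.valuation) (W ^ 2), map_pow, S.vW, one_pow, one_mul] at e2
  rw [e2]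
  refine mul_lt_of_lt_one_right
    (zero_lt_iff.2 ((Valuation.ne_zero_iff _).2 (sub_ne_zero.2 hne))) ?_
  refine V.valuation.map_add_lt h1 (v2mul S.h2 ?_)
  exact vadd (vadd hw (vmul (vofnat 2) S.hν.le)) (vmul (vmul (vmul (vofnat 2) S.vW.le) hx) hw)

lemma expand (hx' : x' * (G * (1 + 4 * W * x)) = W ^ 2 * (x * (x + 4 * ν)))
    (hx : 1 < V.valuation x) : V.valuation x < V.valuation x' := by
  have h0 : 0 < V.valuation x := zero_lt_one.trans hx
  have e2 := congrArg V.valuation hx'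
  have h4 : V.valuation (x + 4 * ν) = V.valuation x := by
    refine V.valuation.map_add_eq_of_lt_left ?_
    exact (vmul (vofnat 4) S.hν.le).trans_lt hx
  rw [map_mul, map_mul, map_mul, S.vG, one_mul, map_mul, map_pow, S.vW, one_pow, one_mul, h4] at e2
  have h5 : V.valuation (1 + 4 * W * x) < V.valuation x := by
    refine V.valuation.map_add_lt (by simpa using hx) ?_
    rw [map_mul]
    refine mul_lt_of_lt_one_left h0 ?_
    have := v2mul S.h2 (y := 2 * W) (vmul (vofnat 2) S.vW.le)
    convert this using 2; ring
  by_contra hcon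
  rw [not_lt] at hcon
  have h6 : V.valuation x' * V.valuation (1 + 4 * W * x) < V.valuation x * V.valuation x :=
    mul_lt_mul_of_le_of_lt_of_nonneg_of_pos hcon h5 zero_le h0
  exact absurd e2 h6.ne

/-- the Artin–Schreier coordinate -/
lemma eta {u y y' β : ℂ} (hu : V.valuation u ≤ 1) (hx : V.valuation x = 1)
    (hβ : β * W = ν) (hy : y ^ 2 + y = x + β / x)
    (hy' : (2 * y' + 1) * ((1 + 4 * W * x) * (x + 4 * ν)) =
      (2 * y + 1) * (1 + 4 * u) * (2 * W * x ^ 2 + x + 2 * ν)) :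
    V.valuation y ≤ 1 ∧ V.valuation y' ≤ 1 ∧ red V y' = red V y ^ 2 := by
  have hx1 := hx.le
  have hW := S.vW
  have vβ : V.valuation β ≤ 1 := by
    have := congrArg V.valuation hβ
    rw [map_mul, hW, mul_one, S.hν] at this; exact this.le
  have hx4 : V.valuation (x + 4 * ν) = 1 := v_eq_one (S.vx4 hx1) (by
    rw [S.rx4 hx1]; exact red_ne_zero hx)
  have hd : V.valuation ((1 + 4 * W * x) * (x + 4 * ν)) = 1 := by
    rw [map_mul, hx4, S.v14 hx1, one_mul]
  have vs : V.valuation (x + β / x) ≤ 1 := vadd hx1 (vdiv vβ hx)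
  have vy : V.valuation y ≤ 1 := v_quad (S := -1) (P := -(x + β / x)) (vneg vone) (vneg vs)
    (by linear_combination hy)
  have hν := S.hν.le
  have vnum : V.valuation (-ν - W * x ^ 2 + 2 * (-(4 * W * ν * x))) ≤ 1 := by
    have := hW.le
    apply_rules [vadd, vsub, vmul, vneg, vpow, vofnat]
  set h := (-ν - W * x ^ 2 + 2 * (-(4 * W * ν * x))) / ((1 + 4 * W * x) * (x + 4 * ν)) with hh
  have vh : V.valuation h ≤ 1 := vdiv vnum hd
  have hd0 := ne_zero_of_v hd
  have hhm : h * ((1 + 4 * W * x) * (x + 4 * ν)) = -ν - W * x ^ 2 + 2 * (-(4 * W * ν * x)) :=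
    div_mul_cancel₀ _ hd0
  have e : y' = (y + h) + 2 * (u * (1 + 2 * h) + (h + 2 * (u * (1 + 2 * h))) * y) := by
    have : 2 * ((1 + 4 * W * x) * (x + 4 * ν)) ≠ 0 := mul_ne_zero two_ne_zero hd0
    apply mul_right_cancel₀ this
    linear_combination hy' - (2 * (2 * y + 1) * (1 + 4 * u)) * hhm
  have v1 : V.valuation (y + h) ≤ 1 := vadd vy vh
  have v2 : V.valuation (u * (1 + 2 * h) + (h + 2 * (u * (1 + 2 * h))) * y) ≤ 1 := by
    apply_rules [vadd, vsub, vmul, vneg, vpow, vofnat, vone]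
  refine ⟨vy, e ▸ vadd v1 (vmul (vofnat 2) v2), ?_⟩
  rw [e, red_cong2 S.h2 v1 v2, red_add vy vh]
  have e1 := congrArg (red V) hy
  rw [red_add (vpow vy 2) vy, red_pow vy, red_add hx1 (vdiv vβ hx), red_div vβ hx] at e1
  have e3 : red V ν = red V β := by rw [← hβ, red_mul vβ hW.le, S.rW, mul_one]
  have e2 : red V h = (- red V β - red V x ^ 2) / red V x := by
    have := hW.le
    rw [hh, red_div vnum hd, red_cong2 S.h2 (by apply_rules [vadd, vsub, vmul, vneg, vpow])
      (by apply_rules [vneg, vmul, vofnat]), red_mul (S.v14 hx1).le hx4.le, S.r14 hx1, S.rx4 hx1,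
      one_mul, red_sub (vneg hν) (by apply_rules [vmul, vpow]), red_neg hν,
      red_mul hW.le (vpow hx1 2), S.rW, red_pow hx1, one_mul, e3]
  have hr := red_ne_zero hx
  have t := red_two S.h2
  rw [e2]
  field_simp at e1 ⊢
  linear_combination e1 - (red V x * red V y ^ 2) * t
end Sc
end
end St16

namespace St16
open IsLocalRing

/-- normalised coordinates -/
noncomputable def xx (L : PeriodPair) (T m z : ℂ) : ℂ := XX L T z / m ^ 2
noncomputable def et (L : PeriodPair) (T m z : ℂ) : ℂ :=
  (L.derivWeierstrassP z / (m * XX L T z) - 1) / 2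
noncomputable def be (L : PeriodPair) (T Q m : ℂ) : ℂ := XX L T Q * XX L T (T + Q) / m ^ 4

structure Lv2 (V : ValuationSubring ℂ) (L : PeriodPair) (T Q m : ℂ) : Prop where
  h2 : V.valuation (2 : ℂ) < 1
  tri : Triple L T Q (T + Q)
  hv : V.valuation (XX L T (T + Q)) = V.valuation (16 * XX L T Q)
  hm : m ^ 2 = -4 * (XX L T Q + XX L T (T + Q))

namespace Lv2
variable {V : ValuationSubring ℂ} {L : PeriodPair} {T Q m : ℂ} (l : Lv2 V L T Q m)
include l

lemma ab_ne : XX L T Q + XX L T (T + Q) ≠ 0 := by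
  intro h
  have h1 : XX L T (T + Q) = - XX L T Q := by linear_combination h
  have h2 := l.hv
  have h3 : 0 < V.valuation (XX L T Q) :=
    zero_lt_iff.2 ((Valuation.ne_zero_iff _).2 (aa_ne l.tri))
  rw [h1, Valuation.map_neg, map_mul] at h2
  have h4 : V.valuation (16 : ℂ) < 1 := by
    have := v2mul l.h2 (y := 8) (vofnat 8)
    convert this using 2; norm_num
  exact absurd h2 (mul_lt_of_lt_one_left h3 h4).ne'

lemma m_ne : m ≠ 0 := by
  intro h
  have := l.hm
  rw [h] at this
  have h3 := l.ab_ne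
  apply h3
  linear_combination (1/4 : ℂ) * this

/-- the scalars -/
lemma sc : Sc V (XX L T (T + Q) / (16 * (XX L T Q + XX L T (T + Q))))
    (1 + XX L T (T + Q) / XX L T Q) (1 - XX L T (T + Q) / XX L T Q / 2) := by
  have h0 := aa_ne l.tri
  have h1 := l.ab_ne
  refine ⟨l.h2, ?_, ?_, ?_⟩
  · have h4 : V.valuation (16 : ℂ) < 1 := by
      have := v2mul l.h2 (y := 8) (vofnat 8)
      convert this using 2; norm_num
    have h3 : 0 < V.valuation (XX L T Q) := zero_lt_iff.2 ((Valuation.ne_zero_iff _).2 h0)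
    have h5 : V.valuation (XX L T Q + XX L T (T + Q)) = V.valuation (XX L T Q) := by
      refine V.valuation.map_add_eq_of_lt_left ?_
      rw [l.hv, map_mul]; exact mul_lt_of_lt_one_left h3 h4
    rw [map_div₀, l.hv, map_mul, map_mul, h5]
    refine div_self (mul_ne_zero ?_ h3.ne')
    exact (Valuation.ne_zero_iff _).2 (by norm_num)
  · field_simp
  · field_simp
    ring

lemma be_W : be L T Q m * (1 + XX L T (T + Q) / XX L T Q) =
    XX L T (T + Q) / (16 * (XX L T Q + XX L T (T + Q))) := by
  have h0 := aa_ne l.tri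
  have h1 := l.ab_ne
  have : m ^ 4 = 16 * (XX L T Q + XX L T (T + Q)) ^ 2 := by
    linear_combination (m ^ 2 - 4 * (XX L T Q + XX L T (T + Q))) * l.hm
  rw [be, this]
  field_simp

lemma v_be : V.valuation (be L T Q m) = 1 := by
  have := congrArg V.valuation l.be_W
  rwa [map_mul, l.sc.vW, l.sc.hν, mul_one] at this

lemma et_eq {z : ℂ} (hz : z ∉ L.lattice) (hx : xx L T m z ≠ 0) :
    et L T m z ^ 2 + et L T m z = xx L T m z + be L T Q m / xx L T m z := by
  have hm := l.m_ne
  have hX : XX L T z ≠ 0 := by rintro h; rw [xx, h, zero_div] at hx; exact hx rfl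
  have h := l.tri.ode hz
  have e : L.derivWeierstrassP z ^ 2 = 4 * XX L T z * (XX L T z - XX L T Q) *
      (XX L T z - XX L T (T + Q)) := by
    rw [h]; simp only [XX]; ring
  have h2 := l.hm
  rw [et, xx, be]
  field_simp
  linear_combination e - XX L T z ^ 2 * h2

end Lv2

structure Rel2 (V : ValuationSubring ℂ) (T : ℂ) (L : PeriodPair) (m : ℂ) (L' : PeriodPair) (m' : ℂ)
    (N : ℕ) : Prop where
  le : L.lattice ≤ L'.lattice
  expand : ∀ z, z ∉ L'.lattice → 1 < V.valuation (xx L T m z) →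
    V.valuation (xx L T m z) < V.valuation (xx L' T m' z)
  integ : ∀ z, z ∉ L'.lattice → V.valuation (xx L T m z) ≤ 1 →
    V.valuation (xx L' T m' z) ≤ 1 ∧ red V (xx L' T m' z) = red V (xx L T m z) ^ N
  contr : ∀ z w, z ∉ L'.lattice → w ∉ L'.lattice → V.valuation (xx L T m z) ≤ 1 →
    V.valuation (xx L T m w) ≤ 1 → V.valuation (xx L T m z - xx L T m w) < 1 →
    xx L T m z ≠ xx L T m w →
    V.valuation (xx L' T m' z - xx L' T m' w) < V.valuation (xx L T m z - xx L T m w)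
  eta : ∀ z, z ∉ L'.lattice → V.valuation (xx L T m z) = 1 →
    V.valuation (et L T m z) ≤ 1 ∧ V.valuation (et L' T m' z) ≤ 1 ∧
    red V (et L' T m' z) = red V (et L T m z) ^ N

lemma Rel2.trans {V : ValuationSubring ℂ} {T : ℂ} {L L' L'' : PeriodPair} {m m' m'' Q : ℂ} {N N' : ℕ}
    (l' : Lv2 V L' T Q m') (h : Rel2 V T L m L' m' N) (h' : Rel2 V T L' m' L'' m'' N') :
    Rel2 V T L m L'' m'' (N * N') where
  le := h.le.trans h'.le
  expand := fun z hz h1 => by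
    have hz' : z ∉ L'.lattice := fun hh => hz (h'.le hh)
    have h2 := h.expand z hz' h1
    exact h2.trans (h'.expand z hz (h1.trans h2))
  integ := fun z hz h1 => by
    have hz' : z ∉ L'.lattice := fun hh => hz (h'.le hh)
    have h2 := h.integ z hz' h1
    have h3 := h'.integ z hz h2.1
    exact ⟨h3.1, by rw [h3.2, h2.2, pow_mul]⟩
  contr := fun z w hz hw iz iw h1 hne => by
    have hz' : z ∉ L'.lattice := fun hh => hz (h'.le hh)
    have hw' : w ∉ L'.lattice := fun hh => hw (h'.le hh)
    have h2 := h.contr z w hz' hw' iz iw h1 hne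
    by_cases he : xx L' T m' z = xx L' T m' w
    · have hm' := l'.m_ne
      have he2 : L'.weierstrassP z = L'.weierstrassP w := by
        rw [xx, xx, div_left_inj' (pow_ne_zero 2 hm'), XX, XX] at he
        simpa using he
      have h4 : xx L'' T m'' z = xx L'' T m'' w := by
        rw [xx, xx, XX, XX]
        rcases P_inj l'.tri hw' hz' he2 with h5 | h5
        · rw [P_congr_neg L'' (h'.le h5)]
        · rw [P_congr L'' (h'.le h5)]
      rw [he, sub_self] at h2
      rwa [h4, sub_self]
    · exact (h'.contr z w hz hw (h.integ z hz' iz).1 (h.integ w hw' iw).1 (h2.trans h1) he).trans h2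
  eta := fun z hz h1 => by
    have hz' : z ∉ L'.lattice := fun hh => hz (h'.le hh)
    have h2 := h.eta z hz' h1
    have h3 := h.integ z hz' h1.le
    have h4 : V.valuation (xx L' T m' z) = 1 := v_eq_one h3.1 (by
      rw [h3.2]; exact pow_ne_zero _ (red_ne_zero h1))
    have h5 := h'.eta z hz h4
    exact ⟨h2.1, h5.2.1, by rw [h5.2.2, h2.2.2, pow_mul]⟩

section
variable {V : ValuationSubring ℂ} {L L' : PeriodPair} {T Q Q1 m : ℂ}

theorem step2 (l : Lv2 V L T Q m) (h' : Triple L' T Q1 (T + Q1))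
    (hc : Cosets L L' {0, Q}) (h2 : 2 * Q1 = Q)
    (hv' : V.valuation (XX L' T (T + Q1)) = V.valuation (16 * XX L' T Q1)) :
    ∃ m', Lv2 V L' T Q1 m' ∧ Rel2 V T L m L' m' 2 ∧
      red V (be L' T Q1 m') = red V (be L T Q m) ^ 2 := by
  have h := l.tri
  obtain ⟨ab1, ab2⟩ := step2_ab h h' hc h2
  have S := l.sc
  obtain ⟨u, hu, huG⟩ := S.exists_u
  have hβ := l.be_W
  have ha := aa_ne h
  have hab := l.ab_ne
  have hm := l.m_ne
  have hmm := l.hm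
  have hX1 := fun z (hz : z ∉ L'.lattice) => step2_X h h' hc hz
  have hd := fun z (hz : z ∉ L'.lattice) => step2_d h hc hz
  have hXQ := fun z (hz : z ∉ L'.lattice) => XQ_ne h hc hz
  have hode := fun z (hz : z ∉ L.lattice) (hx : xx L T m z ≠ 0) => l.et_eq hz hx
  have hvbe := l.v_be
  unfold xx et be at *
  set a := XX L T Q with hadef
  set b := XX L T (T + Q) with hbdef
  obtain ⟨r, hr⟩ : ∃ r, b = a * r := ⟨b / a, by field_simp⟩
  have hr' : b / a = r := by rw [hr]; field_simp
  rw [hr'] at S huG hβ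
  set W := 1 + r with hW
  have hW0 := ne_zero_of_v S.vW
  set G := 1 - r / 2 with hG
  have hG0 := ne_zero_of_v S.vG
  have haW : a + b = a * W := by rw [hr, hW]; ring
  set ν := b / (16 * (a + b)) with hν
  have hrν : r = 16 * ν * W := by
    linear_combination S.hW - hW
  have hκ0 : 1 + 4 * u ≠ 0 := by rintro h0; rw [h0] at huG; apply hW0; rw [← huG]; ring
  have hmW : m ^ 2 = -4 * a * W := by rw [hmm, haW]; ring
  have hbr : b = 16 * a * ν * W := by rw [hr, hrν]; ring
  set K := 1 + 4 * u with hK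
  have hm' : (2 * m / K) ^ 2 = -16 * a * G := by
    rw [div_pow, div_eq_iff (pow_ne_zero 2 hκ0)]
    linear_combination 4 * hmW - 16 * (-a) * huG
  have hm'0 : 2 * m / K ≠ 0 := div_ne_zero (mul_ne_zero two_ne_zero hm) hκ0
  have hx : ∀ z, XX L T z = -4 * a * W * (XX L T z / m ^ 2) := fun z => by
    rw [← hmW]; field_simp
  have hx' : ∀ z, XX L' T z = -16 * a * G * (XX L' T z / (2 * m / K) ^ 2) := fun z => by
    rw [← hm']; field_simp
  have key : ∀ z, z ∉ L'.lattice → (XX L' T z / (2 * m / K) ^ 2) *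
      (G * (1 + 4 * W * (XX L T z / m ^ 2))) =
      W ^ 2 * ((XX L T z / m ^ 2) * ((XX L T z / m ^ 2) + 4 * ν)) := by
    intro z hz
    have e := hX1 z hz
    have e1 := hx z
    have e2 := hx' z
    generalize XX L T z / m ^ 2 = x at *
    generalize XX L' T z / (2 * m / K) ^ 2 = x' at *
    rw [e1, e2, hbr] at e
    have : 16 * a ^ 2 ≠ 0 := mul_ne_zero (by norm_num) (pow_ne_zero 2 ha)
    apply mul_left_cancel₀ this
    linear_combination e
  refine ⟨2 * m / K, ⟨l.h2, h', hv', ?_⟩, ⟨hc.le, ?_, ?_, ?_, ?_⟩, ?_⟩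
  · rw [hm', ab1, hr, hG]; ring
  · exact fun z hz h1 => S.expand (key z hz) h1
  · exact fun z hz h1 => S.integ (key z hz) h1
  · exact fun z w hz hw iz iw h1 hne => S.contr (key z hz) (key w hw) iz iw h1 hne
  · intro z hz h1
    unfold xx at h1
    have hx0 := ne_zero_of_v h1
    have e := hode z (fun hh => hz (hc.le hh)) hx0
    unfold et
    refine S.eta hu h1 hβ e ?_
    rw [← hK]
    have hX0 : XX L T z ≠ 0 := by rintro h0; rw [h0, zero_div] at hx0; exact hx0 rfl
    have hi := S.integ (key z hz) h1.le
    have hx'0 : XX L' T z / (2 * m / K) ^ 2 ≠ 0 := ne_zero_of_v (V := V) (v_eq_one hi.1 (by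
      rw [hi.2]; exact pow_ne_zero _ (red_ne_zero h1)))
    have hX'0 : XX L' T z ≠ 0 := by rintro h0; rw [h0, zero_div] at hx'0; exact hx'0 rfl
    have d := hd z hz
    have k := hX1 z hz
    have e1 := hx z
    have hq := hXQ z hz
    generalize XX L T z / m ^ 2 = x at *
    have hq' : 1 + 4 * W * x ≠ 0 := by
      intro h0; apply hq; rw [e1]; linear_combination -a * h0
    generalize XX L T z = X at *
    generalize XX L' T z = X' at *
    generalize L'.derivWeierstrassP z = P2 at *
    generalize L.derivWeierstrassP z = P1 at *
    subst e1
    rw [hbr] at d k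
    have d' : P2 * (1 + 4 * W * x) ^ 2 = P1 * (8 * W * (2 * W * x ^ 2 + x + 2 * ν)) := by
      apply mul_left_cancel₀ (pow_ne_zero 2 ha)
      linear_combination d
    have k' : X' * (1 + 4 * W * x) = -16 * a * W ^ 2 * x * (x + 4 * ν) := by
      apply mul_left_cancel₀ ha
      linear_combination -k
    have fK : K * (2 * m / K) = 2 * m := by field_simp
    generalize 2 * m / K = m' at *
    have f1 : 2 * ((P2 / (m' * X') - 1) / 2) + 1 = P2 / (m' * X') := by ring
    have f2 : 2 * ((P1 / (m * (-4 * a * W * x)) - 1) / 2) + 1 = P1 / (m * (-4 * a * W * x)) := by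
      ring
    rw [f1, f2, div_mul_eq_mul_div, div_mul_eq_mul_div, div_mul_eq_mul_div,
      div_eq_div_iff (mul_ne_zero hm'0 hX'0) (mul_ne_zero hm hX0)]
    apply mul_left_cancel₀ hq'
    linear_combination (m * (-4 * a * W * x) * (x + 4 * ν)) * d' -
      (P1 * (2 * W * x ^ 2 + x + 2 * ν) * X' * (1 + 4 * W * x)) * fK -
      (P1 * (2 * W * x ^ 2 + x + 2 * ν) * 2 * m) * k'
  · have h4 : (2 * m / K) ^ 4 = 256 * a ^ 2 * G ^ 2 := by
      linear_combination ((2 * m / K) ^ 2 - 16 * a * G) * hm'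
    have h5 : m ^ 4 = 16 * a ^ 2 * W ^ 2 := by
      linear_combination (m ^ 2 - 4 * a * W) * hmW
    have h6 : XX L' T Q1 * XX L' T (T + Q1) / (2 * m / K) ^ 4 =
        (a * b / m ^ 4) ^ 2 * W ^ 4 / G ^ 2 := by
      rw [ab2, h4, h5]
      field_simp
      norm_num
    have hG2 : V.valuation (G ^ 2) = 1 := by rw [map_pow, S.vG, one_pow]
    have e1 := vpow hvbe.le 2
    have e2 := vpow S.vW.le 4
    rw [h6, red_div (vmul e1 e2) hG2, red_mul e1 e2, red_pow S.vG.le, red_pow S.vW.le, S.rW,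
      S.rG, red_pow hvbe.le]
    simp only [one_pow, mul_one, div_one]
end

end St16

namespace St16
open IsLocalRing

section
variable {V : ValuationSubring ℂ}

lemma val_propA {a b a' b' : ℂ} (hb : b ≠ 0)
    (hs : a' + b' = 2 * (2 * a - b)) (hp : a' * b' = b ^ 2)
    (h : V.valuation (2 * a) ≤ V.valuation b) :
    V.valuation a' = V.valuation b ∧ V.valuation b' = V.valuation b := by
  have hb0 : 0 < V.valuation b := zero_lt_iff.2 ((Valuation.ne_zero_iff _).2 hb)
  have hS : V.valuation (2 * (2 * a / b - 1)) ≤ 1 := by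
    refine vmul (vofnat 2) (vsub ?_ vone)
    rw [map_div₀]; exact div_le_one_of_le₀ h zero_le
  have e1 : (a' / b) ^ 2 = (2 * (2 * a / b - 1)) * (a' / b) - 1 := by
    field_simp
    linear_combination a' * hs - hp
  have e2 : (b' / b) ^ 2 = (2 * (2 * a / b - 1)) * (b' / b) - 1 := by
    field_simp
    linear_combination b' * hs - hp
  have v1 := v_quad hS vone e1
  have v2 := v_quad hS vone e2
  have e3 : (a' / b) * (b' / b) = 1 := by
    field_simp; exact hp
  have v3 := congrArg V.valuation e3
  rw [map_mul, map_one] at v3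
  rw [map_div₀] at v1 v2
  rw [map_div₀, map_div₀] at v3
  have key : ∀ x y : ValuationSubring.ValueGroup V, x ≤ 1 → y ≤ 1 → x * y = 1 → x = 1 := by
    intro x y hx hy hxy
    refine le_antisymm hx ?_
    rw [← hxy]; exact mul_le_of_le_one_right' hy
  have k1 := key _ _ v1 v2 v3
  have k2 := key _ _ v2 v1 (by rw [mul_comm]; exact v3)
  exact ⟨(div_eq_one_iff_eq hb0.ne').1 k1, (div_eq_one_iff_eq hb0.ne').1 k2⟩

lemma val_cyc (h2 : V.valuation (2 : ℂ) < 1) (n : ℕ) (hn : 0 < n) (a b : ℕ → ℂ) (c : ℂ)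
    (hc : V.valuation c < 1) (hc0 : c ≠ 0)
    (ha : ∀ i ≤ n, a i ≠ 0) (hb : ∀ i ≤ n, b i ≠ 0)
    (hs : ∀ i < n, a (i + 1) + b (i + 1) = 2 * (2 * a i - b i))
    (hp : ∀ i < n, a (i + 1) * b (i + 1) = b i ^ 2)
    (han : a n = c * a 0) (hbn : b n = c * b 0) :
    ∀ i ≤ n, V.valuation (b i) = V.valuation (16 * a i) := by
  have va : ∀ i ≤ n, 0 < V.valuation (a i) := fun i hi =>
    zero_lt_iff.2 ((Valuation.ne_zero_iff _).2 (ha i hi))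
  have vb : ∀ i ≤ n, 0 < V.valuation (b i) := fun i hi =>
    zero_lt_iff.2 ((Valuation.ne_zero_iff _).2 (hb i hi))
  have vc : 0 < V.valuation c := zero_lt_iff.2 ((Valuation.ne_zero_iff _).2 hc0)
  have v20 : 0 < V.valuation (2 : ℂ) := zero_lt_iff.2 ((Valuation.ne_zero_iff _).2 two_ne_zero)
  have B : ∀ i ≤ n, V.valuation (b i) < V.valuation (2 * a i) := by
    by_contra hcon
    push Not at hcon
    obtain ⟨i0, hi0, h0⟩ := hcon
    have stepA : ∀ i < n, V.valuation (2 * a i) ≤ V.valuation (b i) →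
        V.valuation (2 * a (i + 1)) ≤ V.valuation (b (i + 1)) ∧
        V.valuation (b (i + 1)) = V.valuation (b i) := by
      intro i hi h
      obtain ⟨k1, k2⟩ := val_propA (hb i hi.le) (hs i hi) (hp i hi) h
      refine ⟨?_, k2⟩
      rw [map_mul, k1, k2]; exact mul_le_of_le_one_left' h2.le
    have h3 : ∀ j, i0 + j ≤ n → V.valuation (2 * a (i0 + j)) ≤ V.valuation (b (i0 + j)) := by
      intro j
      induction j with
      | zero => intro _; exact h0
      | succ j ih => intro hj; exact (stepA (i0 + j) (by omega) (ih (by omega))).1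
    have h4 := h3 (n - i0) (by omega)
    rw [show i0 + (n - i0) = n by omega, han, hbn] at h4
    have h5 : V.valuation (2 * a 0) ≤ V.valuation (b 0) := by
      rw [show 2 * (c * a 0) = c * (2 * a 0) by ring, map_mul, map_mul] at h4
      exact le_of_mul_le_mul_left h4 vc
    have h6 : ∀ j ≤ n, V.valuation (2 * a j) ≤ V.valuation (b j) ∧
        V.valuation (b j) = V.valuation (b 0) := by
      intro j
      induction j with
      | zero => intro _; exact ⟨h5, rfl⟩
      | succ j ih =>
        intro hj
        obtain ⟨k1, k2⟩ := stepA j (by omega) (ih (by omega)).1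
        exact ⟨k1, k2.trans (ih (by omega)).2⟩
    have h7 := (h6 n le_rfl).2
    rw [hbn, map_mul] at h7
    exact absurd h7 (mul_lt_of_lt_one_left (vb 0 (by omega)) hc).ne
  set ρ : ℕ → ValuationSubring.ValueGroup V :=
    fun i => V.valuation (b i) / V.valuation (16 * a i) with hρ
  have v16 : 0 < V.valuation (16 : ℂ) := zero_lt_iff.2 ((Valuation.ne_zero_iff _).2 (by norm_num))
  have hstep : ∀ i < n, ρ (i + 1) = ρ i ^ 2 := by
    intro i hi
    have e1 : V.valuation (a (i + 1)) = V.valuation (4 * a i) := by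
      have k1 : V.valuation (a (i + 1) + b (i + 1)) = V.valuation (a (i + 1)) := by
        refine V.valuation.map_add_eq_of_lt_left ((B (i + 1) hi).trans_le ?_)
        rw [map_mul]; exact mul_le_of_le_one_left' h2.le
      have k2 : V.valuation (2 * a i - b i) = V.valuation (2 * a i) :=
        V.valuation.map_sub_eq_of_lt_left (B i hi.le)
      rw [← k1, hs i hi, map_mul, k2, ← map_mul]
      congr 1; ring
    have e2 : V.valuation (4 * a i) * V.valuation (b (i + 1)) = V.valuation (b i) ^ 2 := by
      rw [← e1, ← map_mul, hp i hi, map_pow]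
    have v4a : V.valuation (4 * a i) ≠ 0 := by rw [← e1]; exact (va (i + 1) hi).ne'
    have e3 : V.valuation (b (i + 1)) = V.valuation (b i) ^ 2 / V.valuation (4 * a i) := by
      rw [← e2, mul_div_cancel_left₀ _ v4a]
    have e4 : V.valuation (16 * a i) ^ 2 = V.valuation (4 * a i) * V.valuation (16 * a (i + 1)) := by
      rw [map_mul (V.valuation) 16 (a (i + 1)), e1, ← map_mul, ← map_mul, ← map_pow]
      congr 1; ring
    simp only [hρ]
    rw [div_pow, e4, e3, div_div]
  have hall : ∀ i ≤ n, ρ i = ρ 0 ^ (2 ^ i) := by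
    intro i
    induction i with
    | zero => intro _; simp
    | succ i ih => intro hi; rw [hstep i hi, ih (by omega), ← pow_mul, pow_succ]
  have hρn : ρ n = ρ 0 := by
    simp only [hρ]
    rw [hbn, han, show 16 * (c * a 0) = c * (16 * a 0) by ring, map_mul, map_mul,
      mul_div_mul_left _ _ vc.ne']
  have hρ0 : 0 < ρ 0 := by
    simp only [hρ]
    exact div_pos (vb 0 (by omega)) (by rw [map_mul]; exact mul_pos v16 (va 0 (by omega)))
  have h1n : 1 < 2 ^ n := Nat.one_lt_two_pow hn.ne'
  have hone : ρ 0 = 1 := by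
    have h := hall n le_rfl
    rw [hρn] at h
    rcases lt_trichotomy (ρ 0) 1 with h' | h' | h'
    · exact absurd h (pow_lt_self_of_lt_one₀ hρ0 h' h1n).ne'
    · exact h'
    · exact absurd h (lt_self_pow₀ h' h1n).ne
  intro i hi
  have := hall i hi
  rw [hone, one_pow] at this
  have h0 : V.valuation (16 * a i) ≠ 0 := by rw [map_mul]; exact (mul_pos v16 (va i hi)).ne'
  exact (div_eq_one_iff_eq h0).1 this
end

namespace Dat
variable (D : Dat)

/-- the fixed half period and the tower of the others -/
noncomputable def T2 : ℂ := (1 + D.τ) / 2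
noncomputable def Q2 (i : ℕ) : ℂ := (D.τ + D.q) / 2 ^ (i + 1)

lemma Q2_succ (i : ℕ) : 2 * D.Q2 (i + 1) = D.Q2 i := by
  rw [Q2, Q2, pow_succ]; field_simp

variable {D}
lemma two_T2 (i : ℕ) : 2 * D.T2 = 1 + 2 ^ i * (D.τ / 2 ^ i) := by
  rw [T2]; field_simp

lemma two_Q2 (h2 : D.p = 2) {i : ℕ} (hi : i ≤ D.n) :
    2 * D.Q2 i = ((2 ^ (D.n - i) : ℤ) : ℂ) + D.τ / 2 ^ i := by
  have : (D.q : ℂ) = 2 ^ (D.n - i) * 2 ^ i := by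
    rw [D.q_eq, h2, ← pow_add, Nat.sub_add_cancel hi]; norm_num
  rw [Q2, this, pow_succ]; push_cast; field_simp; ring

lemma mem_L2 (h2 : D.p = 2) {i : ℕ} {x : ℂ} : x ∈ (D.L i).lattice ↔
    ∃ a b : ℤ, x = a + b * (D.τ / 2 ^ i) := by
  have := D.mem_L (i := i) (x := x)
  rw [h2] at this; exact_mod_cast this

lemma repr2 (h2 : D.p = 2) (i : ℕ) {a b a' b' : ℤ}
    (h : (a : ℂ) + b * (D.τ / 2 ^ i) = a' + b' * (D.τ / 2 ^ i)) : a = a' ∧ b = b' := by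
  refine D.repr_unique (i := i) ?_
  rw [h2]; exact_mod_cast h

lemma triple2 (h2 : D.p = 2) {i : ℕ} (hi : i ≤ D.n) :
    Triple (D.L i) D.T2 (D.Q2 i) (D.T2 + D.Q2 i) := by
  have hT := two_T2 (D := D) i
  have hQ := two_Q2 h2 hi
  have hn := D.hn
  have ha2 : 2 * D.T2 ∈ (D.L i).lattice := (mem_L2 h2).2 ⟨1, 2 ^ i, by rw [hT]; push_cast; ring⟩
  have hb2 : 2 * D.Q2 i ∈ (D.L i).lattice := (mem_L2 h2).2 ⟨2 ^ (D.n - i), 1, by rw [hQ]; simp⟩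
  refine ⟨?_, ?_, ?_, ha2, hb2, by rw [mul_add]; exact add_mem ha2 hb2, ?_⟩
  · intro h
    obtain ⟨a, b, h⟩ := (mem_L2 h2).1 h
    have := (repr2 h2 i (a := 1) (b := 2 ^ i) (a' := 2 * a) (b' := 2 * b) (by
      push_cast; linear_combination 2 * h - hT)).1
    omega
  · intro h
    obtain ⟨a, b, h⟩ := (mem_L2 h2).1 h
    have := (repr2 h2 i (a := 2 ^ (D.n - i)) (b := 1) (a' := 2 * a) (b' := 2 * b) (by
      push_cast at hQ ⊢; linear_combination 2 * h - hQ)).2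
    omega
  · intro h
    obtain ⟨a, b, h⟩ := (mem_L2 h2).1 h
    have := (repr2 h2 i (a := 1 + 2 ^ (D.n - i)) (b := 2 ^ i + 1) (a' := 2 * a) (b' := 2 * b) (by
      push_cast at hQ ⊢; linear_combination 2 * h - hQ - hT))
    rcases Nat.eq_zero_or_pos i with h0 | h0
    · obtain ⟨k, hk⟩ : ∃ k, D.n - i = k + 1 := ⟨D.n - i - 1, by omega⟩
      have := this.1
      rw [hk, pow_succ] at this
      omega
    · obtain ⟨k, rfl⟩ : ∃ k, i = k + 1 := ⟨i - 1, by omega⟩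
      have := this.2
      rw [pow_succ] at this
      omega
  · have := add_mem ha2 hb2
    convert this using 1; ring

lemma cosets2 (h2 : D.p = 2) {i : ℕ} (hi : i < D.n) :
    Cosets (D.L i) (D.L (i + 1)) {0, D.Q2 i} := by
  have hQ : D.Q2 i = ((2 ^ (D.n - (i + 1)) : ℤ) : ℂ) + D.τ / 2 ^ (i + 1) := by
    rw [← Q2_succ]; exact two_Q2 h2 hi
  have hQm : D.Q2 i ∈ (D.L (i + 1)).lattice := (mem_L2 h2).2 ⟨2 ^ (D.n - (i + 1)), 1, by rw [hQ]; simp⟩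
  have hQn := (triple2 h2 hi.le).hb
  refine ⟨by simp, D.L_mono i, ?_, ?_, ?_⟩
  · intro R hR
    simp only [Finset.mem_insert, Finset.mem_singleton] at hR
    rcases hR with rfl | rfl
    · exact zero_mem _
    · exact hQm
  · intro x hx
    obtain ⟨a, b, rfl⟩ := (mem_L2 h2).1 hx
    rcases Int.even_or_odd' b with ⟨c, rfl | rfl⟩
    · refine ⟨0, by simp, (mem_L2 h2).2 ⟨a, c, ?_⟩⟩
      rw [pow_succ]; push_cast; field_simp; ring
    · refine ⟨D.Q2 i, by simp, (mem_L2 h2).2 ⟨a - 2 ^ (D.n - (i + 1)), c, ?_⟩⟩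
      rw [hQ, pow_succ]; push_cast; field_simp; ring
  · intro R hR S hS h
    simp only [Finset.mem_insert, Finset.mem_singleton] at hR hS
    rcases hR with rfl | rfl <;> rcases hS with rfl | rfl
    · rfl
    · exact absurd (by simpa using neg_mem h) hQn
    · exact absurd (by simpa using h) hQn
    · rfl

lemma s_odd2 (h2 : D.p = 2) : ∃ k : ℤ, (D.s : ℤ) = 2 * k + 1 := by
  have := D.hs
  rw [h2] at this
  exact ⟨D.s / 2, by omega⟩

lemma q_even2 (h2 : D.p = 2) : ∃ k : ℤ, (D.q : ℤ) = 2 * k := by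
  obtain ⟨m, hm⟩ : ∃ m, D.n = m + 1 := ⟨D.n - 1, by have := D.hn; omega⟩
  exact ⟨2 ^ m, by rw [q, h2, hm, pow_succ]; push_cast; ring⟩

lemma pi_T2 (h2 : D.p = 2) : D.π * D.T2 - D.T2 ∈ (D.L 0).lattice := by
  obtain ⟨k, hk⟩ := s_odd2 h2
  obtain ⟨j, hj⟩ := q_even2 h2
  have hk' : (D.s : ℂ) = 2 * k + 1 := by exact_mod_cast congrArg (Int.cast (R := ℂ)) hk
  have hj' : (D.q : ℂ) = 2 * j := by exact_mod_cast congrArg (Int.cast (R := ℂ)) hj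
  refine (mem_L2 h2).2 ⟨j - k - 1, -1, ?_⟩
  have h1 := D.hsum
  have h3 := D.hprod'
  rw [T2]; push_cast
  linear_combination (1/2 : ℂ) * h1 + (1/2 : ℂ) * h3 + (1/2 : ℂ) * hj' - (1/2 : ℂ) * hk'

lemma pi_Q2 (h2 : D.p = 2) : D.π * D.Q2 D.n - D.Q2 0 ∈ (D.L 0).lattice := by
  obtain ⟨k, hk⟩ := s_odd2 h2
  obtain ⟨j, hj⟩ := q_even2 h2
  have hk' : (D.s : ℂ) = 2 * k + 1 := by exact_mod_cast congrArg (Int.cast (R := ℂ)) hk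
  have hj' : (D.q : ℂ) = 2 * j := by exact_mod_cast congrArg (Int.cast (R := ℂ)) hj
  have hq : (2 : ℂ) ^ (D.n + 1) = 2 * D.q := by rw [D.q_eq, h2, pow_succ]; push_cast; ring
  have hq0 := D.q_ne
  have h1 := D.hsum
  have h3 := D.hprod'
  have e : D.π * D.Q2 D.n = (1 + D.π) / 2 := by
    rw [Q2, hq]; field_simp; linear_combination h3
  refine (mem_L2 h2).2 ⟨-k - j, -1, ?_⟩
  rw [e, Q2]; push_cast
  linear_combination (1/2 : ℂ) * h1 - (1/2 : ℂ) * hj' - (1/2 : ℂ) * hk'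

lemma XX_top (h2 : D.p = 2) (z : ℂ) :
    XX (D.L D.n) D.T2 z = D.π ^ 2 * XX (D.L 0) D.T2 (D.π * z) := by
  rw [XX, XX, P_scale D.π_ne D.pi_mem_L0, P_scale D.π_ne D.pi_mem_L0,
    P_congr (D.L 0) (pi_T2 h2)]
  ring

lemma XX_top_Q (h2 : D.p = 2) :
    XX (D.L D.n) D.T2 (D.Q2 D.n) = D.π ^ 2 * XX (D.L 0) D.T2 (D.Q2 0) := by
  rw [XX_top h2, XX, XX, P_congr (D.L 0) (pi_Q2 h2)]

lemma XX_top_TQ (h2 : D.p = 2) :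
    XX (D.L D.n) D.T2 (D.T2 + D.Q2 D.n) = D.π ^ 2 * XX (D.L 0) D.T2 (D.T2 + D.Q2 0) := by
  rw [XX_top h2, XX, XX, P_congr (D.L 0) (a := D.π * (D.T2 + D.Q2 D.n)) (b := D.T2 + D.Q2 0)]
  have := add_mem (pi_T2 h2) (pi_Q2 h2)
  convert this using 1; ring

lemma v2_lt (h2 : D.p = 2) : D.V.valuation (2 : ℂ) < 1 := by
  have := D.hVp
  rw [h2] at this; exact_mod_cast this

lemma val2 (h2 : D.p = 2) : ∀ i ≤ D.n, D.V.valuation (XX (D.L i) D.T2 (D.T2 + D.Q2 i)) =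
    D.V.valuation (16 * XX (D.L i) D.T2 (D.Q2 i)) := by
  refine val_cyc (v2_lt h2) D.n D.hn (fun i => XX (D.L i) D.T2 (D.Q2 i))
    (fun i => XX (D.L i) D.T2 (D.T2 + D.Q2 i)) (D.π ^ 2) ?_ (pow_ne_zero 2 D.π_ne)
    (fun i hi => aa_ne (triple2 h2 hi)) (fun i hi => bb_ne (triple2 h2 hi))
    (fun i hi => ?_) (fun i hi => ?_) (XX_top_Q h2) (XX_top_TQ h2)
  · rw [map_pow]; exact pow_lt_one₀ zero_le D.hVπ (by norm_num)
  · exact (step2_ab (triple2 h2 hi.le) (triple2 h2 hi) (cosets2 h2 hi) (D.Q2_succ i)).1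
  · exact (step2_ab (triple2 h2 hi.le) (triple2 h2 hi) (cosets2 h2 hi) (D.Q2_succ i)).2

lemma exists_lv0 (h2 : D.p = 2) : ∃ m, Lv2 D.V (D.L 0) D.T2 (D.Q2 0) m := by
  obtain ⟨m, hm⟩ := IsAlgClosed.exists_pow_nat_eq
    (-4 * (XX (D.L 0) D.T2 (D.Q2 0) + XX (D.L 0) D.T2 (D.T2 + D.Q2 0))) (n := 2) (by norm_num)
  exact ⟨m, v2_lt h2, triple2 h2 (Nat.zero_le _), val2 h2 0 (Nat.zero_le _), hm⟩

lemma rel2 (h2 : D.p = 2) {m : ℂ} (l : Lv2 D.V (D.L 0) D.T2 (D.Q2 0) m) : ∀ i, i < D.n →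
    ∃ m', Lv2 D.V (D.L (i + 1)) D.T2 (D.Q2 (i + 1)) m' ∧
      Rel2 D.V D.T2 (D.L 0) m (D.L (i + 1)) m' (2 ^ (i + 1)) ∧
      red D.V (be (D.L (i + 1)) D.T2 (D.Q2 (i + 1)) m') =
        red D.V (be (D.L 0) D.T2 (D.Q2 0) m) ^ (2 ^ (i + 1)) := by
  intro i
  induction i with
  | zero =>
    intro hi
    simpa using step2 l (triple2 h2 hi) (cosets2 h2 hi) (D.Q2_succ 0) (val2 h2 1 hi)
  | succ i ih =>
    intro hi
    obtain ⟨m1, l1, r1, b1⟩ := ih (by omega)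
    obtain ⟨m2, l2, r2, b2⟩ := step2 l1 (triple2 h2 hi) (cosets2 h2 hi) (D.Q2_succ (i + 1))
      (val2 h2 (i + 2) hi)
    refine ⟨m2, l2, ?_, ?_⟩
    · rw [pow_succ]; exact r1.trans l1 r2
    · rw [b2, b1, ← pow_mul, ← pow_succ]

lemma rel2_top (h2 : D.p = 2) {m : ℂ} (l : Lv2 D.V (D.L 0) D.T2 (D.Q2 0) m) :
    ∃ c : ℤ, (c = 1 ∨ c = -1) ∧
      Rel2 D.V D.T2 (D.L 0) m (D.L D.n) (c * D.π * m) D.q ∧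
      red D.V (be (D.L 0) D.T2 (D.Q2 0) m) ^ D.q = red D.V (be (D.L 0) D.T2 (D.Q2 0) m) := by
  obtain ⟨k, hk⟩ : ∃ k, D.n = k + 1 := ⟨D.n - 1, by have := D.hn; omega⟩
  obtain ⟨m', l', r', b'⟩ := rel2 h2 l k (by omega)
  rw [← hk] at l' r' b'
  have hq : (2 : ℕ) ^ D.n = D.q := by rw [q, h2]
  rw [hq] at r' b'
  have hsq : m' ^ 2 = (D.π * m) ^ 2 := by
    rw [l'.hm, XX_top_Q h2, XX_top_TQ h2, mul_pow, l.hm]; ring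
  have hβ : be (D.L D.n) D.T2 (D.Q2 D.n) m' = be (D.L 0) D.T2 (D.Q2 0) m := by
    have hm := l.m_ne
    have hπ := D.π_ne
    have : m' ^ 4 = (D.π * m) ^ 4 := by
      linear_combination (m' ^ 2 + (D.π * m) ^ 2) * hsq
    rw [be, be, this, XX_top_Q h2, XX_top_TQ h2]
    field_simp
  rw [hβ] at b'
  rcases sq_eq_sq_iff_eq_or_eq_neg.1 hsq with h | h
  · exact ⟨1, Or.inl rfl, by simpa [h] using r', b'.symm⟩
  · exact ⟨-1, Or.inr rfl, by simpa [h] using r', b'.symm⟩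

end Dat
end St16

namespace St16
open IsLocalRing
namespace Dat
variable (D : Dat)

theorem two_final (h2 : D.p = 2) (hs : D.s ≤ D.q) :
    ∃ (β : ResidueField D.V) (c : ℤ) (sg : ResidueField D.V → ℤ),
      D.Fix.card = D.q ∧ β ≠ 0 ∧ β ^ D.q = β ∧ (c = 1 ∨ c = -1) ∧ sg 0 = 0 ∧
      (∀ y ∈ D.Fix, y ≠ 0 → (sg y = 1 ∨ sg y = -1) ∧ ∃ η, η ^ 2 + η = y + β / y ∧
        (sg y = c → η ^ D.q = η) ∧ (sg y ≠ c → η ^ D.q = η + 1)) ∧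
      ∑ y ∈ D.Fix, sg y = D.s := by
  classical
  obtain ⟨m, l⟩ := exists_lv0 h2
  obtain ⟨c, hc, R, hβ⟩ := rel2_top h2 l
  have hm := l.m_ne
  have hπ := D.π_ne
  have v2 := v2_lt h2
  have hc2 : (c : ℂ) ^ 2 = 1 := by rcases hc with h | h <;> rw [h] <;> norm_num
  have hc0 : (c : ℂ) ≠ 0 := by intro h; rw [h] at hc2; norm_num at hc2
  have zn := D.zz_notMem_n hs
  have z0 := D.zz_notMem hs
  have tri0 := triple2 h2 (Nat.zero_le D.n)
  have trin := triple2 h2 (le_refl D.n)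
  -- the top coordinate
  have htop : ∀ i, xx (D.L D.n) D.T2 (c * D.π * m) (D.zz i) = xx (D.L 0) D.T2 m (D.zz i) := by
    intro i
    have e : XX (D.L 0) D.T2 (D.π * D.zz i) = XX (D.L 0) D.T2 (D.zz i) := by
      rw [XX, XX, zz_P]
    rw [xx, xx, XX_top h2, e, mul_pow, mul_pow, hc2]
    field_simp
  have hIntg : ∀ i, D.V.valuation (xx (D.L 0) D.T2 m (D.zz i)) ≤ 1 := by
    intro i
    by_contra h
    have := R.expand _ (zn i) (not_le.1 h)
    rw [htop] at this
    exact lt_irrefl _ this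
  set t : D.ι → ResidueField D.V := fun i => red D.V (xx (D.L 0) D.T2 m (D.zz i)) with ht
  have htF : ∀ i, t i ∈ D.Fix := by
    intro i
    rw [mem_Fix]
    have := (R.integ _ (zn i) (hIntg i)).2
    rw [htop] at this
    exact this.symm
  have hPeq : ∀ z w, xx (D.L 0) D.T2 m z = xx (D.L 0) D.T2 m w →
      (D.L 0).weierstrassP z = (D.L 0).weierstrassP w := by
    intro z w he
    rw [xx, xx, div_left_inj' (pow_ne_zero 2 hm), XX, XX] at he
    simpa using he
  have htinj : ∀ i j, t i = t j → D.zz i + D.zz j ∈ (D.L 0).lattice ∨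
      D.zz i - D.zz j ∈ (D.L 0).lattice := by
    intro i j hij
    have h1 := (red_eq_iff (hIntg i) (hIntg j)).1 hij
    by_cases he : xx (D.L 0) D.T2 m (D.zz i) = xx (D.L 0) D.T2 m (D.zz j)
    · exact P_inj tri0 (z0 j) (z0 i) (hPeq _ _ he)
    · have := R.contr _ _ (zn i) (zn j) (hIntg i) (hIntg j) h1 he
      rw [htop, htop] at this
      exact absurd this (lt_irrefl _)
  obtain ⟨hcard, hsurj, sg, hsg0, hsg1, hsum⟩ := D.count hs t htinj D.Fix htF D.Fix_card
  have hT0 : ∀ L m', xx L D.T2 m' D.T2 = 0 := by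
    intro L m'; rw [xx, XX, sub_self, zero_div]
  have hz1 : ∀ i, t i = 0 → 2 * D.zz i ∈ (D.L 0).lattice := by
    intro i h0
    have h1 := (red_eq_zero_iff (hIntg i)).1 h0
    by_cases he : xx (D.L 0) D.T2 m (D.zz i) = 0
    · rcases P_inj tri0 tri0.ha (z0 i) (hPeq _ _ (by rw [he, hT0])) with h | h
      · have := sub_mem (add_mem h h) tri0.ha2
        convert this using 1; ring
      · have := add_mem (add_mem h h) tri0.ha2
        convert this using 1; ring
    · have := R.contr _ D.T2 (zn i) trin.ha (hIntg i) (by rw [hT0, map_zero]; exact zero_le)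
        (by rw [hT0, sub_zero]; exact h1) (by rw [hT0]; exact he)
      rw [htop, hT0, hT0] at this
      exact absurd this (lt_irrefl _)
  have ha0 := aa_ne l.tri
  have hab0 := l.ab_ne
  have hν := l.sc.hν
  have v4 : D.V.valuation (4 : ℂ) < 1 := by
    have := v2mul v2 (y := 2) (vofnat 2)
    convert this using 2; norm_num
  have hxb : D.V.valuation (xx (D.L 0) D.T2 m (D.T2 + D.Q2 0)) < 1 := by
    have e : xx (D.L 0) D.T2 m (D.T2 + D.Q2 0) = 4 * (-(XX (D.L 0) D.T2 (D.T2 + D.Q2 0) /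
        (16 * (XX (D.L 0) D.T2 (D.Q2 0) + XX (D.L 0) D.T2 (D.T2 + D.Q2 0))))) := by
      rw [xx, l.hm]; field_simp; ring
    rw [e, map_mul, Valuation.map_neg, hν, mul_one]
    exact v4
  have hxa : 1 < D.V.valuation (xx (D.L 0) D.T2 m (D.Q2 0)) := by
    by_contra hcon
    push Not at hcon
    have e : xx (D.L 0) D.T2 m (D.Q2 0) * 4 +
        4 * xx (D.L 0) D.T2 m (D.T2 + D.Q2 0) = -1 := by
      rw [xx, xx, l.hm]; field_simp; ring
    have h1 : D.V.valuation (-1 : ℂ) < 1 := by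
      rw [← e]
      refine Valuation.map_add_lt _ ?_ ?_
      · rw [map_mul]
        exact lt_of_le_of_lt (mul_le_of_le_one_left' hcon) v4
      · rw [map_mul]
        exact lt_of_le_of_lt (mul_le_of_le_one_left' v4.le) hxb
    rw [Valuation.map_neg, map_one] at h1
    exact lt_irrefl _ h1
  have hz2 : ∀ i, 2 * D.zz i ∈ (D.L 0).lattice → t i = 0 := by
    intro i h
    have h1 := tri0.ode (z0 i)
    rw [P'_half _ h] at h1
    have h3 : ((D.L 0).weierstrassP (D.zz i) - (D.L 0).weierstrassP D.T2) *
      ((D.L 0).weierstrassP (D.zz i) - (D.L 0).weierstrassP (D.Q2 0)) *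
      ((D.L 0).weierstrassP (D.zz i) - (D.L 0).weierstrassP (D.T2 + D.Q2 0)) = 0 := by
      linear_combination (-1/4 : ℂ) * h1
    have hx : ∀ w, (D.L 0).weierstrassP (D.zz i) - (D.L 0).weierstrassP w = 0 →
        xx (D.L 0) D.T2 m (D.zz i) = xx (D.L 0) D.T2 m w := by
      intro w hw
      rw [xx, xx, XX, XX, sub_eq_zero.1 hw]
    rcases mul_eq_zero.1 h3 with h4 | h4
    · rcases mul_eq_zero.1 h4 with h5 | h5
      · simp only [ht]
        rw [hx _ h5, hT0, red_zero]
      · have := hIntg i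
        rw [hx _ h5] at this
        exact absurd hxa (not_lt.2 this)
    · exact (red_eq_zero_iff (hIntg i)).2 (by rw [hx _ h4]; exact hxb)
  refine ⟨red D.V (be (D.L 0) D.T2 (D.Q2 0) m), c, sg, hcard, red_ne_zero l.v_be, hβ, hc, ?_, ?_,
    hsum⟩
  · have h0 : (0 : ResidueField D.V) ∈ D.Fix := by
      rw [mem_Fix]; exact zero_pow (by have := D.q_gt; omega)
    obtain ⟨i, hi⟩ := hsurj 0 h0
    rw [← hi]
    exact hsg0 i (hz1 i hi)
  · intro y hy hy0
    obtain ⟨i, rfl⟩ := hsurj y hy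
    have hi : 2 * D.zz i ∉ (D.L 0).lattice := fun h => hy0 (hz2 i h)
    have vx : D.V.valuation (xx (D.L 0) D.T2 m (D.zz i)) = 1 := v_eq_one (hIntg i) hy0
    have hx0 : xx (D.L 0) D.T2 m (D.zz i) ≠ 0 := ne_zero_of_v vx
    have hX0 : XX (D.L 0) D.T2 (D.zz i) ≠ 0 := by
      intro h; apply hx0; rw [xx, h, zero_div]
    obtain ⟨ve, ve', hred⟩ := R.eta _ (zn i) vx
    rw [hsg1 i hi]
    have key : 2 * et (D.L D.n) D.T2 (c * D.π * m) (D.zz i) + 1 =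
        c * D.eps i * (2 * et (D.L 0) D.T2 m (D.zz i) + 1) := by
      have e : XX (D.L D.n) D.T2 (D.zz i) = D.π ^ 2 * XX (D.L 0) D.T2 (D.zz i) := by
        rw [XX_top h2, XX, XX, zz_P]
      rw [et, et, e, P'_scale D.π_ne D.pi_mem_L0, zz_P']
      field_simp
      linear_combination (-(D.eps i : ℂ) * (D.L 0).derivWeierstrassP (D.zz i)) * hc2
    refine ⟨D.eps_pm i, red D.V (et (D.L 0) D.T2 m (D.zz i)), ?_, ?_, ?_⟩
    · have := congrArg (red D.V) (l.et_eq (z0 i) hx0)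
      rw [red_add (vpow ve 2) ve, red_pow ve, red_add (hIntg i) (vdiv l.v_be.le vx),
        red_div l.v_be.le vx] at this
      exact this
    · intro h
      rw [← hred]
      congr 1
      rw [h, ← sq, hc2] at key
      linear_combination (1/2 : ℂ) * key
    · intro h
      have h5 : (c : ℂ) * D.eps i = -1 := by
        rcases hc with h' | h' <;> rcases D.eps_pm i with h'' | h'' <;> rw [h', h''] at h <;>
        first | exact absurd rfl h | (rw [h', h'']; norm_num)
      rw [h5] at key
      have h6 : et (D.L D.n) D.T2 (c * D.π * m) (D.zz i) = -(et (D.L 0) D.T2 m (D.zz i) + 1) := by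
        linear_combination (1/2 : ℂ) * key
      rw [← hred, h6, red_neg (vadd ve vone), red_add ve vone, red_one]
      linear_combination (-(red D.V (et (D.L 0) D.T2 m (D.zz i)) + 1)) * red_two v2

theorem two_curve (h2 : D.p = 2) (hs : D.s ≤ D.q) (F : Type*) [Field F] [Fintype F]
    (hF : Fintype.card F = D.q) : ∃ E : WeierstrassCurve F, E.IsElliptic ∧
      Nat.card E.toAffine.Point = D.q + 1 + D.s := by
  classical
  obtain ⟨β, c, sg, hcard, hβ0, hβ, hc, hz, hnz, hsum⟩ := D.two_final h2 hs
  obtain ⟨φ, hφ⟩ := D.exists_emb hcard F hF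
  obtain ⟨B, hB⟩ := (hφ _).1 (D.mem_Fix.2 hβ)
  have k2 : (2 : ResidueField D.V) = 0 := red_two (v2_lt h2)
  have F2 : (2 : F) = 0 := φ.injective (by rw [map_ofNat, map_zero, k2])
  have hB0 : B ≠ 0 := by rintro rfl; rw [map_zero] at hB; exact hβ0 hB.symm
  -- Artin-Schreier map
  let ψ : F →+ F :=
    { toFun := fun w => w ^ 2 + w
      map_zero' := by ring
      map_add' := fun x y => by linear_combination x * y * F2 }
  have hψ : ∀ w, ψ w = w ^ 2 + w := fun _ => rfl
  have hker : ∀ w w', ψ w = ψ w' → w' = w ∨ w' = w + 1 := by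
    intro w w' h
    rw [hψ, hψ] at h
    have : (w' - w) * (w' - (w + 1)) = 0 := by
      linear_combination -h + (w ^ 2 - w * w' + w - w') * F2
    rcases mul_eq_zero.1 this with h | h
    · left; linear_combination h
    · right; linear_combination h
  have hψ1 : ∀ w, ψ (w + 1) = ψ w := by
    intro w; rw [hψ, hψ]; linear_combination (w + 1) * F2
  -- membership in range by Frobenius
  have hmem : ∀ (u : F) (η : ResidueField D.V), η ^ 2 + η = φ u →
      (η ^ D.q = η ↔ u ∈ ψ.range) := by
    intro u η hη
    constructor
    · intro h
      obtain ⟨w, hw⟩ := (hφ _).1 (D.mem_Fix.2 h)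
      exact ⟨w, φ.injective (by rw [hψ, map_add, map_pow, hw, hη])⟩
    · rintro ⟨w, rfl⟩
      rw [hψ, map_add, map_pow] at hη
      have hw : (φ w) ^ D.q = φ w := D.mem_Fix.1 ((hφ _).2 ⟨w, rfl⟩)
      have : (η - φ w) * (η - (φ w + 1)) = 0 := by
        linear_combination hη + (φ w ^ 2 - φ w * η + φ w - η) * k2
      rcases mul_eq_zero.1 this with h | h
      · rw [sub_eq_zero.1 h, hw]
      · rw [sub_eq_zero.1 h, D.addq, hw, one_pow]
  -- index two
  have hidx : ψ.range.index = 2 := by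
    have h1 : Nat.card ψ.ker = 2 := by
      have : (ψ.ker : Set F) = {0, 1} := by
        ext w
        simp only [SetLike.mem_coe, AddMonoidHom.mem_ker, Set.mem_insert_iff,
          Set.mem_singleton_iff]
        constructor
        · intro h
          rcases hker 0 w (by rw [h, map_zero]) with h | h
          · left; exact h
          · right; rw [h, zero_add]
        · rintro (rfl | rfl)
          · exact map_zero _
          · rw [hψ]; linear_combination F2
      have h3 : Nat.card ψ.ker = (ψ.ker : Set F).ncard := rfl
      rw [h3, this, Set.ncard_pair zero_ne_one]
    have h4 := ψ.ker.card_mul_index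
    rw [AddSubgroup.index_ker, h1] at h4
    have h5 := ψ.range.card_mul_index
    have h6 : 0 < Nat.card ψ.range := Nat.card_pos
    apply Nat.eq_of_mul_eq_mul_left h6
    rw [h5, ← h4, mul_comm]
  obtain ⟨a0, ha0⟩ := AddSubgroup.index_eq_two_iff.1 hidx
  obtain ⟨a2, ha2⟩ : ∃ a2 : F, (c = 1 ∧ a2 = 0) ∨
      (c = -1 ∧ ∀ b, Xor (b + a2 ∈ ψ.range) (b ∈ ψ.range)) := by
    rcases hc with h | h
    · exact ⟨0, Or.inl ⟨h, rfl⟩⟩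
    · exact ⟨a0, Or.inr ⟨h, ha0⟩⟩
  let E : WeierstrassCurve F := ⟨1, a2, 0, B, 0⟩
  have hΔ : E.Δ ≠ 0 := by
    have : E.Δ = B ^ 2 := by
      simp only [WeierstrassCurve.Δ, WeierstrassCurve.b₂, WeierstrassCurve.b₄, WeierstrassCurve.b₆,
        WeierstrassCurve.b₈, E]
      linear_combination (4 * B ^ 2 * a2 + 8 * B ^ 2 * a2 ^ 2 - 32 * B ^ 3) * F2
    rw [this]; exact pow_ne_zero _ hB0
  refine ⟨E, ⟨isUnit_iff_ne_zero.2 hΔ⟩, ?_⟩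
  rw [card_points E hΔ _ (fun _ => rfl)]
  have hcnt : ∀ t, ((Finset.univ.filter fun y => E.toAffine.Equation t y).card : ℤ) =
      sg (φ t) + 1 := by
    intro t
    by_cases ht : t = 0
    · subst ht
      rw [map_zero, hz]
      have : (Finset.univ.filter fun y => E.toAffine.Equation 0 y) = {0} := by
        ext y
        simp [WeierstrassCurve.Affine.equation_iff, E]
      rw [this]; simp
    have hφt : φ t ≠ 0 := (map_ne_zero φ).2 ht
    obtain ⟨hpm, η, hη, hη1, hη2⟩ := hnz _ ((hφ _).2 ⟨t, rfl⟩) hφt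
    have hH := hmem (t + B / t) η (by rw [hη, map_add, map_div₀, hB])
    have hiff : sg (φ t) = c ↔ t + B / t ∈ ψ.range := by
      rw [← hH]
      refine ⟨hη1, fun h => ?_⟩
      by_contra hne
      have := hη2 hne
      rw [h] at this
      simp at this
    have hiff2 : sg (φ t) = 1 ↔ t + B / t + a2 ∈ ψ.range := by
      rcases ha2 with ⟨h, h'⟩ | ⟨h, h'⟩
      · rw [h', add_zero, ← hiff, h]
      · rw [h] at hiff
        rcases h' (t + B / t) with ⟨h3, h4⟩ | ⟨h3, h4⟩
        · rw [← hiff] at h4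
          exact ⟨fun _ => h3, fun _ => hpm.resolve_right h4⟩
        · rw [← hiff] at h3
          exact ⟨fun h5 => absurd (h5.symm.trans h3) (by norm_num), fun h5 => absurd h5 h4⟩
    have heq : ∀ y, E.toAffine.Equation t y ↔ ψ (y / t) = t + B / t + a2 := by
      intro y
      rw [WeierstrassCurve.Affine.equation_iff, hψ]
      simp only [E]
      field_simp
      constructor
      · intro h; linear_combination h
      · intro h; linear_combination h
    by_cases h1 : sg (φ t) = 1
    · obtain ⟨w, hw⟩ := hiff2.1 h1
      have : (Finset.univ.filter fun y => E.toAffine.Equation t y) = {t * w, t * (w + 1)} := by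
        ext y
        simp only [Finset.mem_filter, Finset.mem_univ, true_and, Finset.mem_insert,
          Finset.mem_singleton, heq, ← hw]
        constructor
        · intro h
          rcases hker _ _ h.symm with h | h
          · left; rw [← h]; field_simp
          · right; rw [← h]; field_simp
        · rintro (rfl | rfl)
          · rw [mul_div_cancel_left₀ _ ht]
          · rw [mul_div_cancel_left₀ _ ht, hψ1]
      rw [this, Finset.card_pair, h1]
      · norm_num
      · intro h
        have := mul_left_cancel₀ ht h
        simp at this
    · have h1' := hpm.resolve_left h1
      have : (Finset.univ.filter fun y => E.toAffine.Equation t y) = ∅ := by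
        ext y
        simp only [Finset.mem_filter, Finset.mem_univ, true_and, heq, Finset.notMem_empty,
          iff_false]
        intro h
        exact h1 (hiff2.2 ⟨_, h⟩)
      rw [this, h1']; simp
  have htot : ((∑ x, (Finset.univ.filter fun y => E.toAffine.Equation x y).card : ℕ) : ℤ) =
      D.s + D.q := by
    push_cast
    rw [Finset.sum_congr rfl fun t _ => hcnt t, Finset.sum_add_distrib, ← D.sum_emb φ hφ, hsum]
    simp [hF]
  omega

end Dat
end St16

namespace St16

lemma exists_V {p : ℕ} (hp : p.Prime) : ∃ V : ValuationSubring ℂ, V.valuation (p : ℂ) < 1 := by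
  let A : Subring ℂ := (Int.castRingHom ℂ).range
  let P : A := ⟨(p : ℂ), ⟨(p : ℤ), by simp⟩⟩
  have hI : Ideal.span {P} ≠ ⊤ := by
    intro h
    rw [Ideal.eq_top_iff_one, Ideal.mem_span_singleton] at h
    obtain ⟨⟨_, k, rfl⟩, h⟩ := h
    have h1 := congrArg (Subtype.val : A → ℂ) h
    have h2 : (1 : ℂ) = p * k := by simpa [P] using h1
    have h3 : (1 : ℤ) = p * k := by exact_mod_cast h2
    have h4 : (p : ℤ) ∣ 1 := ⟨k, h3⟩
    have h5 : p ∣ 1 := by exact_mod_cast h4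
    exact hp.one_lt.ne' (Nat.dvd_one.1 h5)
  obtain ⟨V, -, hV⟩ := Ideal.image_subset_nonunits_valuationSubring _ hI
  refine ⟨V, ?_⟩
  have : (p : ℂ) ∈ V.nonunits := hV ⟨P, Ideal.subset_span rfl, rfl⟩
  exact this

lemma exists_Dat {p n s : ℕ} (hp : p.Prime) (hn : 0 < n) (hs : ¬ p ∣ s) (hs4 : s ^ 2 < 4 * p ^ n) :
    ∃ D : Dat, D.p = p ∧ D.n = n ∧ D.s = s := by
  obtain ⟨V, hV⟩ := exists_V hp
  obtain ⟨δ, hδ⟩ := IsAlgClosed.exists_pow_nat_eq ((s : ℂ) ^ 2 - 4 * (p : ℂ) ^ n) two_pos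
  set x := (-(s : ℂ) + δ) / 2 with hx
  set y := (-(s : ℂ) - δ) / 2 with hy
  have h1 : x + y = - s := by rw [hx, hy]; ring
  have h2 : x * y = (p : ℂ) ^ n := by
    rw [hx, hy]; linear_combination (-1/4 : ℂ) * hδ
  have h4 : V.valuation (x * y) < 1 := by
    rw [h2, map_pow]; exact pow_lt_one₀ zero_le hV hn.ne'
  have h3 : V.valuation x < 1 ∨ V.valuation y < 1 := by
    by_contra hcon
    push Not at hcon
    rw [map_mul] at h4
    exact absurd h4 (not_lt.2 (one_le_mul hcon.1 hcon.2))
  rcases h3 with h | h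
  · exact ⟨⟨p, n, s, hp, hn, hs, hs4, x, y, h1, h2, V, hV, h⟩, rfl, rfl, rfl⟩
  · exact ⟨⟨p, n, s, hp, hn, hs, hs4, y, x, by rw [add_comm, h1], by rw [mul_comm, h2], V, hV, h⟩,
      rfl, rfl, rfl⟩

end St16

theorem stmt16 (q d : ℕ) (hd : 0 < d) (hq : IsPrimePow q) (hbig : 56 * d ^ 2 < q)
    (hqd : Nat.Prime q ∨ (IsSquare q ∧ Nat.Coprime q d))
    (Fq : Type*) [Field Fq] [Fintype Fq] (hcard : Fintype.card Fq = q) :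
    ∃ E : WeierstrassCurve Fq, E.IsElliptic ∧
      Nat.card E.toAffine.Point = q + 1 + (Nat.sqrt (4 * q) - d) := by
  obtain ⟨p, n, hp', hn, hpn⟩ := hq
  have hp := hp'.nat_prime
  have hd2 : d ≤ d ^ 2 := Nat.le_self_pow two_ne_zero d
  have hlt : d < Nat.sqrt (4 * q) := Nat.le_sqrt.2 (by nlinarith)
  have hle : Nat.sqrt (4 * q) ≤ q := by
    have := Nat.sqrt_le (4 * q)
    by_contra hcon
    push Not at hcon
    nlinarith
  have hs4 : (Nat.sqrt (4 * q) - d) ^ 2 < 4 * p ^ n := by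
    rw [hpn]
    have h1 := Nat.sqrt_le' (4 * q)
    have h2 : Nat.sqrt (4 * q) - d < Nat.sqrt (4 * q) := by omega
    exact lt_of_lt_of_le (Nat.pow_lt_pow_left h2 two_ne_zero) h1
  have hs : ¬ p ∣ Nat.sqrt (4 * q) - d := by
    intro hdvd
    rcases hqd with h | ⟨⟨m, hm⟩, hco⟩
    · have h1 : p = q := by
        have : p ∣ q := by rw [← hpn]; exact dvd_pow_self p hn.ne'
        exact (Nat.prime_dvd_prime_iff_eq hp h).1 this
      have := Nat.le_of_dvd (by omega) hdvd
      omega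
    · have h1 : Nat.sqrt (4 * q) = 2 * m := by
        rw [show 4 * q = (2 * m) * (2 * m) by rw [hm]; ring, Nat.sqrt_eq]
      have hpq : p ∣ q := by rw [← hpn]; exact dvd_pow_self p hn.ne'
      have hpm : p ∣ m := by
        rw [hm] at hpq
        exact (hp.dvd_mul.1 hpq).elim id id
      rw [h1] at hdvd hlt
      have h2 : p ∣ d := (Nat.dvd_sub_iff_right hlt.le (hpm.mul_left 2)).1 hdvd
      exact hp.one_lt.ne' (Nat.dvd_one.1 (hco ▸ Nat.dvd_gcd hpq h2))
  obtain ⟨D, e1, e2, e3⟩ := St16.exists_Dat hp hn hs hs4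
  have hDq : D.q = q := by rw [St16.Dat.q, e1, e2, hpn]
  have hsq : D.s ≤ D.q := by rw [hDq, e3]; omega
  rw [← hDq] at hcard
  have : ∃ E : WeierstrassCurve Fq, E.IsElliptic ∧
      Nat.card E.toAffine.Point = D.q + 1 + D.s := by
    rcases hp.eq_two_or_odd' with h | h
    · exact D.two_curve (by rw [e1, h]) hsq Fq hcard
    · exact D.odd_curve (by rw [e1]; exact h) hsq Fq hcard
  rwa [hDq, e3] at this
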